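/- For any quasi-compact quasi-separated scheme X, the category D_qc(X) has a perfect generator: there exists a perfect O_X-complex S such that for every nonzero object E of D_qc(X) there are an integer n and a nonzero morphism S[n] → E in D_qc(X). -/

import Mathlib

/-!
Setup for statements about a (quasi-compact, quasi-separated) scheme `X`:

* `X.Modules` is the abelian category of sheaves of `O_X`-modules;
* for `U : X.Opens`, `ModOver X U` is the category of `O_U`-modules (sheaves of modules
  over the restriction of the structure sheaf to the localized site at `U`), and
  `restrictComplex X U` restricts complexes of `O_X`-modules to `U`;
* `D(X)` is `DerivedCategory X.Modules`, and `D_qc(X)` consists of the objects all of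
  whose homology sheaves are quasi-coherent;
* `StrictlyPerfect` means a bounded complex of finite-rank free modules;
* `IsNIsoD n ξ` says that `ξ` is an `n`-isomorphism: `H^j(ξ)` is invertible for `j > n`
  and surjective (epi) for `j = n`;
* `IsPseudoCoherent X n E` says that, locally on some open cover, `E` admits an
  `n`-isomorphism from a strictly perfect complex, and `IsPerfect X E` says that `E` is
  locally `D`-isomorphic to a strictly perfect complex.
-/

open CategoryTheory CategoryTheory.Limits AlgebraicGeometry TopologicalSpace

universe u

noncomputable section

namespace LN

variable (X : Scheme.{u})

/-- The category of `O_U`-modules, for an open `U` of the scheme `X`. -/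
abbrev ModOver (U : X.Opens) : Type (u + 1) :=
  SheafOfModules.{u} (X.ringCatSheaf.over U)

/-- Restriction of sheaves of `O_X`-modules to an open `U`. -/
abbrev restrictionFunctor (U : X.Opens) : X.Modules ⥤ ModOver X U :=
  SheafOfModules.pushforward (𝟙 _)

instance (U : X.Opens) : (restrictionFunctor X U).Additive := by
  constructor; intro A B f g; ext1; ext1; rfl

/-- Restriction of complexes of `O_X`-modules to an open `U`. -/
abbrev restrictComplex (U : X.Opens) :
    CochainComplex X.Modules ℤ ⥤ CochainComplex (ModOver X U) ℤ :=
  (restrictionFunctor X U).mapHomologicalComplex _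

/-- A strictly perfect complex on `U`: a bounded complex of finite-rank free modules. -/
def StrictlyPerfect (U : X.Opens) (P : CochainComplex (ModOver X U) ℤ) : Prop :=
  (∃ a b : ℤ, ∀ i : ℤ, (i < a ∨ b < i) → IsZero (P.X i)) ∧
    ∀ i : ℤ, ∃ k : ℕ, Nonempty (P.X i ≅ SheafOfModules.free (ULift.{u} (Fin k)))

/-- `ξ` is an `n`-isomorphism: `H^j(ξ)` is bijective for `j > n` and surjective
for `j = n`. -/
def IsNIsoD {C : Type u₁} [Category.{v₁} C] [Abelian C] [HasDerivedCategory.{w₁} C]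
    (n : ℤ) {P E : DerivedCategory C} (ξ : P ⟶ E) : Prop :=
  (∀ j : ℤ, n < j → IsIso ((DerivedCategory.homologyFunctor C j).map ξ)) ∧
    Epi ((DerivedCategory.homologyFunctor C n).map ξ)

/-- `E` is an `n`-pseudo-coherent complex of `O_X`-modules: on each member `U α` of some
open cover of `X` there is an `n`-isomorphism `P ⟶ E|_{U α}` in `D(U α)` with `P`
strictly perfect. -/
def IsPseudoCoherent [∀ U : X.Opens, HasDerivedCategory.{u + 1} (ModOver X U)]
    (n : ℤ) (E : CochainComplex X.Modules ℤ) : Prop :=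
  ∃ (ι : Type u) (U : ι → X.Opens),
    iSup U = ⊤ ∧
    ∀ α : ι, ∃ P : CochainComplex (ModOver X (U α)) ℤ,
      StrictlyPerfect X (U α) P ∧
      ∃ ξ : DerivedCategory.Q.obj P ⟶ DerivedCategory.Q.obj ((restrictComplex X (U α)).obj E),
        IsNIsoD n ξ

/-- `E` is a perfect complex of `O_X`-modules: locally on some open cover of `X`, it is
`D`-isomorphic to a strictly perfect complex. -/
def IsPerfect [∀ U : X.Opens, HasDerivedCategory.{u + 1} (ModOver X U)]
    (E : CochainComplex X.Modules ℤ) : Prop :=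
  ∃ (ι : Type u) (U : ι → X.Opens),
    iSup U = ⊤ ∧
    ∀ α : ι, ∃ P : CochainComplex (ModOver X (U α)) ℤ,
      StrictlyPerfect X (U α) P ∧
      Nonempty
        (DerivedCategory.Q.obj ((restrictComplex X (U α)).obj E) ≅ DerivedCategory.Q.obj P)

/-- The complex `E` lies in `D_qc(X)`: all its homology sheaves are quasi-coherent. -/
def MemDqc (E : CochainComplex X.Modules ℤ) : Prop :=
  ∀ n : ℤ, (E.homology n).IsQuasicoherent

end LN

namespace LN

set_option linter.unusedSectionVars false

section

instance modules_ab5 (X : Scheme.{u}) : AB5 X.Modules := by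
  refine ⟨fun J _ _ => ?_⟩
  have : ReflectsFiniteLimits (PresheafOfModules.toPresheaf.{u} X.ringCatSheaf.obj) :=
    ⟨fun J _ _ => inferInstance⟩
  have : HasExactColimitsOfShape J (PresheafOfModules.{u} X.ringCatSheaf.obj) :=
    .domain_of_functor J (PresheafOfModules.toPresheaf.{u} X.ringCatSheaf.obj)
  exact (PresheafOfModules.sheafificationAdjunction
    (𝟙 X.ringCatSheaf.obj)).hasExactColimitsOfShape J

instance modules_hasSeparator (X : Scheme.{u}) : HasSeparator X.Modules := by
  let adj := PresheafOfModules.sheafificationAdjunction (𝟙 X.ringCatSheaf.obj)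
  let G : X.Opens → X.Modules := fun U => (PresheafOfModules.sheafification
    (𝟙 X.ringCatSheaf.obj)).obj ((yoneda ⋙ PresheafOfModules.free X.ringCatSheaf.obj).obj U)
  have hG : ObjectProperty.IsSeparating (.ofObj G) := by
    intro M N f₁ f₂ h
    apply (Scheme.Modules.toPresheafOfModules X).map_injective
    refine PresheafOfModules.freeYoneda.isSeparating X.ringCatSheaf.obj _ _ ?_
    rintro _ ⟨U⟩ g
    have := h (G U) ⟨U⟩ ((adj.homEquiv _ M).symm g)
    have e₁ := adj.homEquiv_naturality_right ((adj.homEquiv _ M).symm g) f₁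
    have e₂ := adj.homEquiv_naturality_right ((adj.homEquiv _ M).symm g) f₂
    have e := e₁.symm.trans ((congrArg (adj.homEquiv _ N) this).trans e₂)
    erw [Equiv.apply_symm_apply] at e
    exact e
  exact ⟨_, hG.isSeparator_coproduct⟩

instance modules_isGrothendieckAbelian (X : Scheme.{u}) :
    IsGrothendieckAbelian.{u} X.Modules where

instance modules_enoughInjectives (X : Scheme.{u}) : EnoughInjectives X.Modules :=
  inferInstance

end

section

open Opposite

variable {X : Scheme.{u}}

/-- Restriction of sections of a sheaf of modules to a smaller open. -/
def rs {F : X.Modules} {U V : X.Opens} (h : V ≤ U) : Γ(F, U) →+ Γ(F, V) :=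
  (F.presheaf.map (homOfLE h).op).hom

/-- Restriction of functions to a smaller open. -/
def rf {U V : X.Opens} (h : V ≤ U) : Γ(X, U) →+* Γ(X, V) :=
  (X.presheaf.map (homOfLE h).op).hom

section
variable {F G H : X.Modules} {U V W : X.Opens}

@[simp] lemma rs_self (s : Γ(F, U)) (h : U ≤ U) : rs h s = s := by
  have := congr($(F.presheaf.map_id (op U)) s)
  exact this

@[simp] lemma rs_rs (h : V ≤ U) (h' : W ≤ V) (s : Γ(F, U)) :
    rs h' (rs h s) = rs (h'.trans h) s := by
  have := congr($(F.presheaf.map_comp (homOfLE h).op (homOfLE h').op) s)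
  exact this.symm

@[simp] lemma rf_self (s : Γ(X, U)) (h : U ≤ U) : rf h s = s := by
  have := congr($(X.presheaf.map_id (op U)) s)
  exact this

@[simp] lemma rf_rf (h : V ≤ U) (h' : W ≤ V) (s : Γ(X, U)) :
    rf h' (rf h s) = rf (h'.trans h) s := by
  have := congr($(X.presheaf.map_comp (homOfLE h).op (homOfLE h').op) s)
  exact this.symm

@[simp] lemma rs_smul (h : V ≤ U) (r : Γ(X, U)) (s : Γ(F, U)) :
    rs h (r • s) = rf h r • rs h s :=
  Scheme.Modules.map_smul F (homOfLE h) r s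

lemma app_rs (φ : F ⟶ G) (h : V ≤ U) (s : Γ(F, U)) :
    φ.app V (rs h s) = rs h (φ.app U s) := by
  have := congr($(φ.mapPresheaf.naturality (homOfLE h).op) s)
  exact this

lemma app_comp (φ : F ⟶ G) (ψ : G ⟶ H) (s : Γ(F, U)) :
    (φ ≫ ψ).app U s = ψ.app U (φ.app U s) := rfl

lemma hom_ext' {φ ψ : F ⟶ G} (h : ∀ U (s : Γ(F, U)), φ.app U s = ψ.app U s) : φ = ψ :=
  Scheme.Modules.hom_ext _ _ fun U => by ext s; exact h U s

/-- A section which vanishes in a neighbourhood of every point is zero. -/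
lemma eq_zero_of_locally (s : Γ(F, U))
    (h : ∀ x ∈ U, ∃ (V : X.Opens) (hV : V ≤ U), x ∈ V ∧ rs hV s = 0) : s = 0 := by
  choose V hV hx h0 using h
  refine TopCat.Sheaf.eq_of_locally_eq' ⟨F.presheaf, F.isSheaf⟩
    (fun x : U => V x.1 x.2) U (fun x => homOfLE (hV x.1 x.2)) ?_ s 0 ?_
  · intro x hx'
    exact Opens.mem_iSup.mpr ⟨⟨x, hx'⟩, hx x hx'⟩
  · rintro ⟨x, hx'⟩
    refine (h0 x hx').trans ?_
    exact (map_zero (rs (F := F) (hV x hx'))).symm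

/-- A family of submodules of sections, stable under restriction and of local nature. -/
structure LocSub (F : X.Modules) where
  obj (U : X.Opens) : Submodule Γ(X, U) Γ(F, U)
  map {U V : X.Opens} (h : V ≤ U) {s : Γ(F, U)} : s ∈ obj U → rs h s ∈ obj V
  loc {U : X.Opens} {s : Γ(F, U)} :
    (∀ x ∈ U, ∃ (V : X.Opens) (hV : V ≤ U), x ∈ V ∧ rs hV s ∈ obj V) → s ∈ obj U

namespace LocSub

/-- The underlying submodule of presheaves. -/
def toSub (P : LocSub F) : PresheafOfModules.Submodule F.val where
  obj U := P.obj U.unop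
  map f := fun _ hs => P.map (leOfHom f.unop) hs

/-- The subsheaf given by a local family of submodules. -/
def sheaf (P : LocSub F) : X.Modules where
  val := P.toSub.toPresheafOfModules
  isSheaf := by
    have : TopCat.Presheaf.IsSheaf P.toSub.toPresheafOfModules.presheaf := by
      rw [TopCat.Presheaf.isSheaf_iff_isSheafUniqueGluing]
      intro ι U sf hsf
      have hF := TopCat.Sheaf.existsUnique_gluing ⟨F.presheaf, F.isSheaf⟩ U
        (fun i => (sf i).1) ?_
      · obtain ⟨s, hs, hu⟩ := hF
        have hmem : s ∈ P.obj (iSup U) := by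
          apply P.loc
          intro x hx
          obtain ⟨i, hi⟩ := Opens.mem_iSup.mp hx
          refine ⟨U i, le_iSup U i, hi, ?_⟩
          have : rs (le_iSup U i) s = (sf i).1 := hs i
          rw [this]
          exact (sf i).2
        refine ⟨⟨s, hmem⟩, fun i => Subtype.ext (hs i), ?_⟩
        intro t ht
        exact Subtype.ext (hu t.1 fun i => congrArg Subtype.val (ht i))
      · intro i j
        exact congrArg Subtype.val (hsf i j)
    exact this

/-- The inclusion of the subsheaf. -/
def ι (P : LocSub F) : P.sheaf ⟶ F := ⟨P.toSub.ι⟩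

lemma ι_mem (P : LocSub F) (s : Γ(P.sheaf, U)) : P.ι.app U s ∈ P.obj U := s.2

lemma ι_inj (P : LocSub F) (s t : Γ(P.sheaf, U)) (h : P.ι.app U s = P.ι.app U t) : s = t :=
  Subtype.ext h

lemma exists_ι (P : LocSub F) {s : Γ(F, U)} (hs : s ∈ P.obj U) :
    ∃ t : Γ(P.sheaf, U), P.ι.app U t = s := ⟨⟨s, hs⟩, rfl⟩

/-- The lift of a morphism to a subsheaf. -/
def lift (P : LocSub F) (φ : G ⟶ F) (h : ∀ U (s : Γ(G, U)), φ.app U s ∈ P.obj U) :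
    G ⟶ P.sheaf :=
  ⟨PresheafOfModules.homMk (M₁ := G.val) (M₂ := P.toSub.toPresheafOfModules)
    { app := fun U => AddCommGrpCat.ofHom (X := Γ(G, U.unop)) (Y := P.obj U.unop)
        (AddMonoidHom.mk' (fun s => ⟨φ.app U.unop s, h _ s⟩)
          fun a b => Subtype.ext (map_add (φ.app U.unop).hom a b))
      naturality := fun U V f => by
        ext s
        exact Subtype.ext (app_rs φ (leOfHom f.unop) s) }
    (fun U r s => Subtype.ext (Scheme.Modules.Hom.app_smul φ r s))⟩

lemma lift_ι (P : LocSub F) (φ : G ⟶ F) (h : ∀ U (s : Γ(G, U)), φ.app U s ∈ P.obj U) :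
    P.lift φ h ≫ P.ι = φ := rfl

instance (P : LocSub F) : Mono P.ι := by
  constructor
  intro Z a b h
  apply hom_ext'
  intro U s
  apply P.ι_inj
  rw [← app_comp, ← app_comp, h]

lemma obj_eq_top_of_isIso (P : LocSub F) [IsIso P.ι] (s : Γ(F, U)) : s ∈ P.obj U := by
  have : s = P.ι.app U ((inv P.ι).app U s) := by
    rw [← app_comp, IsIso.inv_hom_id]; rfl
  rw [this]
  exact P.ι_mem _

end LocSub

/-- The image subsheaf. -/
def imageSub (φ : F ⟶ G) : LocSub G where
  obj U :=
    { carrier := {s | ∀ x ∈ U, ∃ (V : X.Opens) (hV : V ≤ U), x ∈ V ∧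
        ∃ t : Γ(F, V), φ.app V t = rs hV s}
      zero_mem' := fun x hx => ⟨U, le_rfl, hx, 0, by simp⟩
      add_mem' := by
        intro a b ha hb x hx
        obtain ⟨V, hV, hxV, t, ht⟩ := ha x hx
        obtain ⟨V', hV', hxV', t', ht'⟩ := hb x hx
        refine ⟨V ⊓ V', inf_le_left.trans hV, ⟨hxV, hxV'⟩,
          rs inf_le_left t + rs inf_le_right t', ?_⟩
        rw [map_add, map_add, app_rs, app_rs, ht, ht', rs_rs, rs_rs]
      smul_mem' := by
        intro r a ha x hx
        obtain ⟨V, hV, hxV, t, ht⟩ := ha x hx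
        refine ⟨V, hV, hxV, rf hV r • t, ?_⟩
        rw [Scheme.Modules.Hom.app_smul, ht, rs_smul] }
  map {U V} h s hs := by
    intro x hx
    obtain ⟨V', hV', hxV', t, ht⟩ := hs x (h hx)
    refine ⟨V ⊓ V', inf_le_left, ⟨hx, hxV'⟩, rs inf_le_right t, ?_⟩
    rw [app_rs, ht, rs_rs, rs_rs]
  loc {U s} hs := by
    intro x hx
    obtain ⟨V, hV, hxV, h⟩ := hs x hx
    obtain ⟨V', hV', hxV', t, ht⟩ := h x hxV
    exact ⟨V', hV'.trans hV, hxV', t, by rw [ht, rs_rs]⟩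

/-- Epimorphisms of sheaves of modules are locally surjective. -/
lemma locally_surjective (φ : F ⟶ G) [Epi φ] (s : Γ(G, U)) {x : X} (hx : x ∈ U) :
    ∃ (V : X.Opens) (hV : V ≤ U), x ∈ V ∧ ∃ t : Γ(F, V), φ.app V t = rs hV s := by
  have hψ := (imageSub φ).lift_ι φ (fun U s x hx => ⟨U, le_rfl, hx, s, by simp⟩)
  have : Epi (imageSub φ).ι := epi_of_epi_fac hψ
  have : IsIso (imageSub φ).ι := isIso_of_mono_of_epi _
  exact (imageSub φ).obj_eq_top_of_isIso s x hx

lemma epi_of_locally_surjective (φ : F ⟶ G)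
    (h : ∀ U (s : Γ(G, U)), ∀ x ∈ U, ∃ (V : X.Opens) (hV : V ≤ U), x ∈ V ∧
      ∃ t : Γ(F, V), φ.app V t = rs hV s) : Epi φ := by
  rw [Preadditive.epi_iff_cancel_zero]
  intro H ψ hψ
  apply hom_ext'
  intro U s
  apply eq_zero_of_locally
  intro x hx
  obtain ⟨V, hV, hxV, t, ht⟩ := h U s x hx
  refine ⟨V, hV, hxV, ?_⟩
  rw [← app_rs, ← ht, ← app_comp, hψ]
  rfl

/-- Sections over an open, as a functor to abelian groups. -/
def secFunctor (U : X.Opens) : X.Modules ⥤ Ab :=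
  Scheme.Modules.toPresheaf X ⋙ (evaluation _ _).obj (op U)

instance (U : X.Opens) : PreservesFiniteLimits (secFunctor (X := X) U) :=
  have : PreservesFiniteLimits ((evaluation (Opens ↥X)ᵒᵖ Ab.{u}).obj (op U)) :=
    ⟨fun _ _ _ => evaluation_preservesLimitsOfShape _⟩
  comp_preservesFiniteLimits _ _

instance (U : X.Opens) : (secFunctor (X := X) U).Additive where

lemma injective_of_mono (φ : F ⟶ G) [Mono φ] (s : Γ(F, U)) (h : φ.app U s = 0) : s = 0 := by
  have : Mono ((secFunctor U).map φ) := inferInstance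
  exact (injective_iff_map_eq_zero ((secFunctor U).map φ).hom).mp
    ((AddCommGrpCat.mono_iff_injective _).mp this) s h

lemma mono_of_injective (φ : F ⟶ G) (h : ∀ U (s : Γ(F, U)), φ.app U s = 0 → s = 0) : Mono φ := by
  rw [Preadditive.mono_iff_cancel_zero]
  intro H ψ hψ
  apply hom_ext'
  intro U s
  apply h
  rw [← app_comp, hψ]
  rfl

lemma exists_kernel (φ : F ⟶ G) (s : Γ(F, U)) (h : φ.app U s = 0) :
    ∃ t : Γ(kernel φ, U), (kernel.ι φ).app U t = s := by
  let S : ShortComplex X.Modules := ShortComplex.mk (kernel.ι φ) φ (kernel.condition φ)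
  have hS : S.Exact := ShortComplex.exact_kernel φ
  have hm : Mono S.f := inferInstanceAs (Mono (kernel.ι φ))
  have := hS.map_of_mono_of_preservesKernel (secFunctor U) hm inferInstance
  rw [ShortComplex.ab_exact_iff] at this
  exact this s h

/-- Exact sequences of sheaves are locally exact on sections. -/
lemma exact_locally {S : ShortComplex X.Modules} (hS : S.Exact) (s : Γ(S.X₂, U))
    (h : S.g.app U s = 0) {x : X} (hx : x ∈ U) :
    ∃ (V : X.Opens) (hV : V ≤ U), x ∈ V ∧ ∃ t : Γ(S.X₁, V), S.f.app V t = rs hV s := by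
  rw [ShortComplex.exact_iff_epi_kernel_lift] at hS
  obtain ⟨t, ht⟩ := exists_kernel S.g s h
  obtain ⟨V, hV, hxV, t', ht'⟩ := locally_surjective (kernel.lift S.g S.f S.zero) t hx
  refine ⟨V, hV, hxV, t', ?_⟩
  rw [← ht, ← app_rs, ← ht', ← app_comp, kernel.lift_ι]

lemma exact_of_locally {S : ShortComplex X.Modules}
    (h : ∀ U (s : Γ(S.X₂, U)), S.g.app U s = 0 → ∀ x ∈ U, ∃ (V : X.Opens) (hV : V ≤ U), x ∈ V ∧
      ∃ t : Γ(S.X₁, V), S.f.app V t = rs hV s) : S.Exact := by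
  rw [ShortComplex.exact_iff_epi_kernel_lift]
  apply epi_of_locally_surjective
  intro U s x hx
  obtain ⟨V, hV, hxV, t, ht⟩ := h U ((kernel.ι S.g).app U s)
    (by rw [← app_comp, kernel.condition]; rfl) x hx
  refine ⟨V, hV, hxV, t, ?_⟩
  rw [← sub_eq_zero]
  apply injective_of_mono (kernel.ι S.g)
  rw [map_sub, ← app_comp, kernel.lift_ι, ht, app_rs, sub_self]

lemma isIso_of_locally (φ : F ⟶ G) (hi : ∀ U (s : Γ(F, U)), φ.app U s = 0 → s = 0)
    (hs : ∀ U (s : Γ(G, U)), ∀ x ∈ U, ∃ (V : X.Opens) (hV : V ≤ U), x ∈ V ∧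
      ∃ t : Γ(F, V), φ.app V t = rs hV s) : IsIso φ := by
  have := mono_of_injective φ hi
  have := epi_of_locally_surjective φ hs
  exact isIso_of_mono_of_epi φ

end

end

section

open Opposite

variable {X : Scheme.{u}} {F G H : X.Modules} {U V W : X.Opens}

/-- All sections of `F` vanish near every point of `A`. -/
def Vanishes (A : Set X) (F : X.Modules) : Prop :=
  ∀ (U : X.Opens) (s : Γ(F, U)), ∀ x ∈ U, x ∈ A →
    ∃ (V : X.Opens) (hV : V ≤ U), x ∈ V ∧ rs hV s = 0

lemma Vanishes.mono {A B : Set X} (h : Vanishes A F) (hAB : B ⊆ A) : Vanishes B F :=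
  fun U s x hx hxB => h U s x hx (hAB hxB)

lemma Vanishes.union {A B : Set X} (hA : Vanishes A F) (hB : Vanishes B F) :
    Vanishes (A ∪ B) F := by
  rintro U s x hx (h | h)
  · exact hA U s x hx h
  · exact hB U s x hx h

lemma Vanishes.isZero (h : Vanishes Set.univ F) : IsZero F := by
  rw [IsZero.iff_id_eq_zero]
  apply hom_ext'
  intro U s
  exact eq_zero_of_locally s fun x hx => h U s x hx trivial

lemma vanishes_of_isZero (A : Set X) (h : IsZero F) : Vanishes A F := by
  intro U s x hx _
  refine ⟨U, le_rfl, hx, ?_⟩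
  have := congr(($((IsZero.iff_id_eq_zero F).mp h)).app U s)
  rw [rs_self]
  exact this

lemma Vanishes.of_exact {A : Set X} {S : ShortComplex X.Modules} (hS : S.Exact)
    (h₁ : Vanishes A S.X₁) (h₃ : Vanishes A S.X₃) : Vanishes A S.X₂ := by
  intro U s x hx hxA
  obtain ⟨V, hV, hxV, h0⟩ := h₃ U (S.g.app U s) x hx hxA
  obtain ⟨V', hV', hxV', t, ht⟩ := exact_locally hS (rs hV s) (by rw [app_rs, h0]) hxV
  obtain ⟨N, hN, hxN, h0'⟩ := h₁ V' t x hxV' hxA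
  refine ⟨N, hN.trans (hV'.trans hV), hxN, ?_⟩
  rw [rs_rs] at ht
  rw [← rs_rs (hV'.trans hV) hN, ← ht, ← app_rs, h0', map_zero]

lemma Vanishes.of_mono {A : Set X} (φ : F ⟶ G) [Mono φ] (h : Vanishes A G) : Vanishes A F := by
  intro U s x hx hxA
  obtain ⟨V, hV, hxV, h0⟩ := h U (φ.app U s) x hx hxA
  exact ⟨V, hV, hxV, injective_of_mono φ _ (by rw [app_rs, h0])⟩

lemma Vanishes.of_epi {A : Set X} (φ : F ⟶ G) [Epi φ] (h : Vanishes A F) : Vanishes A G := by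
  intro U s x hx hxA
  obtain ⟨V, hV, hxV, t, ht⟩ := locally_surjective φ s hx
  obtain ⟨N, hN, hxN, h0⟩ := h V t x hxV hxA
  refine ⟨N, hN.trans hV, hxN, ?_⟩
  rw [← rs_rs hV hN, ← ht, ← app_rs, h0, map_zero]

lemma Vanishes.of_iso {A : Set X} (e : F ≅ G) (h : Vanishes A F) : Vanishes A G :=
  h.of_epi e.hom

/-- Sections supported on `V`. -/
def extSub (V : X.Opens) (F : X.Modules) : LocSub F where
  obj U :=
    { carrier := {s | ∀ x ∈ U, x ∉ V →
        ∃ (N : X.Opens) (hN : N ≤ U), x ∈ N ∧ rs hN s = 0}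
      zero_mem' := fun x hx _ => ⟨U, le_rfl, hx, by simp⟩
      add_mem' := by
        intro a b ha hb x hx hxV
        obtain ⟨N, hN, hxN, h0⟩ := ha x hx hxV
        obtain ⟨N', hN', hxN', h0'⟩ := hb x hx hxV
        refine ⟨N ⊓ N', inf_le_left.trans hN, ⟨hxN, hxN'⟩, ?_⟩
        rw [map_add, ← rs_rs hN inf_le_left, h0, ← rs_rs hN' inf_le_right, h0']
        simp
      smul_mem' := by
        intro r a ha x hx hxV
        obtain ⟨N, hN, hxN, h0⟩ := ha x hx hxV
        refine ⟨N, hN, hxN, ?_⟩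
        rw [rs_smul, h0, smul_zero] }
  map {U U'} h s hs := by
    intro x hx hxV
    obtain ⟨N, hN, hxN, h0⟩ := hs x (h hx) hxV
    refine ⟨N ⊓ U', inf_le_right, ⟨hxN, hx⟩, ?_⟩
    rw [rs_rs, ← rs_rs hN inf_le_left, h0, map_zero]
  loc {U s} hs := by
    intro x hx hxV
    obtain ⟨N, hN, hxN, h⟩ := hs x hx
    obtain ⟨N', hN', hxN', h0⟩ := h x hxN hxV
    exact ⟨N', hN'.trans hN, hxN', by rw [← h0, rs_rs]⟩

lemma mem_extSub_of_le {s : Γ(F, U)} (h : U ≤ V) : s ∈ (extSub V F).obj U :=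
  fun _ hx hxV => (hxV (h hx)).elim

lemma app_mem_extSub (φ : F ⟶ G) {s : Γ(F, U)} (hs : s ∈ (extSub V F).obj U) :
    φ.app U s ∈ (extSub V G).obj U := by
  intro x hx hxV
  obtain ⟨N, hN, hxN, h0⟩ := hs x hx hxV
  exact ⟨N, hN, hxN, by rw [← app_rs, h0, map_zero]⟩

lemma eq_zero_of_mem_extSub {s : Γ(F, U)} (hs : s ∈ (extSub V F).obj U)
    (h : rs (inf_le_left : U ⊓ V ≤ U) s = 0) : s = 0 := by
  apply eq_zero_of_locally
  intro x hx
  by_cases hxV : x ∈ V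
  · exact ⟨U ⊓ V, inf_le_left, ⟨hx, hxV⟩, h⟩
  · exact hs x hx hxV

/-- The extension by zero of a sheaf. -/
def extObj (V : X.Opens) (F : X.Modules) : X.Modules := (extSub V F).sheaf

/-- The inclusion of the extension by zero of a sheaf. -/
def extObjι (V : X.Opens) (F : X.Modules) : extObj V F ⟶ F := (extSub V F).ι

instance (V : X.Opens) (F : X.Modules) : Mono (extObjι V F) :=
  LocSub.instMonoModulesι _

/-- Lifting a morphism to the extension by zero. -/
def extLift (φ : G ⟶ F) (h : ∀ U (s : Γ(G, U)), φ.app U s ∈ (extSub V F).obj U) :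
    G ⟶ extObj V F := (extSub V F).lift φ h

@[simp]
lemma extLift_ι (φ : G ⟶ F) (h : ∀ U (s : Γ(G, U)), φ.app U s ∈ (extSub V F).obj U) :
    extLift φ h ≫ extObjι V F = φ := LocSub.lift_ι _ _ _

lemma extι_mem (s : Γ(extObj V F, U)) :
    (extObjι V F).app U s ∈ (extSub V F).obj U := LocSub.ι_mem _ s

lemma exists_extι {s : Γ(F, U)} (hs : s ∈ (extSub V F).obj U) :
    ∃ t : Γ(extObj V F, U), (extObjι V F).app U t = s := LocSub.exists_ι _ hs

lemma extι_inj {s t : Γ(extObj V F, U)}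
    (h : (extObjι V F).app U s = (extObjι V F).app U t) : s = t :=
  LocSub.ι_inj _ _ _ h

/-- The functoriality of the extension by zero. -/
def extMap (V : X.Opens) (φ : F ⟶ G) : extObj V F ⟶ extObj V G :=
  extLift (extObjι V F ≫ φ) fun _ s => app_mem_extSub φ (extι_mem s)

@[simp]
lemma extMap_ι (φ : F ⟶ G) : extMap V φ ≫ extObjι V G = extObjι V F ≫ φ :=
  extLift_ι _ _

@[simp]
lemma extMap_ι_assoc (φ : F ⟶ G) (ψ : G ⟶ H) :
    extMap V φ ≫ extObjι V G ≫ ψ = extObjι V F ≫ φ ≫ ψ := by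
  rw [← Category.assoc, extMap_ι, Category.assoc]

lemma extι_map (φ : F ⟶ G) (s : Γ(extObj V F, U)) :
    (extObjι V G).app U ((extMap V φ).app U s) = φ.app U ((extObjι V F).app U s) := by
  rw [← app_comp, extMap_ι]; rfl

/-- The extension by zero `j_! j^*` for an open `V`. -/
@[simps]
def extF (V : X.Opens) : X.Modules ⥤ X.Modules where
  obj F := extObj V F
  map φ := extMap V φ
  map_id F := by simp [← cancel_mono (extObjι V F)]
  map_comp {F G H} φ ψ := by simp [← cancel_mono (extObjι V H)]

/-- The inclusion of the extension by zero. -/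
@[simps]
def extι (V : X.Opens) : extF V ⟶ 𝟭 X.Modules where
  app F := extObjι V F
  naturality _ _ φ := extMap_ι φ

instance (V : X.Opens) : (extF V).Additive where
  map_add {F G f g} := by
    change extMap V (f + g) = extMap V f + extMap V g
    rw [← cancel_mono (extObjι V G)]
    simp

lemma extF_vanishes (V : X.Opens) (F : X.Modules) :
    Vanishes (V : Set X)ᶜ (extObj V F) := by
  intro U s x hx hxV
  obtain ⟨N, hN, hxN, h0⟩ := extι_mem s x hx hxV
  refine ⟨N, hN, hxN, extι_inj ?_⟩
  rw [app_rs, h0, map_zero]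

lemma extF_vanishes_of_vanishes {A : Set X} (h : Vanishes A F) (V : X.Opens) :
    Vanishes A (extObj V F) :=
  h.of_mono (extObjι V F)

lemma extMap_exact (V : X.Opens) (S : ShortComplex X.Modules) (hS : S.Exact)
    (s : Γ(extObj V S.X₂, U)) (hs : (extMap V S.g).app U s = 0) {x : X} (hx : x ∈ U) :
    ∃ (N : X.Opens) (hN : N ≤ U), x ∈ N ∧
      ∃ t : Γ(extObj V S.X₁, N), (extMap V S.f).app N t = rs hN s := by
  by_cases hxV : x ∈ V
  · obtain ⟨N, hN, hxN, t, ht⟩ := exact_locally hS ((extObjι V _).app U s)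
      (by rw [← extι_map, hs, map_zero]) hx
    obtain ⟨t', ht'⟩ := exists_extι (V := V) (s := rs (inf_le_left : N ⊓ V ≤ N) t)
      (mem_extSub_of_le inf_le_right)
    refine ⟨N ⊓ V, inf_le_left.trans hN, ⟨hxN, hxV⟩, t', extι_inj ?_⟩
    rw [extι_map, ht', app_rs, ht, app_rs, rs_rs]
  · obtain ⟨N, hN, hxN, h0⟩ := extF_vanishes V _ U s x hx hxV
    exact ⟨N, hN, hxN, 0, by rw [h0, map_zero]⟩

lemma extF_exact (V : X.Opens) (S : ShortComplex X.Modules) (hS : S.Exact) :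
    (S.map (extF V)).Exact :=
  exact_of_locally fun _ s hs _ hx => extMap_exact V S hS s hs hx

lemma extF_preserves (V : X.Opens) :
    PreservesFiniteLimits (extF V) ∧ PreservesFiniteColimits (extF V) := by
  have h := (extF V).exact_tfae.out 1 3
  exact h.mp (extF_exact V)

instance (V : X.Opens) : PreservesFiniteLimits (extF V) := (extF_preserves V).1

instance (V : X.Opens) : PreservesFiniteColimits (extF V) := (extF_preserves V).2

lemma isIso_extι_of_vanishes (h : Vanishes (V : Set X)ᶜ F) : IsIso (extObjι V F) := by
  apply isIso_of_locally
  · intro U s hs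
    exact injective_of_mono _ s hs
  · intro U s x hx
    obtain ⟨t, ht⟩ := exists_extι (V := V) (s := s) (fun x hx hxV => h U s x hx hxV)
    exact ⟨U, le_rfl, hx, t, by rw [ht]; exact (rs_self _ _).symm⟩

lemma cokernel_extι_vanishes (V : X.Opens) (F : X.Modules) :
    Vanishes (V : Set X) (cokernel (extObjι V F)) := by
  intro U s x hx hxV
  obtain ⟨N, hN, hxN, t, ht⟩ := locally_surjective (cokernel.π (extObjι V F)) s hx
  obtain ⟨t', ht'⟩ := exists_extι (V := V) (s := rs (inf_le_left : N ⊓ V ≤ N) t)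
      (mem_extSub_of_le inf_le_right)
  refine ⟨N ⊓ V, inf_le_left.trans hN, ⟨hxN, hxV⟩, ?_⟩
  rw [← rs_rs hN inf_le_left, ← ht, ← app_rs, ← ht']
  have := congr(($(cokernel.condition (extObjι V F))).app _ t')
  exact this

/-- The comparison of extensions by zero for nested opens. -/
def extObjLE (h : V ≤ W) (F : X.Modules) : extObj V F ⟶ extObj W F :=
  extLift (extObjι V F) fun _ s x hx hxW => extι_mem s x hx fun hxV => hxW (h hxV)

@[simp]
lemma extObjLE_ι (h : V ≤ W) : extObjLE h F ≫ extObjι W F = extObjι V F :=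
  extLift_ι _ _

@[simp]
lemma extObjLE_ι_assoc (h : V ≤ W) (φ : F ⟶ G) :
    extObjLE h F ≫ extObjι W F ≫ φ = extObjι V F ≫ φ := by
  rw [← Category.assoc, extObjLE_ι]

lemma extι_LE (h : V ≤ W) (s : Γ(extObj V F, U)) :
    (extObjι W F).app U ((extObjLE h F).app U s) = (extObjι V F).app U s := by
  rw [← app_comp, extObjLE_ι]

/-- The comparison of extensions by zero for nested opens, as a natural transformation. -/
@[simps]
def extLE (h : V ≤ W) : extF (X := X) V ⟶ extF W where
  app F := extObjLE h F
  naturality F G φ := by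
    change extMap V φ ≫ extObjLE h G = extObjLE h F ≫ extMap W φ
    rw [← cancel_mono (extObjι W G)]
    simp

end

section

open Opposite

variable {X : Scheme.{u}} {F G H : X.Modules} {U V W : X.Opens}

/-- Morphisms out of an extension by zero are determined over the open. -/
lemma hom_ext_of_le {φ ψ : extObj U F ⟶ G}
    (h : ∀ (W : X.Opens) (_ : W ≤ U) (s : Γ(extObj U F, W)), φ.app W s = ψ.app W s) :
    φ = ψ := by
  rw [← sub_eq_zero]
  apply hom_ext'
  intro W s
  apply eq_zero_of_locally
  intro x hx
  by_cases hxU : x ∈ U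
  · refine ⟨W ⊓ U, inf_le_left, ⟨hx, hxU⟩, ?_⟩
    rw [← app_rs]
    exact (sub_eq_zero.mpr (h _ inf_le_right _) :)
  · obtain ⟨N, hN, hxN, h0⟩ := extF_vanishes U F W s x hx hxU
    exact ⟨N, hN, hxN, by rw [← app_rs, h0, map_zero]⟩

/-- Morphisms of sheaves of modules over the open `U`. -/
structure LocHom (U : X.Opens) (F G : X.Modules) where
  app (W : X.Opens) (h : W ≤ U) : Γ(F, W) →+ Γ(G, W)
  map_smul (W : X.Opens) (h : W ≤ U) (r : Γ(X, W)) (s : Γ(F, W)) : app W h (r • s) = r • app W h s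
  map_rs {V W : X.Opens} (h : W ≤ U) (hV : V ≤ W) (s : Γ(F, W)) :
    app V (hV.trans h) (rs hV s) = rs hV (app W h s)

namespace LocHom

variable (ψ : LocHom U F G)

lemma existsUnique {W : X.Opens} {s : Γ(F, W)} (hs : s ∈ (extSub U F).obj W) :
    ∃! t : Γ(G, W), t ∈ (extSub U G).obj W ∧
      rs (inf_le_left : W ⊓ U ≤ W) t = ψ.app (W ⊓ U) inf_le_right (rs inf_le_left s) := by
  have hloc : ∀ x : W, ∃ (N : X.Opens) (hN : N ≤ W) (t : Γ(G, N)), x.1 ∈ N ∧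
      t ∈ (extSub U G).obj N ∧ rs (inf_le_left : N ⊓ U ≤ N) t =
        ψ.app (N ⊓ U) inf_le_right (rs (inf_le_left.trans hN) s) := by
    rintro ⟨x, hx⟩
    by_cases hxU : x ∈ U
    · refine ⟨W ⊓ U, inf_le_left, ψ.app (W ⊓ U) inf_le_right (rs inf_le_left s), ⟨hx, hxU⟩,
        mem_extSub_of_le inf_le_right, ?_⟩
      rw [← ψ.map_rs, rs_rs]
    · obtain ⟨N, hN, hxN, h0⟩ := hs x hx hxU
      refine ⟨N, hN, 0, hxN, Submodule.zero_mem _, ?_⟩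
      rw [← rs_rs hN inf_le_left, h0]
      simp
  choose N hN t hxN ht hψ using hloc
  obtain ⟨T, hT, hu⟩ := TopCat.Sheaf.existsUnique_gluing' ⟨G.presheaf, G.isSheaf⟩ N W
    (fun x => homOfLE (hN x)) (fun x hx => Opens.mem_iSup.mpr ⟨⟨x, hx⟩, hxN ⟨x, hx⟩⟩) t (by
      intro x y
      change rs (inf_le_left : N x ⊓ N y ≤ N x) (t x) = rs inf_le_right (t y)
      rw [← sub_eq_zero]
      apply eq_zero_of_mem_extSub (V := U)
      · exact Submodule.sub_mem _ ((extSub U G).map _ (ht x)) ((extSub U G).map _ (ht y))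
      · rw [map_sub, rs_rs, rs_rs, sub_eq_zero,
          ← rs_rs (inf_le_left : N x ⊓ U ≤ N x) (inf_le_inf_right U inf_le_left),
          ← rs_rs (inf_le_left : N y ⊓ U ≤ N y) (inf_le_inf_right U inf_le_right), hψ, hψ,
          ← ψ.map_rs, ← ψ.map_rs, rs_rs, rs_rs])
  have hT' : ∀ x, rs (hN x) T = t x := hT
  refine ⟨T, ⟨?_, ?_⟩, ?_⟩
  · exact (extSub U G).loc fun x hx => ⟨N ⟨x, hx⟩, hN _, hxN _, by rw [hT']; exact ht _⟩
  · rw [← sub_eq_zero]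
    apply eq_zero_of_locally
    intro x hx
    refine ⟨N ⟨x, hx.1⟩ ⊓ U, inf_le_inf_right U (hN _), ⟨hxN _, hx.2⟩, ?_⟩
    rw [map_sub, rs_rs, ← ψ.map_rs, rs_rs, sub_eq_zero, ← rs_rs (hN ⟨x, hx.1⟩) inf_le_left, hT', hψ]
  · rintro T' ⟨h1, h2⟩
    refine hu T' fun x => ?_
    change rs (hN x) T' = t x
    rw [← sub_eq_zero]
    apply eq_zero_of_mem_extSub (V := U)
    · exact Submodule.sub_mem _ ((extSub U G).map _ h1) (ht x)
    · rw [map_sub, rs_rs, hψ, sub_eq_zero,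
        ← rs_rs (inf_le_left : W ⊓ U ≤ W) (inf_le_inf_right U (hN x)), h2, ← ψ.map_rs, rs_rs]

/-- The action of a local morphism on sections of the extension by zero. -/
def fn (W : X.Opens) (s : Γ(extObj U F, W)) : Γ(G, W) :=
  (ψ.existsUnique (extι_mem s)).choose

lemma fn_mem (W : X.Opens) (s : Γ(extObj U F, W)) : ψ.fn W s ∈ (extSub U G).obj W :=
  (ψ.existsUnique (extι_mem s)).choose_spec.1.1

lemma rs_fn (W : X.Opens) (s : Γ(extObj U F, W)) :
    rs (inf_le_left : W ⊓ U ≤ W) (ψ.fn W s) =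
      ψ.app (W ⊓ U) inf_le_right (rs inf_le_left ((extObjι U F).app W s)) :=
  (ψ.existsUnique (extι_mem s)).choose_spec.1.2

lemma eq_fn {W : X.Opens} {s : Γ(extObj U F, W)} {t : Γ(G, W)} (ht : t ∈ (extSub U G).obj W)
    (h : rs (inf_le_left : W ⊓ U ≤ W) t =
      ψ.app (W ⊓ U) inf_le_right (rs inf_le_left ((extObjι U F).app W s))) : t = ψ.fn W s :=
  (ψ.existsUnique (extι_mem s)).choose_spec.2 t ⟨ht, h⟩

lemma fn_add (W : X.Opens) (a b : Γ(extObj U F, W)) : ψ.fn W (a + b) = ψ.fn W a + ψ.fn W b := by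
  refine (ψ.eq_fn (Submodule.add_mem _ (ψ.fn_mem _ a) (ψ.fn_mem _ b)) ?_).symm
  rw [map_add, rs_fn, rs_fn, map_add, map_add, map_add]

lemma fn_rs {V W : X.Opens} (h : V ≤ W) (s : Γ(extObj U F, W)) :
    ψ.fn V (rs h s) = rs h (ψ.fn W s) := by
  refine (ψ.eq_fn ((extSub U G).map h (ψ.fn_mem _ s)) ?_).symm
  rw [rs_rs, ← rs_rs inf_le_left (inf_le_inf_right U h), rs_fn, ← ψ.map_rs, app_rs, rs_rs, rs_rs]

lemma fn_smul (W : X.Opens) (r : Γ(X, W)) (s : Γ(extObj U F, W)) :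
    ψ.fn W (r • s) = r • ψ.fn W s := by
  refine (ψ.eq_fn (Submodule.smul_mem ((extSub U G).obj W) r (ψ.fn_mem _ s)) ?_).symm
  rw [rs_smul, rs_fn, Scheme.Modules.Hom.app_smul, rs_smul, ψ.map_smul]

/-- The morphism from the extension by zero induced by a local morphism. -/
def hom : extObj U F ⟶ G :=
  ⟨PresheafOfModules.homMk (M₁ := (extObj U F).val) (M₂ := G.val)
    { app := fun W => AddCommGrpCat.ofHom (X := Γ(extObj U F, W.unop)) (Y := Γ(G, W.unop))
        (AddMonoidHom.mk' (ψ.fn W.unop) (ψ.fn_add W.unop))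
      naturality := fun V W f => by
        ext s
        exact ψ.fn_rs (leOfHom f.unop) s }
    (fun W r s => ψ.fn_smul W.unop r s)⟩

lemma hom_app (W : X.Opens) (s : Γ(extObj U F, W)) : ψ.hom.app W s = ψ.fn W s := rfl

lemma hom_app_of_le {W : X.Opens} (h : W ≤ U) (s : Γ(extObj U F, W)) :
    ψ.hom.app W s = ψ.app W h ((extObjι U F).app W s) := by
  rw [hom_app]
  refine (ψ.eq_fn (mem_extSub_of_le h) ?_).symm
  rw [ψ.map_rs]

end LocHom

/-- The structure sheaf as a module over itself. -/
def OX (X : Scheme.{u}) : X.Modules := SheafOfModules.unit X.ringCatSheaf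

/-- Functions as sections of the structure sheaf. -/
def oo : Γ(X, U) ≃+ Γ(OX X, U) := AddEquiv.refl _

lemma smul_oo (r f : Γ(X, U)) : r • (oo f : Γ(OX X, U)) = oo (r * f) := rfl

lemma rs_oo (h : V ≤ U) (f : Γ(X, U)) : rs h (oo f : Γ(OX X, U)) = oo (rf h f) := rfl

/-- The extension by zero of the structure sheaf. -/
abbrev OE (V : X.Opens) : X.Modules := extObj V (OX X)

/-- The section `1` of `OE V` over `V`. -/
def oneSec (V : X.Opens) : Γ(OE V, V) :=
  (exists_extι (V := V) (s := (oo 1 : Γ(OX X, V))) (mem_extSub_of_le le_rfl)).choose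

lemma ι_oneSec (V : X.Opens) : (extObjι V (OX X)).app V (oneSec V) = oo 1 :=
  (exists_extι (V := V) (s := (oo 1 : Γ(OX X, V))) (mem_extSub_of_le le_rfl)).choose_spec

lemma eq_smul_oneSec {W : X.Opens} (h : W ≤ V) (s : Γ(OE V, W)) :
    ∃ r : Γ(X, W), s = r • rs h (oneSec V) := by
  refine ⟨oo.symm ((extObjι V (OX X)).app W s), extι_inj ?_⟩
  rw [Scheme.Modules.Hom.app_smul, app_rs, ι_oneSec, rs_oo, smul_oo]
  simp

lemma hom_ext_oneSec {φ ψ : OE V ⟶ F} (h : φ.app V (oneSec V) = ψ.app V (oneSec V)) : φ = ψ := by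
  apply hom_ext_of_le
  intro W hW s
  obtain ⟨r, rfl⟩ := eq_smul_oneSec hW s
  rw [Scheme.Modules.Hom.app_smul, Scheme.Modules.Hom.app_smul, app_rs, app_rs, h]

/-- The local morphism given by a section. -/
def secLocHom (t : Γ(F, V)) : LocHom V (OX X) F where
  app W h := AddMonoidHom.mk' (fun f => (oo.symm f : Γ(X, W)) • rs h t)
    fun a b => by rw [map_add, add_smul]
  map_smul W h r s := by
    obtain ⟨f, rfl⟩ := oo.surjective s
    simp [smul_oo, mul_smul]
  map_rs h hV s := by
    obtain ⟨f, rfl⟩ := oo.surjective s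
    simp [rs_oo]

/-- Morphisms from `OE V` are sections over `V`. -/
def secEquiv (V : X.Opens) (F : X.Modules) : (OE V ⟶ F) ≃+ Γ(F, V) where
  toFun φ := φ.app V (oneSec V)
  invFun t := (secLocHom t).hom
  left_inv φ := by
    apply hom_ext_oneSec
    rw [LocHom.hom_app_of_le _ le_rfl, ι_oneSec]
    simp [secLocHom]
  right_inv t := by
    change ((secLocHom t).hom).app V (oneSec V) = t
    rw [LocHom.hom_app_of_le _ le_rfl, ι_oneSec]
    simp [secLocHom]
  map_add' φ ψ := rfl

lemma secEquiv_apply (φ : OE V ⟶ F) : secEquiv V F φ = φ.app V (oneSec V) := rfl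

lemma secEquiv_comp (φ : OE V ⟶ F) (f : F ⟶ G) :
    secEquiv V G (φ ≫ f) = f.app V (secEquiv V F φ) := rfl

lemma secEquiv_LE (h : V ≤ W) (φ : OE W ⟶ F) :
    secEquiv V F (extObjLE h (OX X) ≫ φ) = rs h (secEquiv W F φ) := by
  have : (extObjLE h (OX X)).app V (oneSec V) = rs h (oneSec W) := by
    apply extι_inj
    rw [extι_LE, ι_oneSec, app_rs, ι_oneSec, rs_oo, map_one (rf h)]
  rw [secEquiv_apply, app_comp, this, app_rs, secEquiv_apply]

/-- Multiplication by a function, as a local morphism. -/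
def smulLocHom (g : Γ(X, U)) (F : X.Modules) : LocHom U F F where
  app W h := AddMonoidHom.mk' (fun s => rf h g • s) fun a b => smul_add _ _ _
  map_smul W h r s := by simp [smul_smul, mul_comm]
  map_rs h hV s := by simp

/-- The action of functions on `U` on extensions by zero from `U`. -/
def actObj (g : Γ(X, U)) (F : X.Modules) : extObj U F ⟶ extObj U F :=
  extLift (smulLocHom g F).hom fun _ s => (smulLocHom g F).fn_mem _ s

lemma actObj_ι (g : Γ(X, U)) (F : X.Modules) :
    actObj g F ≫ extObjι U F = (smulLocHom g F).hom := extLift_ι _ _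

lemma ι_actObj (g : Γ(X, U)) (h : W ≤ U) (s : Γ(extObj U F, W)) :
    (extObjι U F).app W ((actObj g F).app W s) = rf h g • (extObjι U F).app W s := by
  rw [← app_comp, actObj_ι, LocHom.hom_app_of_le _ h]
  rfl

lemma actObj_app (g : Γ(X, U)) (h : W ≤ U) (s : Γ(extObj U F, W)) :
    (actObj g F).app W s = rf h g • s := by
  apply extι_inj
  rw [ι_actObj g h, Scheme.Modules.Hom.app_smul]

/-- The action of functions on `U` on the functor of extensions by zero from `U`. -/
@[simps]
def act (g : Γ(X, U)) : extF (X := X) U ⟶ extF U where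
  app F := actObj g F
  naturality F G φ := by
    apply hom_ext_of_le
    intro W h s
    change (actObj g G).app W ((extMap U φ).app W s) = (extMap U φ).app W ((actObj g F).app W s)
    rw [actObj_app g h, actObj_app g h, Scheme.Modules.Hom.app_smul]

lemma act_one : act (1 : Γ(X, U)) = 𝟙 _ := by
  ext F : 2
  apply hom_ext_of_le
  intro W h s
  change (actObj 1 F).app W s = s
  rw [actObj_app _ h, map_one, one_smul]

lemma act_mul (f g : Γ(X, U)) : act (f * g) = act f ≫ act g := by
  ext F : 2
  apply hom_ext_of_le
  intro W h s
  change (actObj (f * g) F).app W s = (actObj g F).app W ((actObj f F).app W s)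
  rw [actObj_app _ h, actObj_app _ h, actObj_app _ h, map_mul, smul_smul, mul_comm]

lemma extLE_act (h : V ≤ U) (g : Γ(X, U)) : extLE h ≫ act g = act (rf h g) ≫ extLE h := by
  ext F : 2
  apply hom_ext_of_le
  intro W hW s
  change (actObj g F).app W ((extObjLE h F).app W s) =
    (extObjLE h F).app W ((actObj (rf h g) F).app W s)
  rw [actObj_app _ (hW.trans h), actObj_app _ hW, Scheme.Modules.Hom.app_smul, rf_rf]

lemma secEquiv_act (g : Γ(X, V)) (φ : OE V ⟶ F) :
    secEquiv V F (actObj g (OX X) ≫ φ) = g • secEquiv V F φ := by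
  rw [secEquiv_apply, app_comp, actObj_app g le_rfl, Scheme.Modules.Hom.app_smul, rf_self,
    secEquiv_apply]

end

section

open CategoryTheory.Pretriangulated DerivedCategory

variable {X : Scheme.{u}} [HasDerivedCategory.{u + 1} X.Modules]
  {A B : Set X} {E F G : DerivedCategory X.Modules} {V W U : X.Opens}

/-- The homology sheaves of `E` vanish locally around the points of `A`. -/
def Van (A : Set X) (E : DerivedCategory X.Modules) : Prop :=
  ∀ n : ℤ, Vanishes A ((homologyFunctor X.Modules n).obj E)

lemma Van.mono (h : Van A E) (hAB : B ⊆ A) : Van B E := fun n => (h n).mono hAB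

lemma Van.union (hA : Van A E) (hB : Van B E) : Van (A ∪ B) E := fun n => (hA n).union (hB n)

lemma Van.of_iso (e : E ≅ F) (h : Van A E) : Van A F :=
  fun n => (h n).of_iso ((homologyFunctor _ n).mapIso e)

lemma isZero_of_homology (h : ∀ n : ℤ, IsZero ((homologyFunctor X.Modules n).obj E)) :
    IsZero E := by
  rw [IsZero.iff_id_eq_zero]
  have : IsIso (0 : E ⟶ E) := by
    rw [DerivedCategory.isIso_iff]
    intro n
    rw [Functor.map_zero]
    exact ⟨0, (h n).eq_of_src _ _, (h n).eq_of_src _ _⟩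
  rw [← IsIso.hom_inv_id (0 : E ⟶ E), zero_comp]

lemma Van.isZero (h : Van Set.univ E) : IsZero E := isZero_of_homology fun n => (h n).isZero

lemma van_of_isZero (A : Set X) (h : IsZero E) : Van A E :=
  fun n => vanishes_of_isZero A (Functor.map_isZero (homologyFunctor _ n) h)

lemma Van.isZero' (h : Van (V : Set X)ᶜ E) (h' : Van (V : Set X) E) : IsZero E :=
  Van.isZero (by simpa using h.union h')

lemma Van.obj₂ {T : Triangle (DerivedCategory X.Modules)} (hT : T ∈ distTriang _)
    (h₁ : Van A T.obj₁) (h₃ : Van A T.obj₃) : Van A T.obj₂ :=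
  fun n => (h₁ n).of_exact (HomologySequence.exact₂ T hT n) (h₃ n)

lemma Van.obj₃ {T : Triangle (DerivedCategory X.Modules)} (hT : T ∈ distTriang _)
    (h₁ : Van A T.obj₁) (h₂ : Van A T.obj₂) : Van A T.obj₃ :=
  fun n => (h₂ n).of_exact (HomologySequence.exact₃ T hT n (n + 1)) (h₁ (n + 1))

lemma Van.shift (h : Van A E) (n : ℤ) : Van A (E⟦n⟧) := fun a =>
  (h (n + a)).of_iso ((((homologyFunctor X.Modules 0).shiftIso n a (n + a) rfl).app E).symm)

lemma van_Q {K : CochainComplex X.Modules ℤ} (h : ∀ i, Vanishes A (K.X i)) :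
    Van A (Q.obj K) := fun n => by
  refine Vanishes.of_iso ((homologyFunctorFactors X.Modules n).app K).symm ?_
  have h₁ : Vanishes A (K.cycles n) := (h n).of_mono (K.iCycles n)
  have h₂ : Vanishes A (K.homology n) := h₁.of_epi (K.homologyπ n)
  exact h₂

section NatTrans

variable {C₁ : Type*} [Category* C₁] [Abelian C₁] [HasDerivedCategory.{w₁} C₁]
  {C₂ : Type*} [Category* C₂] [Abelian C₂] [HasDerivedCategory.{w₂} C₂]
  {F₁ F₂ F₃ : C₁ ⥤ C₂} [F₁.Additive] [PreservesFiniteLimits F₁] [PreservesFiniteColimits F₁]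
  [F₂.Additive] [PreservesFiniteLimits F₂] [PreservesFiniteColimits F₂]
  [F₃.Additive] [PreservesFiniteLimits F₃] [PreservesFiniteColimits F₃]

/-- The natural transformation on derived categories induced by a natural transformation of
exact functors. -/
def mapD (τ : F₁ ⟶ F₂) : F₁.mapDerivedCategory ⟶ F₂.mapDerivedCategory :=
  Localization.liftNatTrans Q (HomologicalComplex.quasiIso C₁ (ComplexShape.up ℤ))
    (F₁.mapHomologicalComplex _ ⋙ Q) (F₂.mapHomologicalComplex _ ⋙ Q) _ _
    (Functor.whiskerRight (NatTrans.mapHomologicalComplex τ _) Q)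

lemma mapD_app (τ : F₁ ⟶ F₂) (K : CochainComplex C₁ ℤ) :
    (mapD τ).app (Q.obj K) = F₁.mapDerivedCategoryFactors.hom.app K ≫
      Q.map ((NatTrans.mapHomologicalComplex τ _).app K) ≫
        F₂.mapDerivedCategoryFactors.inv.app K :=
  Localization.liftNatTrans_app ..

lemma mapD_comp (τ : F₁ ⟶ F₂) (σ : F₂ ⟶ F₃) : mapD (τ ≫ σ) = mapD τ ≫ mapD σ := by
  rw [mapD, mapD, mapD, Localization.comp_liftNatTrans, NatTrans.mapHomologicalComplex_comp,
    Functor.whiskerRight_comp]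

lemma mapD_id : mapD (𝟙 F₁) = 𝟙 _ := by
  rw [mapD, NatTrans.mapHomologicalComplex_id, Functor.whiskerRight_id']
  exact Localization.liftNatTrans_id ..

end NatTrans

/-- Extension by zero from `V` of the restriction to `V`, on the derived category. -/
def LT (V : X.Opens) : DerivedCategory X.Modules ⥤ DerivedCategory X.Modules :=
  (extF V).mapDerivedCategory

instance : (LT V).CommShift ℤ :=
  inferInstanceAs ((extF V).mapDerivedCategory.CommShift ℤ)

instance : (LT V).IsTriangulated :=
  inferInstanceAs ((extF V).mapDerivedCategory.IsTriangulated)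

/-- Extension by zero from `V`, on complexes. -/
def LC (V : X.Opens) : CochainComplex X.Modules ℤ ⥤ CochainComplex X.Modules ℤ :=
  (extF V).mapHomologicalComplex _

/-- The comparison between `LT` and `LC`. -/
def LTQ (V : X.Opens) : Q ⋙ LT V ≅ LC V ⋙ Q := (extF V).mapDerivedCategoryFactors

/-- The counit on complexes. -/
def εC (V : X.Opens) : LC V ⟶ 𝟭 (CochainComplex X.Modules ℤ) where
  app K := { f := fun i => extObjι V (K.X i)
             comm' := fun i j _ => ((extι V).naturality (K.d i j)).symm }
  naturality K L f := by
    ext i : 1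
    exact (extι V).naturality (f.f i)

instance (V : X.Opens) : Localization.Lifting Q
    (HomologicalComplex.quasiIso X.Modules (ComplexShape.up ℤ)) (LC V ⋙ Q) (LT V) :=
  ⟨LTQ V⟩

/-- The counit. -/
def εT (V : X.Opens) : LT V ⟶ 𝟭 (DerivedCategory X.Modules) :=
  Localization.liftNatTrans Q (HomologicalComplex.quasiIso X.Modules (ComplexShape.up ℤ))
    (LC V ⋙ Q) Q _ _ (Functor.whiskerRight (εC V) Q ≫ (Functor.leftUnitor Q).hom)

lemma εT_app (V : X.Opens) (K : CochainComplex X.Modules ℤ) :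
    (εT V).app (Q.obj K) = (LTQ V).hom.app K ≫ Q.map ((εC V).app K) := by
  refine (Localization.liftNatTrans_app ..).trans ?_
  change (LTQ V).hom.app K ≫ (Q.map ((εC V).app K) ≫ 𝟙 _) ≫ 𝟙 _ = _
  rw [Category.comp_id, Category.comp_id]

lemma van_LT_compl (V : X.Opens) (E : DerivedCategory X.Modules) :
    Van (V : Set X)ᶜ ((LT V).obj E) := by
  refine Van.of_iso ((LT V).mapIso (Q.objObjPreimageIso E)) ?_
  refine Van.of_iso ((LTQ V).app _).symm ?_
  exact van_Q fun i => extF_vanishes V _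

lemma exists_cone_ε (V : X.Opens) (E : DerivedCategory X.Modules) :
    ∃ (C : DerivedCategory X.Modules) (p : E ⟶ C) (δ : C ⟶ ((LT V).obj E)⟦(1 : ℤ)⟧),
      Triangle.mk ((εT V).app E) p δ ∈ distTriang _ ∧ Van (V : Set X) C := by
  obtain ⟨C, p, δ, h⟩ := distinguished_cocone_triangle ((εT V).app E)
  refine ⟨C, p, δ, h, ?_⟩
  let K := Q.objPreimage E
  let e : Q.obj K ≅ E := Q.objObjPreimageIso E
  have : ∀ i, Mono (((εC V).app K).f i) := fun i =>
    inferInstanceAs (Mono (extObjι V (K.X i)))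
  have : Mono ((εC V).app K) := HomologicalComplex.mono_of_mono_f _ inferInstance
  let S : ShortComplex (CochainComplex X.Modules ℤ) :=
    ShortComplex.mk ((εC V).app K) (cokernel.π _) (cokernel.condition _)
  have hS : S.ShortExact :=
    { exact := ShortComplex.exact_cokernel _
      mono_f := inferInstanceAs (Mono ((εC V).app K))
      epi_g := inferInstanceAs (Epi (cokernel.π _)) }
  have hC : Van (V : Set X) (Q.obj S.X₃) := by
    apply van_Q
    intro i
    have e' := PreservesCokernel.iso (HomologicalComplex.eval X.Modules (ComplexShape.up ℤ) i)
      ((εC V).app K)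
    exact (cokernel_extι_vanishes V (K.X i)).of_iso e'.symm
  refine hC.of_iso (Triangle.π₃.mapIso (isoTriangleOfIso₁₂ _ _
    (triangleOfSES_distinguished hS) h ((LTQ V).symm.app K ≪≫ (LT V).mapIso e) e ?_))
  change Q.map ((εC V).app K) ≫ e.hom = ((LTQ V).inv.app K ≫ (LT V).map e.hom) ≫ (εT V).app E
  rw [Category.assoc, (εT V).naturality, εT_app, Functor.id_map, Category.assoc,
    Iso.inv_hom_id_app_assoc]

end

section

open CategoryTheory.Pretriangulated DerivedCategory
open scoped ZeroObject

variable {X : Scheme.{u}} [HasDerivedCategory.{u + 1} X.Modules]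
  {A B E F G C : DerivedCategory X.Modules} {V W U : X.Opens}

/-- The homology of `LT`. -/
def homologyLT (V : X.Opens) (E : DerivedCategory X.Modules) (n : ℤ) :
    (homologyFunctor X.Modules n).obj ((LT V).obj E) ≅
      (extF V).obj ((homologyFunctor X.Modules n).obj E) :=
  (homologyFunctor X.Modules n).mapIso ((LT V).mapIso (Q.objObjPreimageIso E).symm ≪≫
    (LTQ V).app (Q.objPreimage E)) ≪≫
  (homologyFunctorFactors X.Modules n).app ((LC V).obj (Q.objPreimage E)) ≪≫
  ((Q.objPreimage E).sc n).mapHomologyIso (extF V) ≪≫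
  (extF V).mapIso (((homologyFunctorFactors X.Modules n).app (Q.objPreimage E)).symm ≪≫
    (homologyFunctor X.Modules n).mapIso (Q.objObjPreimageIso E))

lemma Van.LT {S : Set X} (h : Van S E) (V : X.Opens) : Van S ((LT V).obj E) := fun n =>
  (extF_vanishes_of_vanishes (h n) V).of_iso (homologyLT V E n).symm

lemma isIso_ε (h : Van (V : Set X)ᶜ E) : IsIso ((εT V).app E) := by
  obtain ⟨C, p, δ, hT, hC⟩ := exists_cone_ε V E
  exact (Triangle.isZero₃_iff_isIso₁ _ hT).1
    (Van.isZero' (Van.obj₃ hT (van_LT_compl V E) h) hC)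

lemma isZero_LT (h : Van (V : Set X) E) : IsZero ((LT V).obj E) :=
  (van_LT_compl V E).isZero' (h.LT V)

lemma van_of_isZero_LT (h : IsZero ((LT V).obj E)) : Van (V : Set X) E := by
  obtain ⟨C, p, δ, hT, hC⟩ := exists_cone_ε V E
  exact Van.obj₂ hT (van_of_isZero _ h) hC

/-- A morphism which becomes an isomorphism over `V`. -/
def VIso (V : X.Opens) (f : E ⟶ F) : Prop := IsIso ((LT V).map f)

lemma vIso_iff {T : Triangle (DerivedCategory X.Modules)} (hT : T ∈ distTriang _) :
    VIso V T.mor₁ ↔ Van (V : Set X) T.obj₃ :=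
  (Triangle.isZero₃_iff_isIso₁ _ ((LT V).map_distinguished T hT)).symm.trans
    ⟨van_of_isZero_LT, isZero_LT⟩

lemma vIso_ε (V : X.Opens) (E : DerivedCategory X.Modules) : VIso V ((εT V).app E) := by
  obtain ⟨C, p, δ, hT, hC⟩ := exists_cone_ε V E
  exact (vIso_iff hT).2 hC

lemma vIso_of_isIso (f : E ⟶ F) [IsIso f] : VIso V f :=
  inferInstanceAs (IsIso ((LT V).map f))

lemma VIso.comp {f : E ⟶ F} {g : F ⟶ G} (hf : VIso V f) (hg : VIso V g) : VIso V (f ≫ g) := by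
  have := hf; have := hg
  unfold VIso at *
  rw [Functor.map_comp]
  infer_instance

lemma VIso.of_comp_left {f : E ⟶ F} {g : F ⟶ G} (hf : VIso V f) (h : VIso V (f ≫ g)) :
    VIso V g := by
  unfold VIso at *
  rw [Functor.map_comp] at h
  exact IsIso.of_isIso_comp_left ((LT V).map f) ((LT V).map g)

lemma VIso.shift {f : E ⟶ F} (h : VIso V f) (n : ℤ) : VIso V (f⟦n⟧') := by
  unfold VIso at *
  have := ((LT V).commShiftIso n).hom.naturality f
  have h2 : (LT V).map (f⟦n⟧') = ((LT V).commShiftIso n).hom.app E ≫ ((LT V).map f)⟦n⟧' ≫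
      ((LT V).commShiftIso n).inv.app F := by
    simp
  rw [h2]
  infer_instance

lemma VIso.exists_lift {f : E ⟶ F} (h : VIso V f) (hA : Van (V : Set X)ᶜ A) (g : A ⟶ F) :
    ∃ g' : A ⟶ E, g' ≫ f = g := by
  have := isIso_ε hA
  have : IsIso ((LT V).map f) := h
  refine ⟨inv ((εT V).app A) ≫ (LT V).map g ≫ inv ((LT V).map f) ≫ (εT V).app E, ?_⟩
  have h1 := (εT V).naturality f
  have h2 := (εT V).naturality g
  simp only [Functor.id_map, Functor.id_obj] at h1 h2
  simp only [Category.assoc]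
  rw [← h1, IsIso.inv_hom_id_assoc, h2, IsIso.inv_hom_id_assoc]

lemma VIso.hom_ext {f : E ⟶ F} (h : VIso V f) (hA : Van (V : Set X)ᶜ A) {g g' : A ⟶ E}
    (hg : g ≫ f = g' ≫ f) : g = g' := by
  have := isIso_ε hA
  have : IsIso ((LT V).map f) := h
  have h1 := (εT V).naturality g
  have h2 := (εT V).naturality g'
  simp only [Functor.id_map, Functor.id_obj] at h1 h2
  rw [← cancel_epi ((εT V).app A), ← h1, ← h2]
  congr 1
  rw [← cancel_mono ((LT V).map f), ← Functor.map_comp, ← Functor.map_comp, hg]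

lemma VIso.isIso {f : E ⟶ F} (h : VIso V f) (hE : Van (V : Set X)ᶜ E)
    (hF : Van (V : Set X)ᶜ F) : IsIso f := by
  obtain ⟨g, hg⟩ := h.exists_lift hF (𝟙 F)
  exact ⟨g, h.hom_ext hE (by simp [hg]), hg⟩

lemma hom_eq_zero (hG : Van (V : Set X)ᶜ G) (hC : Van (V : Set X) C) (f : G ⟶ C) : f = 0 := by
  have : VIso V (0 : C ⟶ 0) := by
    refine ⟨0, (isZero_LT hC).eq_of_src _ _, ?_⟩
    exact (Functor.map_isZero (LT V) (isZero_zero _)).eq_of_src _ _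
  exact this.hom_ext hG (by simp)

lemma VIso.of_van (f : E ⟶ F) (hE : Van (V : Set X) E) (hF : Van (V : Set X) F) : VIso V f :=
  ⟨0, (isZero_LT hE).eq_of_src _ _, (isZero_LT hF).eq_of_src _ _⟩

lemma VIso.mono {f : E ⟶ F} (h : VIso U f) (hV : V ≤ U) : VIso V f := by
  obtain ⟨C, p, δ, hT⟩ := distinguished_cocone_triangle f
  exact (vIso_iff hT).2 (((vIso_iff hT).1 h).mono hV)

/-- Comparison of extensions by zero. -/
def LTle (h : V ≤ W) : LT (X := X) V ⟶ LT W := mapD (extLE h)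

/-- Comparison of extensions by zero, on complexes. -/
def LCle (h : V ≤ W) : LC (X := X) V ⟶ LC W := NatTrans.mapHomologicalComplex (extLE h) _

lemma LTle_app (h : V ≤ W) (K : CochainComplex X.Modules ℤ) :
    (LTle h).app (Q.obj K) = (LTQ V).hom.app K ≫ Q.map ((LCle h).app K) ≫
      (LTQ W).inv.app K := mapD_app _ _

lemma LCle_ε (h : V ≤ W) : LCle h ≫ εC W = εC (X := X) V := by
  ext K i : 3
  exact extObjLE_ι (F := K.X i) h

lemma LTle_ε (h : V ≤ W) : LTle h ≫ εT W = εT (X := X) V := by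
  apply Localization.natTrans_ext Q (HomologicalComplex.quasiIso X.Modules (ComplexShape.up ℤ))
  intro K
  rw [NatTrans.comp_app, εT_app, εT_app, LTle_app, Category.assoc, Category.assoc,
    Iso.inv_hom_id_app_assoc, ← Q.map_comp, ← LCle_ε h, NatTrans.comp_app]

/-- The action of functions. -/
def ρ (g : Γ(X, U)) : LT (X := X) U ⟶ LT U := mapD (act g)

lemma ρ_mul (g h : Γ(X, U)) : ρ (g * h) = ρ g ≫ ρ h := by
  rw [ρ, act_mul, mapD_comp]; rfl

lemma ρ_one : ρ (1 : Γ(X, U)) = 𝟙 (LT U) := by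
  rw [ρ, act_one, mapD_id]; rfl

lemma LTle_ρ (h : V ≤ U) (g : Γ(X, U)) : LTle h ≫ ρ g = ρ (rf h g) ≫ LTle h := by
  rw [LTle, ρ, ρ]
  exact (mapD_comp _ _).symm.trans ((congrArg mapD (extLE_act h g)).trans (mapD_comp _ _))

/-- The action of a function on `U` on an object supported on `U`. -/
def ga (g : Γ(X, U)) (hA : Van (U : Set X)ᶜ A) : A ⟶ A :=
  have := isIso_ε hA
  inv ((εT U).app A) ≫ (ρ g).app A ≫ (εT U).app A

lemma ε_ga (g : Γ(X, U)) (hA : Van (U : Set X)ᶜ A) :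
    (εT U).app A ≫ ga g hA = (ρ g).app A ≫ (εT U).app A := by
  have := isIso_ε hA
  simp [ga]

lemma ga_unique {g : Γ(X, U)} (hA : Van (U : Set X)ᶜ A) {f : A ⟶ A}
    (h : (εT U).app A ≫ f = (ρ g).app A ≫ (εT U).app A) : f = ga g hA := by
  have := isIso_ε hA
  rw [← cancel_epi ((εT U).app A)]
  exact h.trans (ε_ga g hA).symm

lemma ga_nat (g : Γ(X, U)) (hA : Van (U : Set X)ᶜ A) (hB : Van (U : Set X)ᶜ B) (f : A ⟶ B) :
    ga g hA ≫ f = f ≫ ga g hB := by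
  have := isIso_ε hA
  rw [← cancel_epi ((εT U).app A)]
  have h1 := (εT U).naturality f
  have h2 := (ρ g).naturality f
  simp only [Functor.id_map, Functor.id_obj] at h1
  rw [reassoc_of% ε_ga g hA, ← reassoc_of% h1, ε_ga g hB, reassoc_of% h2, h1]

lemma ga_one (hA : Van (U : Set X)ᶜ A) : ga (1 : Γ(X, U)) hA = 𝟙 A :=
  (ga_unique hA (by rw [ρ_one]; simp)).symm

lemma ga_mul (g h : Γ(X, U)) (hA : Van (U : Set X)ᶜ A) : ga (g * h) hA = ga g hA ≫ ga h hA :=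
  (ga_unique hA (by
    rw [ρ_mul, reassoc_of% ε_ga g hA, ε_ga h hA, NatTrans.comp_app, Category.assoc])).symm

lemma compl_le (h : V ≤ U) : ((U : Set X)ᶜ) ⊆ (V : Set X)ᶜ := Set.compl_subset_compl.2 h

lemma ga_rf (h : V ≤ U) (g : Γ(X, U)) (hA : Van (V : Set X)ᶜ A) :
    ga (rf h g) hA = ga g (hA.mono (compl_le h)) := by
  have := isIso_ε hA
  rw [← cancel_epi ((εT V).app A), ε_ga, ← LTle_ε h, NatTrans.comp_app, Category.assoc, ε_ga]
  have := congr_app (LTle_ρ h g) A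
  simp only [NatTrans.comp_app] at this
  rw [reassoc_of% this]

lemma isIso_ga {g : Γ(X, U)} (hg : IsUnit g) (hA : Van (U : Set X)ᶜ A) : IsIso (ga g hA) := by
  obtain ⟨v, rfl⟩ := hg
  refine ⟨ga (↑v⁻¹) hA, ?_, ?_⟩
  · rw [← ga_mul, Units.mul_inv, ga_one]
  · rw [← ga_mul, Units.inv_mul, ga_one]

lemma isIso_ga_of_le (h : V ≤ U) {g : Γ(X, U)} (hg : IsUnit (rf h g))
    (hA : Van (V : Set X)ᶜ A) : IsIso (ga g (hA.mono (compl_le h))) := by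
  rw [← ga_rf h]
  exact isIso_ga hg hA

end

section

open CategoryTheory.Pretriangulated DerivedCategory HomologicalComplex
open scoped ZeroObject

section Complexes

variable {X : Scheme.{u}} {V W U : X.Opens} {K L : CochainComplex X.Modules ℤ}

/-- `extObjLE` for the structure sheaf. -/
abbrev OEle (h : V ≤ W) : OE V ⟶ OE W := extObjLE h (OX X)

lemma OEle_self (V : X.Opens) : OEle (le_refl V) = 𝟙 _ := by
  rw [← cancel_mono (extObjι V (OX X)), extObjLE_ι, Category.id_comp]

lemma OEle_comp {V₁ V₂ V₃ : X.Opens} (h : V₁ ≤ V₂) (h' : V₂ ≤ V₃) :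
    OEle h ≫ OEle h' = OEle (h.trans h') := by
  rw [← cancel_mono (extObjι V₃ (OX X)), Category.assoc, extObjLE_ι, extObjLE_ι, extObjLE_ι]

lemma exists_local_lift {F G : X.Modules} (p : F ⟶ G) [Epi p] (t : OE V ⟶ G) {x : X}
    (hx : x ∈ V) : ∃ (V' : X.Opens) (h : V' ≤ V), x ∈ V' ∧ ∃ z : OE V' ⟶ F,
      z ≫ p = OEle h ≫ t := by
  obtain ⟨V', h, hx', s, hs⟩ := locally_surjective p (secEquiv V G t) hx
  refine ⟨V', h, hx', (secEquiv V' F).symm s, (secEquiv V' G).injective ?_⟩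
  rw [secEquiv_comp, secEquiv_LE, AddEquiv.apply_symm_apply, hs]

lemma exists_local_lift' {S : ShortComplex X.Modules} (hS : S.Exact) (t : OE V ⟶ S.X₂)
    (ht : t ≫ S.g = 0) {x : X} (hx : x ∈ V) :
    ∃ (V' : X.Opens) (h : V' ≤ V), x ∈ V' ∧ ∃ z : OE V' ⟶ S.X₁, z ≫ S.f = OEle h ≫ t := by
  have h0 : S.g.app V (secEquiv V _ t) = 0 := by rw [← secEquiv_comp, ht, map_zero]
  obtain ⟨V', h, hx', s, hs⟩ := exact_locally hS (secEquiv V _ t) h0 hx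
  refine ⟨V', h, hx', (secEquiv V' _).symm s, (secEquiv V' _).injective ?_⟩
  rw [secEquiv_comp, secEquiv_LE, AddEquiv.apply_symm_apply, hs]

/-- The structure sheaf of `V` extended by zero, as a complex in degree `0`. -/
abbrev SC (V : X.Opens) : CochainComplex X.Modules ℤ := (single X.Modules (.up ℤ) 0).obj (OE V)

/-- The map of complexes attached to a morphism. -/
abbrev SCmap {V W : X.Opens} (f : OE V ⟶ OE W) : SC V ⟶ SC W :=
  (single X.Modules (.up ℤ) 0).map f

/-- The class of a map of complexes `SC V ⟶ K`. -/
def clC (c : SC V ⟶ K) : OE V ⟶ K.homology 0 :=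
  (singleObjHomologySelfIso (.up ℤ) 0 (OE V)).inv ≫ homologyMap c 0

lemma clC_comp (c : SC V ⟶ K) (f : K ⟶ L) : clC (c ≫ f) = clC c ≫ homologyMap f 0 := by
  rw [clC, clC, homologyMap_comp, Category.assoc]

lemma clC_SCmap (f : OE V ⟶ OE W) (c : SC W ⟶ K) : clC (SCmap f ≫ c) = f ≫ clC c := by
  rw [clC, clC, homologyMap_comp, ← Category.assoc, ← Category.assoc]
  congr 1
  exact singleObjHomologySelfIso_inv_naturality ..

lemma clC_sub (c c' : SC V ⟶ K) : clC (c - c') = clC c - clC c' := by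
  rw [clC, clC, clC, homologyMap_sub, Preadditive.comp_sub]

/-- The map of complexes attached to a local cocycle. -/
def mkC (z : OE V ⟶ K.cycles 0) : SC V ⟶ K :=
  mkHomFromSingle (z ≫ K.iCycles 0) (by simp)

lemma mkC_f (z : OE V ⟶ K.cycles 0) :
    (mkC z).f 0 = (singleObjXSelf (.up ℤ) 0 (OE V)).hom ≫ z ≫ K.iCycles 0 := mkHomFromSingle_f ..

lemma cyclesMap_mkC (z : OE V ⟶ K.cycles 0) :
    (singleObjCyclesSelfIso (.up ℤ) 0 (OE V)).inv ≫ cyclesMap (mkC z) 0 = z := by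
  rw [← cancel_mono (K.iCycles 0), Category.assoc, cyclesMap_i, mkC_f,
    singleObjCyclesSelfIso_inv_iCycles_assoc, Iso.inv_hom_id_assoc]

lemma clC_eq (c : SC V ⟶ K) : clC c =
    ((singleObjCyclesSelfIso (.up ℤ) 0 (OE V)).inv ≫ cyclesMap c 0) ≫ K.homologyπ 0 := by
  rw [clC, ← singleObjCyclesSelfIso_inv_homologyπ]
  simp only [Category.assoc]
  congr 1
  exact homologyπ_naturality c 0

lemma clC_mkC (z : OE V ⟶ K.cycles 0) : clC (mkC z) = z ≫ K.homologyπ 0 := by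
  rw [clC_eq, cyclesMap_mkC]

lemma mkC_surj (c : SC V ⟶ K) :
    mkC ((singleObjCyclesSelfIso (.up ℤ) 0 (OE V)).inv ≫ cyclesMap c 0) = c := by
  apply from_single_hom_ext
  refine (mkC_f _).trans ?_
  rw [Category.assoc, cyclesMap_i, singleObjCyclesSelfIso_inv_iCycles_assoc,
    Iso.hom_inv_id_assoc]

lemma SCmap_mkC (f : OE W ⟶ OE V) (z : OE V ⟶ K.cycles 0) : SCmap f ≫ mkC z = mkC (f ≫ z) := by
  rw [← mkC_surj (SCmap f ≫ mkC z), cyclesMap_comp]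
  congr 1
  rw [← Category.assoc]
  have : (singleObjCyclesSelfIso (.up ℤ) 0 (OE W)).inv ≫ cyclesMap (SCmap f) 0 = f ≫ _ :=
    singleObjCyclesSelfIso_inv_naturality ..
  rw [this, Category.assoc, cyclesMap_mkC]

/-- Coboundaries give maps of complexes homotopic to zero. -/
def mkCHomotopy (y : OE V ⟶ K.X (-1)) : Homotopy (mkC (y ≫ K.toCycles (-1) 0)) 0 := by
  refine (Homotopy.ofEq ?_).trans (Homotopy.nullHomotopy' (C := SC V) (D := K)
    fun i j _ => if h : i = 0 ∧ j = -1 then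
      (singleObjXIsoOfEq (.up ℤ) 0 (OE V) i h.1).hom ≫ y ≫ (K.XIsoOfEq h.2.symm).hom else 0)
  apply from_single_hom_ext
  refine (mkC_f _).trans ?_
  rw [Homotopy.nullHomotopicMap'_f (k₂ := (-1 : ℤ)) (k₁ := 0) (k₀ := 1) (by simp) (by simp)]
  have : (SC V).d 0 1 = 0 := single_obj_d ..
  rw [this, zero_comp, zero_add, dif_pos (by simp)]
  simp [singleObjXSelf, XIsoOfEq]

lemma exists_clC (t : OE V ⟶ K.homology 0) {x : X} (hx : x ∈ V) :
    ∃ (V' : X.Opens) (h : V' ≤ V), x ∈ V' ∧ ∃ z : OE V' ⟶ K.cycles 0,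
      clC (mkC z) = OEle h ≫ t := by
  have : Epi (K.homologyπ 0) := inferInstance
  obtain ⟨V', h, hx', z, hz⟩ := exists_local_lift (K.homologyπ 0) t hx
  exact ⟨V', h, hx', z, by rw [clC_mkC, hz]⟩

end Complexes

variable {X : Scheme.{u}} [HasDerivedCategory.{u + 1} X.Modules]
  {E F G : DerivedCategory X.Modules} {V W U : X.Opens} {K L : CochainComplex X.Modules ℤ}

lemma locally_zero_of_clC (c : SC V ⟶ K) (hc : clC c = 0) {x : X} (hx : x ∈ V) :
    ∃ (V' : X.Opens) (h : V' ≤ V), x ∈ V' ∧ Q.map (SCmap (OEle h) ≫ c) = 0 := by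
  obtain ⟨z, rfl⟩ : ∃ z, c = mkC z := ⟨_, (mkC_surj c).symm⟩
  rw [clC_mkC] at hc
  have hS := ShortComplex.exact_of_g_is_cokernel (S := ShortComplex.mk (K.toCycles (-1) 0)
    (K.homologyπ 0) (by simp)) (K.homologyIsCokernel (-1) 0 (by simp))
  obtain ⟨V', h, hx', y, hy⟩ := exists_local_lift' hS z hc hx
  refine ⟨V', h, hx', ?_⟩
  rw [SCmap_mkC, ← hy]
  exact (DerivedCategory.Q_map_eq_of_homotopy _ (mkCHomotopy y)).trans (Q.map_zero _ _)

/-- The structure sheaf of `V` extended by zero, in the derived category. -/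
abbrev OT (V : X.Opens) : DerivedCategory X.Modules := Q.obj (SC V)

/-- The map in the derived category attached to a morphism. -/
abbrev OTmap (f : OE V ⟶ OE W) : OT V ⟶ OT W := Q.map (SCmap f)

lemma OTmap_comp (f : OE V ⟶ OE W) (g : OE W ⟶ OE U) : OTmap (f ≫ g) = OTmap f ≫ OTmap g := by
  rw [OTmap, OTmap, OTmap, SCmap, Functor.map_comp, Q.map_comp]

lemma OTmap_id : OTmap (𝟙 (OE V)) = 𝟙 _ := by
  rw [OTmap, SCmap, CategoryTheory.Functor.map_id]; exact Q.map_id _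

/-- Restriction of the extension by zero of the structure sheaf. -/
abbrev res (h : V ≤ W) : OT V ⟶ OT W := OTmap (OEle h)

lemma res_self (V : X.Opens) : res (le_refl V) = 𝟙 _ := by
  rw [res, OEle_self, OTmap_id]

lemma res_res {V₁ V₂ V₃ : X.Opens} (h : V₁ ≤ V₂) (h' : V₂ ≤ V₃) :
    res h ≫ res h' = res (h.trans h') := by
  rw [← OTmap_comp, OEle_comp]

lemma res_res_assoc {V₁ V₂ V₃ : X.Opens} (h : V₁ ≤ V₂) (h' : V₂ ≤ V₃) (φ : OT V₃ ⟶ E) :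
    res h ≫ res h' ≫ φ = res (h.trans h') ≫ φ := by
  rw [← Category.assoc, res_res]

/-- The degree zero homology sheaf. -/
abbrev H0 (E : DerivedCategory X.Modules) : X.Modules := (homologyFunctor X.Modules 0).obj E

/-- Homology computed in the derived category. -/
def hQ (K : CochainComplex X.Modules ℤ) : K.homology 0 ≅ H0 (Q.obj K) :=
  ((homologyFunctorFactors X.Modules 0).app K).symm

lemma hQ_naturality (f : K ⟶ L) : homologyMap f 0 ≫ (hQ L).hom =
    (hQ K).hom ≫ (DerivedCategory.homologyFunctor X.Modules 0).map (Q.map f) :=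
  (homologyFunctorFactors X.Modules 0).inv.naturality f

/-- The class in degree zero homology. -/
def cl (φ : OT V ⟶ E) : OE V ⟶ H0 E :=
  ((singleObjHomologySelfIso (.up ℤ) 0 (OE V)).inv ≫ (hQ (SC V)).hom) ≫
    (DerivedCategory.homologyFunctor X.Modules 0).map φ

lemma cl_comp (φ : OT V ⟶ E) (f : E ⟶ F) :
    cl (φ ≫ f) = cl φ ≫ (DerivedCategory.homologyFunctor X.Modules 0).map f := by
  rw [cl, cl, Functor.map_comp, Category.assoc, Category.assoc, Category.assoc]

lemma cl_Q (c : SC V ⟶ K) : cl (Q.map c) = clC c ≫ (hQ K).hom := by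
  rw [cl, clC, Category.assoc, Category.assoc, hQ_naturality]

lemma clC_id : clC (𝟙 (SC W)) = (singleObjHomologySelfIso (.up ℤ) 0 (OE W)).inv := by
  rw [clC, homologyMap_id]; exact Category.comp_id _

lemma cl_OTmap (f : OE V ⟶ OE W) (φ : OT W ⟶ E) : cl (OTmap f ≫ φ) = f ≫ cl φ := by
  have h := clC_SCmap f (𝟙 (SC W))
  rw [Category.comp_id, clC_id] at h
  rw [cl_comp, cl_Q, h, cl]
  simp only [Category.assoc]

lemma cl_add (φ ψ : OT V ⟶ E) : cl (φ + ψ) = cl φ + cl ψ := by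
  rw [cl, Functor.map_add, Preadditive.comp_add]; rfl

lemma cl_zero : cl (0 : OT V ⟶ E) = 0 := by
  rw [cl, Functor.map_zero, comp_zero]

lemma exists_cl (t : OE V ⟶ H0 E) {x : X} (hx : x ∈ V) :
    ∃ (V' : X.Opens) (h : V' ≤ V), x ∈ V' ∧ ∃ φ : OT V' ⟶ E, cl φ = OEle h ≫ t := by
  obtain ⟨K, ⟨e⟩⟩ : ∃ K, Nonempty (Q.obj K ≅ E) := ⟨_, ⟨Q.objObjPreimageIso E⟩⟩
  obtain ⟨V', h, hx', z, hz⟩ := exists_clC (t ≫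
    (DerivedCategory.homologyFunctor X.Modules 0).map e.inv ≫ (hQ K).inv) hx
  refine ⟨V', h, hx', Q.map (mkC z) ≫ e.hom, ?_⟩
  rw [cl_comp, cl_Q, hz]
  simp only [Category.assoc, Iso.inv_hom_id_assoc]
  rw [← Functor.map_comp, Iso.inv_hom_id, CategoryTheory.Functor.map_id, Category.comp_id]

lemma exists_rep (φ : OT V ⟶ Q.obj K) {x : X} (hx : x ∈ V) :
    ∃ (V' : X.Opens) (h : V' ≤ V), x ∈ V' ∧ ∃ z : OE V' ⟶ K.cycles 0,
      res h ≫ φ = Q.map (mkC z) := by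
  obtain ⟨K', s, hs, g, hg⟩ := right_fac φ
  have hs' : IsIso (homologyMap s 0) := by
    have := (isIso_Q_map_iff_quasiIso (φ := s)).1 hs
    infer_instance
  have hid : clC (𝟙 (SC V)) = clC (𝟙 (SC V)) := rfl
  obtain ⟨V₁, h₁, hx₁, z, hz⟩ := exists_clC (clC (𝟙 (SC V)) ≫ inv (homologyMap s 0)) hx
  have hd : clC (mkC z ≫ s - SCmap (OEle h₁)) = 0 := by
    rw [clC_sub, clC_comp, hz]
    have := clC_SCmap (OEle h₁) (𝟙 (SC V))
    rw [Category.comp_id] at this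
    rw [this]
    simp
  obtain ⟨V₂, h₂, hx₂, h0⟩ := locally_zero_of_clC _ hd hx₁
  refine ⟨V₂, h₂.trans h₁, hx₂, ?_⟩
  rw [Preadditive.comp_sub, Functor.map_sub, sub_eq_zero] at h0
  refine ⟨(OEle h₂ ≫ z) ≫ cyclesMap g 0, ?_⟩
  have e1 : mkC ((OEle h₂ ≫ z) ≫ cyclesMap g 0) = mkC (OEle h₂ ≫ z) ≫ g := by
    rw [← mkC_surj (mkC (OEle h₂ ≫ z) ≫ g), cyclesMap_comp, ← Category.assoc, cyclesMap_mkC]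
  have e2 : res h₂ ≫ res h₁ = Q.map (SCmap (OEle h₂) ≫ mkC z) ≫ Q.map s := by
    refine (Q.map_comp _ _).symm.trans (h0.symm.trans ?_)
    rw [← Q.map_comp, Category.assoc]
  rw [e1, ← SCmap_mkC, hg, ← res_res h₂ h₁, e2, Category.assoc, IsIso.hom_inv_id_assoc]
  exact (Q.map_comp _ _).symm

lemma locally_zero_of_cl (φ : OT V ⟶ E) (h0 : cl φ = 0) {x : X} (hx : x ∈ V) :
    ∃ (V' : X.Opens) (h : V' ≤ V), x ∈ V' ∧ res h ≫ φ = 0 := by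
  obtain ⟨K, ⟨e⟩⟩ : ∃ K, Nonempty (Q.obj K ≅ E) := ⟨_, ⟨Q.objObjPreimageIso E⟩⟩
  obtain ⟨V₁, h₁, hx₁, z, hz⟩ := exists_rep (φ ≫ e.inv) hx
  have hz0 : clC (mkC z) = 0 := by
    have : cl (Q.map (mkC z)) = 0 := by
      rw [← hz, cl_OTmap, cl_comp, h0, zero_comp, comp_zero]
    rw [cl_Q] at this
    rw [← cancel_mono (hQ K).hom]
    exact this.trans zero_comp.symm
  obtain ⟨V₂, h₂, hx₂, h3⟩ := locally_zero_of_clC _ hz0 hx₁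
  refine ⟨V₂, h₂.trans h₁, hx₂, ?_⟩
  have e2 : res h₂ ≫ Q.map (mkC z) = 0 := (Q.map_comp _ _).symm.trans h3
  rw [← cancel_mono e.inv, zero_comp, ← res_res h₂ h₁, Category.assoc, Category.assoc, hz, e2]

end

section

open CategoryTheory.Pretriangulated DerivedCategory HomologicalComplex
open scoped ZeroObject

section

variable {X : Scheme.{u}} {V W U : X.Opens} {F : X.Modules}

lemma isIso_extF_map_extObjι (V : X.Opens) (F : X.Modules) :
    IsIso ((extF V).map (extObjι V F)) := by
  have h1 := (extι V).naturality (extObjι V F)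
  have h2 : (extF V).map (extObjι V F) ≫ extObjι V F = extObjι V (extObj V F) ≫ extObjι V F := h1
  rw [(cancel_mono (extObjι V F)).1 h2]
  exact isIso_extι_of_vanishes (extF_vanishes V F)

lemma isIso_extF_map_extObjLE (h : V ≤ W) (F : X.Modules) :
    IsIso ((extF V).map (extObjLE h F)) := by
  have h1 := isIso_extF_map_extObjι V F
  have h2 : (extF V).map (extObjLE h F) ≫ (extF V).map (extObjι W F) =
      (extF V).map (extObjι V F) := by
    rw [← Functor.map_comp, extObjLE_ι]
  have := (extF_preserves (X := X) V).1
  have hm : Mono ((extF V).map (extObjι W F)) := inferInstance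
  rw [← h2] at h1
  have : IsSplitEpi ((extF V).map (extObjι W F)) := IsSplitEpi.mk' ⟨inv
    ((extF V).map (extObjLE h F) ≫ (extF V).map (extObjι W F)) ≫ (extF V).map (extObjLE h F), by
      rw [Category.assoc, IsIso.inv_hom_id]⟩
  have := isIso_of_mono_of_isSplitEpi ((extF V).map (extObjι W F))
  exact IsIso.of_isIso_comp_right _ ((extF V).map (extObjι W F))

end

variable {X : Scheme.{u}} [HasDerivedCategory.{u + 1} X.Modules]
  {A B C D E F G : DerivedCategory X.Modules} {V W U : X.Opens} {K L : CochainComplex X.Modules ℤ}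

lemma vIso_Q_map (f : K ⟶ L) (h : ∀ i, IsIso ((extF V).map (f.f i))) : VIso V (Q.map f) := by
  have h1 : IsIso ((LC V).map f) := by
    have : ∀ i, IsIso (((LC V).map f).f i) := h
    exact HomologicalComplex.Hom.isIso_of_components _
  have h2 := (LTQ V).hom.naturality f
  have h3 : (LT V).map (Q.map f) = (LTQ V).hom.app K ≫ Q.map ((LC V).map f) ≫
      (LTQ V).inv.app L := by
    have h4 : (LTQ V).hom.app L ≫ (LTQ V).inv.app L = 𝟙 _ := (LTQ V).hom_inv_id_app L
    exact ((congrArg ((LT V).map (Q.map f) ≫ ·) h4).trans (Category.comp_id _)).symm.trans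
      ((Category.assoc _ _ _).symm.trans
        ((congrArg (· ≫ (LTQ V).inv.app L) h2).trans (Category.assoc _ _ _)))
  unfold VIso
  rw [h3]
  infer_instance

lemma van_OT (V : X.Opens) : Van (V : Set X)ᶜ (OT V) := by
  apply van_Q
  intro i
  by_cases hi : i = 0
  · subst hi
    exact (extF_vanishes V (OX X)).of_iso (singleObjXSelf (.up ℤ) 0 (OE V)).symm
  · exact vanishes_of_isZero _ (isZero_single_obj_X (.up ℤ) 0 (OE V) i hi)

lemma vIso_res (h : V ≤ W) : VIso V (res h) := by
  apply vIso_Q_map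
  intro i
  by_cases hi : i = 0
  · subst hi
    have h1 := isIso_extF_map_extObjLE h (OX X)
    rw [single_map_f_self, Functor.map_comp, Functor.map_comp]
    infer_instance
  · have h1 := isZero_single_obj_X (.up ℤ) 0 (OE V) i hi
    have h2 := isZero_single_obj_X (.up ℤ) 0 (OE W) i hi
    exact ⟨0, (Functor.map_isZero (extF V) h1).eq_of_src _ _,
      (Functor.map_isZero (extF V) h2).eq_of_src _ _⟩

lemma VIso.of_inf_le {f : E ⟶ F} (h : VIso V f) (hE : Van (W : Set X)ᶜ E)
    (hF : Van (W : Set X)ᶜ F) (hU : U ⊓ W ≤ V) : VIso U f := by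
  obtain ⟨C, p, δ, hT⟩ := distinguished_cocone_triangle f
  refine (vIso_iff hT).2 ((((vIso_iff hT).1 h).union (Van.obj₃ hT hE hF)).mono ?_)
  intro x hx
  by_cases hxW : x ∈ W
  · exact Or.inl (hU ⟨hx, hxW⟩)
  · exact Or.inr hxW

lemma vIso_res_of_inf_le (h : V ≤ W) (hU : U ⊓ W ≤ V) : VIso U (res h) :=
  (vIso_res h).of_inf_le ((van_OT V).mono (compl_le h)) (van_OT W) hU

lemma VIso.sup {f : E ⟶ F} (h : VIso V f) (h' : VIso W f) : VIso (V ⊔ W) f := by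
  obtain ⟨C, p, δ, hT⟩ := distinguished_cocone_triangle f
  refine (vIso_iff hT).2 ((((vIso_iff hT).1 h).union ((vIso_iff hT).1 h')).mono ?_)
  rw [Opens.coe_sup]

lemma VIso.hom₃ {T T' : Triangle (DerivedCategory X.Modules)} (hT : T ∈ distTriang _)
    (hT' : T' ∈ distTriang _) (φ : T ⟶ T') (h₁ : VIso V φ.hom₁) (h₂ : VIso V φ.hom₂) :
    VIso V φ.hom₃ :=
  isIso₃_of_isIso₁₂ ((LT V).mapTriangle.map φ) ((LT V).map_distinguished _ hT)
    ((LT V).map_distinguished _ hT') h₁ h₂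

/-- A class vanishing on two opens vanishes on their union as soon as the obstruction
classes on the intersection can be decomposed. -/
lemma mayerVietoris_eq_zero (c : OT (V ⊔ W) ⟶ E) (hV : res le_sup_left ≫ c = 0)
    (hW : res le_sup_right ≫ c = 0)
    (H : ∀ b : (OT (V ⊓ W))⟦(1 : ℤ)⟧ ⟶ E, ∃ (b₁ : (OT V)⟦(1 : ℤ)⟧ ⟶ E)
      (b₂ : (OT W)⟦(1 : ℤ)⟧ ⟶ E),
      b = (res inf_le_left)⟦(1 : ℤ)⟧' ≫ b₁ + (res inf_le_right)⟦(1 : ℤ)⟧' ≫ b₂) : c = 0 := by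
  obtain ⟨C, p, δ, hT⟩ := distinguished_cocone_triangle (res (le_sup_left : V ≤ V ⊔ W))
  obtain ⟨C', p', δ', hT'⟩ := distinguished_cocone_triangle (res (inf_le_right : V ⊓ W ≤ W))
  obtain ⟨φ, hφ₁, hφ₂⟩ : ∃ φ : Triangle.mk (res (inf_le_right : V ⊓ W ≤ W)) p' δ' ⟶
      Triangle.mk (res (le_sup_left : V ≤ V ⊔ W)) p δ,
      φ.hom₁ = res inf_le_left ∧ φ.hom₂ = res le_sup_right := by
    refine ⟨completeDistinguishedTriangleMorphism _ _ hT' hT (res inf_le_left)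
      (res le_sup_right) ?_, rfl, rfl⟩
    dsimp only [Triangle.mk]
    rw [res_res, res_res]
  have hC : Van (V : Set X) C := (vIso_iff hT).1 (vIso_res _)
  have hC' : Van (V : Set X) C' := (vIso_iff hT').1 (vIso_res_of_inf_le _ le_rfl)
  have hiso : IsIso φ.hom₃ := by
    have hs : ∀ {S : X.Opens}, S ≤ V ⊔ W → Van ((V ⊔ W : X.Opens) : Set X)ᶜ (OT S) :=
      fun h => (van_OT _).mono (compl_le h)
    have h1 : VIso (V ⊔ W) φ.hom₃ := by
      refine VIso.sup (VIso.of_van _ hC' hC) (VIso.hom₃ hT' hT φ ?_ ?_)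
      · rw [hφ₁]; exact vIso_res_of_inf_le _ (by rw [inf_comm])
      · rw [hφ₂]; exact vIso_res _
    exact h1.isIso (Van.obj₃ hT' (hs (inf_le_left.trans le_sup_left)) (hs le_sup_right))
      (Van.obj₃ hT (hs le_sup_left) (hs le_rfl))
  obtain ⟨θ, h₂, h₃, hθ⟩ : ∃ θ : C' ⟶ C, p' ≫ θ = res le_sup_right ≫ p ∧
      δ' ≫ (res inf_le_left)⟦(1 : ℤ)⟧' = θ ≫ δ ∧ IsIso θ :=
    ⟨φ.hom₃, by rw [← hφ₂]; exact φ.comm₂, by rw [← hφ₁]; exact φ.comm₃, hiso⟩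
  obtain ⟨d, rfl⟩ : ∃ d : C ⟶ E, c = p ≫ d := Triangle.yoneda_exact₂ _ hT c hV
  obtain ⟨b, hb⟩ : ∃ b : (OT (V ⊓ W))⟦(1 : ℤ)⟧ ⟶ E, θ ≫ d = δ' ≫ b :=
    Triangle.yoneda_exact₃ _ hT' (θ ≫ d)
      (((reassoc_of% h₂) d).trans hW)
  obtain ⟨b₁, b₂, rfl⟩ := H b
  have h31 : δ' ≫ (res (inf_le_right : V ⊓ W ≤ W))⟦(1 : ℤ)⟧' = 0 :=
    comp_distTriang_mor_zero₃₁ _ hT'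
  have h23 : p ≫ δ = 0 := comp_distTriang_mor_zero₂₃ _ hT
  have hb' : θ ≫ d = θ ≫ δ ≫ b₁ := by
    rw [hb, Preadditive.comp_add, reassoc_of% h31, zero_comp, add_zero, reassoc_of% h₃]
  rw [(cancel_epi θ).1 hb', reassoc_of% h23, zero_comp]

/-- To be zero on `U`, it is enough that classes on small opens are locally zero. -/
lemma van_of_locally_zero (P : X.Opens → Prop)
    (hP : ∀ V ≤ U, ∀ x ∈ V, ∃ V' ≤ V, x ∈ V' ∧ P V')
    (h : ∀ V ≤ U, P V → ∀ (n : ℤ) (φ : OT V ⟶ E⟦n⟧), ∀ x ∈ V,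
      ∃ (V' : X.Opens) (hV : V' ≤ V), x ∈ V' ∧ res hV ≫ φ = 0) : Van (U : Set X) E := by
  intro n
  refine Vanishes.of_iso (((DerivedCategory.homologyFunctor X.Modules 0).shiftIso n 0 n
    (by simp)).app E) ?_
  change Vanishes _ (H0 (E⟦n⟧))
  intro N s x hx hxU
  obtain ⟨φ₀, hφ₀⟩ : ∃ φ₀, secEquiv N (H0 (E⟦n⟧)) φ₀ = s :=
    ⟨_, AddEquiv.apply_symm_apply _ _⟩
  obtain ⟨V₁, h₁, hx₁, φ, hφ⟩ := exists_cl φ₀ hx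
  obtain ⟨V₂, h₂, hx₂, hP₂⟩ := hP (V₁ ⊓ U) inf_le_right x ⟨hx₁, hxU⟩
  obtain ⟨V₃, h₃, hx₃, hφ₃⟩ := h V₂ (h₂.trans inf_le_right) hP₂ n
    (res (h₂.trans inf_le_left) ≫ φ) x hx₂
  refine ⟨V₃, (h₃.trans (h₂.trans inf_le_left)).trans h₁, hx₃, ?_⟩
  rw [res_res_assoc] at hφ₃
  have := congrArg cl hφ₃
  rw [cl_OTmap, hφ, cl_zero, ← Category.assoc, OEle_comp] at this
  rw [← hφ₀, ← secEquiv_LE, this, map_zero]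

end

section

open CategoryTheory.Pretriangulated DerivedCategory
open scoped ZeroObject

section Sheaf

variable {X : Scheme.{u}} {F G : X.Modules} {V W U : X.Opens}

/-- The restriction to the closed complement of `V` (extended by zero). -/
def cokObj (V : X.Opens) (F : X.Modules) : X.Modules := cokernel (extObjι V F)

/-- The projection to `cokObj`. -/
def cokObjπ (V : X.Opens) (F : X.Modules) : F ⟶ cokObj V F := cokernel.π (extObjι V F)

instance : Epi (cokObjπ V F) := inferInstanceAs (Epi (cokernel.π (extObjι V F)))

/-- The functoriality of `cokObj`. -/
def cokMap (V : X.Opens) (φ : F ⟶ G) : cokObj V F ⟶ cokObj V G :=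
  cokernel.map (extObjι V F) (extObjι V G) (extMap V φ) φ (extMap_ι φ).symm

lemma cokObjπ_map (φ : F ⟶ G) : cokObjπ V F ≫ cokMap V φ = φ ≫ cokObjπ V G :=
  cokernel.π_desc _ _ _

lemma extObjι_cokObjπ : extObjι V F ≫ cokObjπ V F = 0 := cokernel.condition _

lemma exact_cokObjπ : (ShortComplex.mk _ _ (extObjι_cokObjπ (V := V) (F := F))).Exact :=
  ShortComplex.exact_cokernel _

lemma cokObj_vanishes (V : X.Opens) (F : X.Modules) : Vanishes (V : Set X) (cokObj V F) :=
  cokernel_extι_vanishes V F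

/-- The functor `cokObj`. -/
@[simps]
def cokF (V : X.Opens) : X.Modules ⥤ X.Modules where
  obj F := cokObj V F
  map φ := cokMap V φ
  map_id F := by rw [← cancel_epi (cokObjπ V F), cokObjπ_map]; simp
  map_comp {F G H} f g := by
    rw [← cancel_epi (cokObjπ V F), cokObjπ_map, ← Category.assoc, cokObjπ_map, Category.assoc,
      Category.assoc, cokObjπ_map]

/-- The projection to `cokF`. -/
@[simps]
def cokπ (V : X.Opens) : 𝟭 X.Modules ⟶ cokF V where
  app F := cokObjπ V F
  naturality _ _ φ := (cokObjπ_map φ).symm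

instance (V : X.Opens) : (cokF V).Additive where
  map_add {F G f g} := by
    change cokMap V (f + g) = cokMap V f + cokMap V g
    rw [← cancel_epi (cokObjπ V F)]
    simp [cokObjπ_map]

lemma π_cokMap (φ : F ⟶ G) (s : Γ(F, U)) :
    (cokMap V φ).app U ((cokObjπ V F).app U s) = (cokObjπ V G).app U (φ.app U s) := by
  rw [← app_comp, cokObjπ_map, app_comp]

lemma cokMap_exact (V : X.Opens) (S : ShortComplex X.Modules) (hS : S.Exact)
    (s : Γ(cokObj V S.X₂, U)) (hs : (cokMap V S.g).app U s = 0) {x : X} (hx : x ∈ U) :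
    ∃ (N : X.Opens) (hN : N ≤ U), x ∈ N ∧
      ∃ t : Γ(cokObj V S.X₁, N), (cokMap V S.f).app N t = rs hN s := by
  by_cases hxV : x ∈ V
  · obtain ⟨N, hN, hxN, h0⟩ := cokObj_vanishes V S.X₂ U s x hx hxV
    exact ⟨N, hN, hxN, 0, by rw [h0, map_zero]⟩
  · obtain ⟨N, hN, hxN, t, ht⟩ := locally_surjective (cokObjπ V S.X₂) s hx
    have h1 : (cokObjπ V S.X₃).app N (S.g.app N t) = 0 := by
      rw [← π_cokMap, ht, app_rs, hs, map_zero]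
    obtain ⟨N', hN', hxN', r, hr⟩ := exact_locally exact_cokObjπ (S.g.app N t) h1 hxN
    obtain ⟨N₂, hN₂, hxN₂, h0⟩ := extF_vanishes V _ N' r x hxN' hxV
    have h2 : S.g.app N₂ (rs (hN₂.trans hN') t) = 0 := by
      rw [app_rs, ← rs_rs hN' hN₂, ← hr]
      dsimp only
      rw [← app_rs, h0, map_zero]
    obtain ⟨N₃, hN₃, hxN₃, q, hq⟩ := exact_locally hS _ h2 hxN₂
    refine ⟨N₃, hN₃.trans (hN₂.trans (hN'.trans hN)), hxN₃, (cokObjπ V S.X₁).app N₃ q, ?_⟩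
    rw [π_cokMap, hq, rs_rs, app_rs, ht, rs_rs]

lemma cokF_exact (V : X.Opens) (S : ShortComplex X.Modules) (hS : S.Exact) :
    (S.map (cokF V)).Exact :=
  exact_of_locally fun _ s hs _ hx => cokMap_exact V S hS s hs hx

lemma cokF_preserves (V : X.Opens) :
    PreservesFiniteLimits (cokF V) ∧ PreservesFiniteColimits (cokF V) := by
  have h := (cokF V).exact_tfae.out 1 3
  exact h.mp (cokF_exact V)

instance (V : X.Opens) : PreservesFiniteLimits (cokF V) := (cokF_preserves V).1

instance (V : X.Opens) : PreservesFiniteColimits (cokF V) := (cokF_preserves V).2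

end Sheaf

variable {X : Scheme.{u}} [HasDerivedCategory.{u + 1} X.Modules]
  {A B E F G C : DerivedCategory X.Modules} {V W U : X.Opens}

/-- The part of an object supported on the complement of `V`. -/
def ZT (V : X.Opens) : DerivedCategory X.Modules ⥤ DerivedCategory X.Modules :=
  (cokF V).mapDerivedCategory

instance : (ZT V).CommShift ℤ :=
  inferInstanceAs ((cokF V).mapDerivedCategory.CommShift ℤ)

instance : (ZT V).IsTriangulated :=
  inferInstanceAs ((cokF V).mapDerivedCategory.IsTriangulated)

/-- The functor `ZT` on complexes. -/
def ZC (V : X.Opens) : CochainComplex X.Modules ℤ ⥤ CochainComplex X.Modules ℤ :=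
  (cokF V).mapHomologicalComplex _

/-- The comparison between `ZT` and `ZC`. -/
def ZTQ (V : X.Opens) : Q ⋙ ZT V ≅ ZC V ⋙ Q := (cokF V).mapDerivedCategoryFactors

/-- The unit on complexes. -/
def πC (V : X.Opens) : 𝟭 (CochainComplex X.Modules ℤ) ⟶ ZC V where
  app K := { f := fun i => cokObjπ V (K.X i)
             comm' := fun i j _ => ((cokπ V).naturality (K.d i j)).symm }
  naturality K L f := by
    ext i : 1
    exact (cokπ V).naturality (f.f i)

instance (V : X.Opens) : Localization.Lifting Q
    (HomologicalComplex.quasiIso X.Modules (ComplexShape.up ℤ)) (ZC V ⋙ Q) (ZT V) :=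
  ⟨ZTQ V⟩

/-- The unit. -/
def πT (V : X.Opens) : 𝟭 (DerivedCategory X.Modules) ⟶ ZT V :=
  Localization.liftNatTrans Q (HomologicalComplex.quasiIso X.Modules (ComplexShape.up ℤ))
    Q (ZC V ⋙ Q) _ _ ((Functor.leftUnitor Q).inv ≫ Functor.whiskerRight (πC V) Q)

lemma πT_app (V : X.Opens) (K : CochainComplex X.Modules ℤ) :
    (πT V).app (Q.obj K) = Q.map ((πC V).app K) ≫ (ZTQ V).inv.app K := by
  refine (Localization.liftNatTrans_app ..).trans ?_
  change 𝟙 _ ≫ (𝟙 _ ≫ Q.map ((πC V).app K)) ≫ (ZTQ V).inv.app K = _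
  rw [Category.id_comp, Category.id_comp]

lemma van_ZT (V : X.Opens) (E : DerivedCategory X.Modules) :
    Van (V : Set X) ((ZT V).obj E) := by
  refine Van.of_iso ((ZT V).mapIso (Q.objObjPreimageIso E)) ?_
  refine Van.of_iso ((ZTQ V).app _).symm ?_
  exact van_Q fun i => cokObj_vanishes V _

lemma exists_triangle_ZT (V : X.Opens) (E : DerivedCategory X.Modules) :
    ∃ (δ : (ZT V).obj E ⟶ ((LT V).obj E)⟦(1 : ℤ)⟧),
      Triangle.mk ((εT V).app E) ((πT V).app E) δ ∈ distTriang _ := by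
  let K := Q.objPreimage E
  let e : Q.obj K ≅ E := Q.objObjPreimageIso E
  have : ∀ i, Mono (((εC V).app K).f i) := fun i =>
    inferInstanceAs (Mono (extObjι V (K.X i)))
  have : ∀ i, Epi (((πC V).app K).f i) := fun i =>
    inferInstanceAs (Epi (cokObjπ V (K.X i)))
  let S : ShortComplex (CochainComplex X.Modules ℤ) :=
    ShortComplex.mk ((εC V).app K) ((πC V).app K) (by
      ext i : 1; exact extObjι_cokObjπ)
  have hS : S.ShortExact := HomologicalComplex.shortExact_of_degreewise_shortExact _ fun i =>
    { exact := exact_cokObjπ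
      mono_f := inferInstanceAs (Mono (extObjι V (K.X i)))
      epi_g := inferInstanceAs (Epi (cokObjπ V (K.X i))) }
  let e₁ : Q.obj S.X₁ ≅ (LT V).obj E := (LTQ V).symm.app K ≪≫ (LT V).mapIso e
  let e₃ : Q.obj S.X₃ ≅ (ZT V).obj E := (ZTQ V).symm.app K ≪≫ (ZT V).mapIso e
  refine ⟨e₃.inv ≫ (triangleOfSES hS).mor₃ ≫ e₁.hom⟦1⟧', ?_⟩
  refine isomorphic_distinguished _ (triangleOfSES_distinguished hS) _
    (Triangle.isoMk _ _ e₁ e e₃ ?_ ?_ ?_).symm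
  · change Q.map ((εC V).app K) ≫ e.hom = ((LTQ V).inv.app K ≫ (LT V).map e.hom) ≫ (εT V).app E
    rw [Category.assoc, (εT V).naturality, εT_app, Functor.id_map, Category.assoc,
      Iso.inv_hom_id_app_assoc]
  · change Q.map ((πC V).app K) ≫ (ZTQ V).inv.app K ≫ (ZT V).map e.hom = e.hom ≫ (πT V).app E
    have := (πT V).naturality e.hom
    rw [Functor.id_map] at this
    rw [this, πT_app, Category.assoc]
  · exact (Iso.hom_inv_id_assoc _ _).symm

/-- The connecting morphism. -/
def δT (V : X.Opens) (E : DerivedCategory X.Modules) :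
    (ZT V).obj E ⟶ ((LT V).obj E)⟦(1 : ℤ)⟧ :=
  (exists_triangle_ZT V E).choose

lemma triangle_ZT (V : X.Opens) (E : DerivedCategory X.Modules) :
    Triangle.mk ((εT V).app E) ((πT V).app E) (δT V E) ∈ distTriang _ :=
  (exists_triangle_ZT V E).choose_spec

lemma π_hom_ext (hC : Van (V : Set X) C) {f g : (ZT V).obj E ⟶ C}
    (h : (πT V).app E ≫ f = (πT V).app E ≫ g) : f = g := by
  rw [← sub_eq_zero]
  have h' : (πT V).app E ≫ (f - g) = 0 := by rw [Preadditive.comp_sub, h, sub_self]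
  obtain ⟨d, hd⟩ : ∃ d : ((LT V).obj E)⟦(1 : ℤ)⟧ ⟶ C, f - g = δT V E ≫ d :=
    Triangle.yoneda_exact₃ _ (triangle_ZT V E) (f - g) h'
  rw [hd, hom_eq_zero ((van_LT_compl V E).shift 1) hC d, comp_zero]

lemma π_nat (V : X.Opens) (f : E ⟶ F) :
    (πT V).app E ≫ (ZT V).map f = f ≫ (πT V).app F := ((πT V).naturality f).symm

lemma ε_nat (V : X.Opens) (f : E ⟶ F) :
    (LT V).map f ≫ (εT V).app F = (εT V).app E ≫ f := (εT V).naturality f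

lemma δ_nat (V : X.Opens) (f : E ⟶ F) :
    δT V E ≫ ((LT V).map f)⟦(1 : ℤ)⟧' = (ZT V).map f ≫ δT V F := by
  obtain ⟨c, hc, hc'⟩ : ∃ c : (ZT V).obj E ⟶ (ZT V).obj F,
      (πT V).app E ≫ c = f ≫ (πT V).app F ∧
      δT V E ≫ ((LT V).map f)⟦(1 : ℤ)⟧' = c ≫ δT V F :=
    complete_distinguished_triangle_morphism _ _ (triangle_ZT V E) (triangle_ZT V F)
      ((LT V).map f) f (ε_nat V f).symm
  rw [hc', π_hom_ext (van_ZT V F) (hc.trans (π_nat V f).symm)]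

lemma Van.ZT {S : Set X} (h : Van S E) (V : X.Opens) : Van S ((ZT V).obj E) :=
  Van.obj₃ (triangle_ZT V E) (h.LT V) h

lemma isIso_π (h : Van (V : Set X) E) : IsIso ((πT V).app E) :=
  (Triangle.isZero₁_iff_isIso₂ _ (triangle_ZT V E)).1 (isZero_LT h)

lemma isZero_ZT (h : Van (V : Set X)ᶜ E) : IsZero ((ZT V).obj E) :=
  (h.ZT V).isZero' (van_ZT V E)

lemma ZT_ga (g : Γ(X, U)) (hA : Van (U : Set X)ᶜ A) :
    (ZT V).map (ga g hA) = ga g (hA.ZT V) :=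
  π_hom_ext (van_ZT V A) (by rw [π_nat, ga_nat g hA (hA.ZT V)])

/-- The action of functions, on complexes. -/
def actC (g : Γ(X, U)) : LC (X := X) U ⟶ LC U := NatTrans.mapHomologicalComplex (act g) _

lemma ρ_app (g : Γ(X, U)) (K : CochainComplex X.Modules ℤ) :
    (ρ g).app (Q.obj K) = (LTQ U).hom.app K ≫ Q.map ((actC g).app K) ≫ (LTQ U).inv.app K :=
  mapD_app _ _

lemma Q_map_eq_ga {g : Γ(X, U)} {K : CochainComplex X.Modules ℤ} {f : K ⟶ K}
    (hf : ∀ i, extObjι U (K.X i) ≫ f.f i = actObj g (K.X i) ≫ extObjι U (K.X i))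
    (hA : Van (U : Set X)ᶜ (Q.obj K)) : Q.map f = ga g hA := by
  apply ga_unique hA
  rw [εT_app, ρ_app, Category.assoc, Category.assoc, Category.assoc, Iso.inv_hom_id_app_assoc,
    ← Q.map_comp, ← Q.map_comp]
  congr 2
  ext i : 1
  exact hf i

lemma extObjι_actObj (g : Γ(X, U)) (F : X.Modules) :
    extObjι U (extObj U F) ≫ actObj g F = actObj g (extObj U F) ≫ extObjι U (extObj U F) := by
  apply hom_ext_of_le
  intro W h s
  rw [app_comp, app_comp, actObj_app g h, actObj_app g h, Scheme.Modules.Hom.app_smul]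

lemma shift_Q_map {K : CochainComplex X.Modules ℤ} {f : K ⟶ K} (n : ℤ) :
    (Q.map f)⟦n⟧' = (Q.commShiftIso n).inv.app K ≫ Q.map (f⟦n⟧') ≫ (Q.commShiftIso n).hom.app K := by
  have := (Q.commShiftIso n).hom.naturality f
  simp only [Functor.comp_map] at this
  rw [this, Iso.inv_hom_id_app_assoc]

lemma shift_ga_of_iso {g : Γ(X, U)} (e : A ≅ B) (hA : Van (U : Set X)ᶜ A)
    (hB : Van (U : Set X)ᶜ B) {n : ℤ} (h : (ga g hB)⟦n⟧' = ga g (hB.shift n)) :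
    (ga g hA)⟦n⟧' = ga g (hA.shift n) := by
  rw [← cancel_mono (e.hom⟦n⟧'), ← Functor.map_comp, ga_nat g hA hB,
    ga_nat g (hA.shift n) (hB.shift n), Functor.map_comp, h]

lemma shift_ga_Q {g : Γ(X, U)} {K : CochainComplex X.Modules ℤ} {f : K ⟶ K}
    (hf : ∀ i, extObjι U (K.X i) ≫ f.f i = actObj g (K.X i) ≫ extObjι U (K.X i))
    (hA : Van (U : Set X)ᶜ (Q.obj K)) (n : ℤ) : (ga g hA)⟦n⟧' = ga g (hA.shift n) := by
  have hL' : Van (U : Set X)ᶜ (Q.obj (K⟦n⟧)) :=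
    (hA.shift n).of_iso ((Q.commShiftIso n).app K).symm
  have hf' : ∀ i, extObjι U ((K⟦n⟧).X i) ≫ (f⟦n⟧').f i =
      actObj g ((K⟦n⟧).X i) ≫ extObjι U ((K⟦n⟧).X i) := fun i => hf (i + n)
  have h2 : Q.map (f⟦n⟧') = ga g hL' := Q_map_eq_ga hf' hL'
  rw [← Q_map_eq_ga hf hA, shift_Q_map, h2]
  have h3 : ga g hL' ≫ (Q.commShiftIso n).hom.app K = (Q.commShiftIso n).hom.app K ≫
    ga g (hA.shift n) := ga_nat g hL' (hA.shift n) _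
  rw [h3, Iso.inv_hom_id_app_assoc]

lemma shift_ga (g : Γ(X, U)) (hA : Van (U : Set X)ᶜ A) (n : ℤ) :
    (ga g hA)⟦n⟧' = ga g (hA.shift n) := by
  have := isIso_ε hA
  let e : A ≅ Q.obj ((LC U).obj (Q.objPreimage A)) := (asIso ((εT U).app A)).symm ≪≫
    (LT U).mapIso (Q.objObjPreimageIso A).symm ≪≫ (LTQ U).app _
  exact shift_ga_of_iso e hA (hA.of_iso e) (shift_ga_Q (f := (actC g).app (Q.objPreimage A))
    (fun i => extObjι_actObj g ((Q.objPreimage A).X i)) (hA.of_iso e) n)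

end

section

open CategoryTheory.Pretriangulated DerivedCategory
open scoped ZeroObject

variable {X : Scheme.{u}} [HasDerivedCategory.{u + 1} X.Modules]
  {A B C E F G : DerivedCategory X.Modules} {V W U : X.Opens}

/-- A class of objects closed under shifts and cones. -/
structure TriClosed (S : DerivedCategory X.Modules → Prop) : Prop where
  zero {A : DerivedCategory X.Modules} : IsZero A → S A
  shift {A : DerivedCategory X.Modules} : S A → ∀ n : ℤ, S (A⟦n⟧)
  ext {T : Triangle (DerivedCategory X.Modules)} : T ∈ distTriang _ → S T.obj₁ → S T.obj₃ →
    S T.obj₂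

namespace TriClosed

variable {S : DerivedCategory X.Modules → Prop}

lemma iso (h : TriClosed S) (e : A ≅ B) (hA : S A) : S B :=
  h.ext (T := Triangle.mk e.hom (0 : B ⟶ 0) 0)
    (isomorphic_distinguished _ (contractible_distinguished A) _
      (Triangle.isoMk _ (contractibleTriangle A) (Iso.refl A) e.symm (Iso.refl _)
        (e.hom_inv_id.trans (Category.id_comp _).symm)
        ((isZero_zero _).eq_of_tgt _ _) ((isZero_zero _).eq_of_src _ _)))
    hA (h.zero (isZero_zero _))

lemma cone (h : TriClosed S) {T : Triangle (DerivedCategory X.Modules)} (hT : T ∈ distTriang _)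
    (h₁ : S T.obj₁) (h₂ : S T.obj₂) : S T.obj₃ :=
  h.ext (rot_of_distTriang _ hT) h₂ (h.shift h₁ 1)

lemma fiber (h : TriClosed S) {T : Triangle (DerivedCategory X.Modules)} (hT : T ∈ distTriang _)
    (h₂ : S T.obj₂) (h₃ : S T.obj₃) : S T.obj₁ :=
  h.ext (inv_rot_of_distTriang _ hT) (h.shift h₃ (-1)) h₂

lemma comap (h : TriClosed S) (Φ : DerivedCategory X.Modules ⥤ DerivedCategory X.Modules) [Φ.CommShift ℤ]
    [Φ.IsTriangulated] : TriClosed fun A => S (Φ.obj A) where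
  zero hA := h.zero (Functor.map_isZero Φ hA)
  shift {A} hA n := h.iso ((Φ.commShiftIso n).app A).symm (h.shift hA n)
  ext hT h₁ h₃ := h.ext (Φ.map_distinguished _ hT) h₁ h₃

end TriClosed

lemma triClosed_van (S : Set X) :
    TriClosed fun A : DerivedCategory X.Modules => Van S A where
  zero := van_of_isZero S
  shift h n := h.shift n
  ext hT h₁ h₃ := Van.obj₂ hT h₁ h₃

lemma TriClosed.forall {ι : Sort*} {S : ι → DerivedCategory X.Modules → Prop}
    (h : ∀ i, TriClosed (S i)) : TriClosed fun A => ∀ i, S i A where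
  zero hA i := (h i).zero hA
  shift hA n i := (h i).shift (hA i) n
  ext hT h₁ h₃ i := (h i).ext hT (h₁ i) (h₃ i)

/-- The class of objects generated by the `OT V` with `P V`. -/
def Gen (P : X.Opens → Prop) (A : DerivedCategory X.Modules) : Prop :=
  ∀ S : DerivedCategory X.Modules → Prop, TriClosed S → (∀ V, P V → S (OT V)) → S A

variable {P P' : X.Opens → Prop}

lemma triClosed_gen (P : X.Opens → Prop) : TriClosed (Gen (X := X) P) where
  zero hA _ hS _ := hS.zero hA
  shift hA n S hS hV := hS.shift (hA S hS hV) n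
  ext hT h₁ h₃ S hS hV := hS.ext hT (h₁ S hS hV) (h₃ S hS hV)

lemma gen_OT (h : P V) : Gen P (OT V) := fun _ _ hV => hV V h

lemma Gen.mono (h : ∀ V, P V → P' V) (hA : Gen P A) : Gen P' A :=
  hA _ (triClosed_gen P') fun V hV => gen_OT (h V hV)

lemma Gen.van (hA : Gen P A) (h : ∀ V, P V → V ≤ U) : Van (U : Set X)ᶜ A :=
  hA _ (triClosed_van _) fun V hV => (van_OT V).mono (compl_le (h V hV))

/-- The transpose of a morphism between shifts. -/
lemma exists_transpose (A E : DerivedCategory X.Modules) (m n : ℤ) :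
    ∃ t : (A⟦m⟧ ⟶ E⟦n⟧) → (A ⟶ E⟦n - m⟧), Function.Bijective t ∧
      (∀ (a : A ⟶ A) (φ : A⟦m⟧ ⟶ E⟦n⟧), t (a⟦m⟧' ≫ φ) = a ≫ t φ) := by
  let e : A ≅ (A⟦m⟧)⟦-m⟧ := ((shiftFunctorCompIsoId _ m (-m) (by simp)).app A).symm
  let e' : (E⟦n⟧)⟦-m⟧ ≅ E⟦n - m⟧ := (shiftFunctorAdd' _ n (-m) (n - m) (by ring)).symm.app E
  refine ⟨fun φ => e.hom ≫ φ⟦-m⟧' ≫ e'.hom, ⟨fun φ ψ h => ?_, fun φ => ?_⟩, fun a φ => ?_⟩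
  · dsimp only at h
    rw [cancel_epi, cancel_mono] at h
    exact (shiftFunctor _ (-m)).map_injective h
  · obtain ⟨ψ, hψ⟩ := (shiftFunctor (DerivedCategory X.Modules) (-m)).map_surjective
      (e.inv ≫ φ ≫ e'.inv)
    exact ⟨ψ, by simp [hψ]⟩
  · have := (shiftFunctorCompIsoId (DerivedCategory X.Modules) m (-m) (by simp)).inv.naturality a
    simp only [Functor.id_map, Functor.comp_map] at this
    dsimp only
    rw [Functor.map_comp, Category.assoc]
    exact (reassoc_of% this.symm) (φ⟦-m⟧' ≫ e'.hom)

lemma transpose_zero {m n : ℤ} {t : (A⟦m⟧ ⟶ E⟦n⟧) → (A ⟶ E⟦n - m⟧)}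
    (ht : Function.Bijective t)
    (h : ∀ (a : A ⟶ A) (φ : A⟦m⟧ ⟶ E⟦n⟧), t (a⟦m⟧' ≫ φ) = a ≫ t φ) : t 0 = 0 := by
  have := h 0 0
  rwa [comp_zero, zero_comp] at this

/-- There are no nonzero morphisms from `A` to the shifts of `E`. -/
def Perp (A E : DerivedCategory X.Modules) : Prop := ∀ (n : ℤ) (f : A ⟶ E⟦n⟧), f = 0

lemma triClosed_perp (E : DerivedCategory X.Modules) : TriClosed fun A => Perp A E where
  zero hA _ f := hA.eq_of_src _ _
  shift {A} hA m n f := by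
    obtain ⟨t, ht, h⟩ := exists_transpose A E m n
    apply ht.1
    rw [transpose_zero ht h]
    exact hA _ _
  ext {T} hT h₁ h₃ n f := by
    obtain ⟨g, rfl⟩ := Triangle.yoneda_exact₂ T hT f (h₁ n _)
    rw [h₃ n g, comp_zero]

lemma Perp.of_van (hA : Van (V : Set X)ᶜ A) (hE : Van (V : Set X) E) : Perp A E :=
  fun n f => hom_eq_zero hA (hE.shift n) f

/-- Morphisms from `C` to the shifts of `E` are torsion with respect to `g`. -/
def Tors (g : Γ(X, U)) (C E : DerivedCategory X.Modules) : Prop :=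
  ∃ hC : Van (U : Set X)ᶜ C, ∀ (n : ℤ) (φ : C ⟶ E⟦n⟧), ∃ k : ℕ, ga (g ^ k) hC ≫ φ = 0

lemma ga_pow_add (g : Γ(X, U)) (k l : ℕ) (hC : Van (U : Set X)ᶜ C) :
    ga (g ^ (k + l)) hC = ga (g ^ k) hC ≫ ga (g ^ l) hC := by rw [pow_add, ga_mul]

lemma triClosed_tors (g : Γ(X, U)) (E : DerivedCategory X.Modules) :
    TriClosed fun C => Tors g C E where
  zero hA := ⟨van_of_isZero _ hA, fun _ _ => ⟨0, hA.eq_of_src _ _⟩⟩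
  shift {A} := by
    rintro ⟨hA, h⟩ m
    refine ⟨hA.shift m, fun n φ => ?_⟩
    obtain ⟨t, ht, h'⟩ := exists_transpose A E m n
    obtain ⟨k, hk⟩ := h _ (t φ)
    refine ⟨k, ht.1 ?_⟩
    rw [transpose_zero ht h', ← hk, ← h', shift_ga]
  ext {T} hT := by
    rintro ⟨h₁, h₁'⟩ ⟨h₃, h₃'⟩
    have h₂ := Van.obj₂ hT h₁ h₃
    refine ⟨h₂, fun n φ => ?_⟩
    obtain ⟨k, hk⟩ := h₁' n (T.mor₁ ≫ φ)
    rw [← Category.assoc, ga_nat _ h₁ h₂, Category.assoc] at hk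
    obtain ⟨ψ, hψ⟩ := Triangle.yoneda_exact₂ T hT _ hk
    obtain ⟨l, hl⟩ := h₃' n ψ
    refine ⟨l + k, ?_⟩
    rw [ga_pow_add, Category.assoc, hψ, ← Category.assoc, ga_nat _ h₂ h₃, Category.assoc, hl,
      comp_zero]

lemma triClosed_tors' (g : Γ(X, U)) (hC : Van (U : Set X)ᶜ C) :
    TriClosed fun E => Tors g C E where
  zero {E} hE := ⟨hC, fun n _ => ⟨0, (Functor.map_isZero (shiftFunctor _ n) hE).eq_of_tgt _ _⟩⟩
  shift {E} := by
    rintro ⟨h0, h⟩ m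
    refine ⟨hC, fun n φ => ?_⟩
    let e : (E⟦m⟧)⟦n⟧ ≅ E⟦m + n⟧ := (shiftFunctorAdd _ m n).symm.app E
    obtain ⟨k, hk⟩ := h _ (φ ≫ e.hom)
    refine ⟨k, ?_⟩
    rw [← cancel_mono e.hom, Category.assoc, hk, zero_comp]
  ext {T} hT := by
    rintro ⟨h0, h₁⟩ ⟨h0', h₃⟩
    refine ⟨hC, fun n φ => ?_⟩
    have hT' := Triangle.shift_distinguished T hT n
    obtain ⟨k, hk⟩ := h₃ n (φ ≫ T.mor₂⟦n⟧')
    rw [← Category.assoc] at hk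
    have hk' : (ga (g ^ k) hC ≫ φ) ≫ (n.negOnePow • T.mor₂⟦n⟧') = 0 := by
      rw [Linear.comp_units_smul, hk, smul_zero]
    obtain ⟨ψ, hψ⟩ : ∃ ψ : C ⟶ T.obj₁⟦n⟧, ga (g ^ k) hC ≫ φ = ψ ≫ (n.negOnePow • T.mor₁⟦n⟧') :=
      Triangle.coyoneda_exact₂ _ hT' _ hk'
    obtain ⟨l, hl⟩ := h₁ n ψ
    refine ⟨l + k, ?_⟩
    rw [ga_pow_add, Category.assoc, hψ, ← Category.assoc, hl, zero_comp]

lemma Tors.of_vIso {g : Γ(X, U)} {f : E ⟶ F} (hf : VIso V f) (hC : Van (V : Set X)ᶜ C)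
    (h : Tors g C E) : Tors g C F := by
  obtain ⟨hC', h⟩ := h
  refine ⟨hC', fun n φ => ?_⟩
  obtain ⟨ψ, rfl⟩ := (hf.shift n).exists_lift hC φ
  obtain ⟨k, hk⟩ := h n ψ
  exact ⟨k, by rw [← Category.assoc, hk, zero_comp]⟩

lemma Tors.of_vIso' {g : Γ(X, U)} {f : E ⟶ F} (hf : VIso V f) (hC : Van (V : Set X)ᶜ C)
    (h : Tors g C F) : Tors g C E := by
  obtain ⟨hC', h⟩ := h
  refine ⟨hC', fun n φ => ?_⟩
  obtain ⟨k, hk⟩ := h n (φ ≫ f⟦n⟧')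
  exact ⟨k, (hf.shift n).hom_ext hC (by rw [Category.assoc, hk, zero_comp])⟩

/-- A torsion morphism whose source has a cone of multiplication without morphisms vanishes. -/
lemma Tors.perp {g : Γ(X, U)} (h : Tors g C E) (hC : Van (U : Set X)ᶜ C) {p : C ⟶ F}
    {δ : F ⟶ C⟦(1 : ℤ)⟧} (hT : Triangle.mk (ga g hC) p δ ∈ distTriang _) (hF : Perp F E) :
    Perp C E := by
  intro n φ
  obtain ⟨_, h⟩ := h
  obtain ⟨k, hk⟩ := h n φ
  have key : ∀ ψ : C ⟶ E⟦n⟧, ga g hC ≫ ψ = 0 → ψ = 0 := by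
    intro ψ hψ
    obtain ⟨χ, hχ⟩ : ∃ χ : F ⟶ E⟦n⟧, ψ = p ≫ χ := Triangle.yoneda_exact₂ _ hT ψ hψ
    rw [hχ, hF n χ, comp_zero]
  induction k with
  | zero => rwa [pow_zero, ga_one, Category.id_comp] at hk
  | succ k ih =>
    refine ih (key _ ?_)
    rwa [← Category.assoc, ← ga_mul, ← pow_succ']

/-- Morphisms out of `LT V A` extend to `A` after multiplication. -/
lemma Tors.exists_extension {g : Γ(X, U)} (h : Tors g ((ZT V).obj A) E)
    (hA : Van (U : Set X)ᶜ A) (n : ℤ) (φ : (LT V).obj A ⟶ E⟦n⟧) :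
    ∃ (k : ℕ) (ψ : A ⟶ E⟦n⟧), (εT V).app A ≫ ψ = ga (g ^ k) (hA.LT V) ≫ φ := by
  have hT := inv_rot_of_distTriang _ (triangle_ZT V A)
  have h' := (triClosed_tors g E).shift h (-1)
  obtain ⟨hZ, h'⟩ := h'
  let β : ((ZT V).obj A)⟦(-1 : ℤ)⟧ ⟶ (LT V).obj A :=
    (Triangle.mk ((εT V).app A) ((πT V).app A) (δT V A)).invRotate.mor₁
  obtain ⟨k, hk⟩ := h' n (β ≫ φ)
  rw [← Category.assoc, ga_nat _ hZ (hA.LT V), Category.assoc] at hk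
  obtain ⟨ψ, hψ⟩ : ∃ ψ : A ⟶ E⟦n⟧, ga (g ^ k) (hA.LT V) ≫ φ = (εT V).app A ≫ ψ :=
    Triangle.yoneda_exact₂ _ hT _ hk
  exact ⟨k, ψ, hψ.symm⟩

lemma Tors.eq_zero_of_LT {g : Γ(X, U)} (h : Tors g ((ZT V).obj A) E)
    (hA : Van (U : Set X)ᶜ A) (n : ℤ) (φ : A ⟶ E⟦n⟧) (h0 : (εT V).app A ≫ φ = 0) :
    ∃ k : ℕ, ga (g ^ k) hA ≫ φ = 0 := by
  obtain ⟨ψ, hψ⟩ : ∃ ψ : (ZT V).obj A ⟶ E⟦n⟧, φ = (πT V).app A ≫ ψ :=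
    Triangle.yoneda_exact₂ _ (triangle_ZT V A) φ h0
  obtain ⟨hZ, h⟩ := h
  obtain ⟨k, hk⟩ := h n ψ
  exact ⟨k, by rw [hψ, ← Category.assoc, ga_nat _ hA hZ, Category.assoc, hk, comp_zero]⟩

lemma VIso.isoLT {f : A ⟶ F} (hf : VIso V f) (hA : Van (V : Set X)ᶜ A) :
    Nonempty ((LT V).obj F ≅ A) := by
  have : IsIso ((LT V).map f) := hf
  have := isIso_ε hA
  exact ⟨(asIso ((LT V).map f)).symm ≪≫ asIso ((εT V).app A)⟩

lemma nonempty_LT_OT (V W : X.Opens) :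
    Nonempty ((LT V).obj (OT W) ≅ OT (V ⊓ W)) :=
  (vIso_res_of_inf_le (U := V) (inf_le_right : V ⊓ W ≤ W) le_rfl).isoLT
    ((van_OT _).mono (compl_le inf_le_left))

lemma Gen.LT (hV : ∀ W, P W → P' (V ⊓ W)) (hA : Gen P A) : Gen P' ((LT V).obj A) :=
  hA _ ((triClosed_gen P').comap (LN.LT V)) fun W hW =>
    (triClosed_gen P').iso (nonempty_LT_OT V W).some.symm (gen_OT (hV W hW))

/-- `ZT V` inverts morphisms whose cone is supported on `V`. -/
lemma isIso_ZT_map {T : Triangle (DerivedCategory X.Modules)} (hT : T ∈ distTriang _)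
    (h : Van (V : Set X)ᶜ T.obj₃) : IsIso ((ZT V).map T.mor₁) :=
  (Triangle.isZero₃_iff_isIso₁ _ ((ZT V).map_distinguished T hT)).1 (isZero_ZT h)

lemma isIso_ZT_map₂ {T : Triangle (DerivedCategory X.Modules)} (hT : T ∈ distTriang _)
    (h : Van (V : Set X)ᶜ T.obj₁) : IsIso ((ZT V).map T.mor₂) :=
  (Triangle.isZero₁_iff_isIso₂ _ ((ZT V).map_distinguished T hT)).1 (isZero_ZT h)

lemma isIso_LT_ε (h : V ≤ W) (A : DerivedCategory X.Modules) :
    IsIso ((LT V).map ((εT W).app A)) := (vIso_ε W A).mono h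

/-- `LT` for a union, from `LT` for the parts. -/
lemma TriClosed.LT_sup {S : DerivedCategory X.Modules → Prop} (hS : TriClosed S)
    (hV : S ((LT V).obj A)) (hW : S ((LT W).obj A)) (hVW : S ((LT V).obj ((LT W).obj A))) :
    S ((LT (V ⊔ W)).obj A) := by
  have hA' := van_LT_compl (V ⊔ W) A
  have i₁ := isIso_LT_ε (le_sup_left : V ≤ V ⊔ W) A
  have i₂ := isIso_LT_ε (le_sup_right : W ≤ V ⊔ W) A
  set A' := (LT (V ⊔ W)).obj A with hA'def
  let e₁ : (LT V).obj A' ≅ (LT V).obj A := @asIso _ _ _ _ _ i₁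
  let e₂ : (LT W).obj A' ≅ (LT W).obj A := @asIso _ _ _ _ _ i₂
  have h1 : S ((LT V).obj A') := hS.iso e₁.symm hV
  have h2 : S ((LT W).obj A') := hS.iso e₂.symm hW
  have h3 : S ((LT V).obj ((LT W).obj A')) := hS.iso ((LT V).mapIso e₂.symm) hVW
  have h4 : S ((ZT V).obj ((LT W).obj A')) := hS.cone (triangle_ZT V _) h3 h2
  have i₃ : IsIso ((ZT V).map ((εT W).app A')) := by
    apply isIso_ZT_map (triangle_ZT W A')
    refine ((van_ZT W A').union (hA'.ZT W)).mono ?_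
    intro x hx
    by_cases hxW : x ∈ W
    · exact Or.inl hxW
    · exact Or.inr fun h => h.elim hx hxW
  exact hS.ext (triangle_ZT V A') h1 (hS.iso (@asIso _ _ _ _ _ i₃) h4)

/-- Iterated `ZT`. -/
lemma nonempty_ZT_ZT (V W : X.Opens) (A : DerivedCategory X.Modules) :
    Nonempty ((ZT V).obj ((ZT W).obj A) ≅ (ZT (V ⊔ W)).obj A) := by
  have i : IsIso ((ZT (V ⊔ W)).map ((πT W).app A)) :=
    isIso_ZT_map₂ (triangle_ZT W A) ((van_LT_compl W A).mono (compl_le le_sup_right))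
  have j : IsIso ((ZT (V ⊔ W)).map ((πT V).app ((ZT W).obj A))) :=
    isIso_ZT_map₂ (triangle_ZT V _) ((van_LT_compl V _).mono (compl_le le_sup_left))
  have hv : Van ((V ⊔ W : X.Opens) : Set X) ((ZT V).obj ((ZT W).obj A)) := by
    rw [Opens.coe_sup]
    exact (van_ZT V _).union ((van_ZT W A).ZT V)
  have k := isIso_π hv
  exact ⟨asIso ((πT (V ⊔ W)).app _) ≪≫ (asIso ((ZT (V ⊔ W)).map ((πT V).app _))).symm ≪≫
    (asIso ((ZT (V ⊔ W)).map ((πT W).app A))).symm⟩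

end

section

open Opposite

variable {X : Scheme.{u}} {F : X.Modules} {U V W : X.Opens}

/-- Sections of `F` over `V` are fractions of sections over `U` with powers of `g` as
denominators. -/
structure LocalizesAt (F : X.Modules) (h : V ≤ U) (g : Γ(X, U)) : Prop where
  torsion (s : Γ(F, U)) (hs : rs h s = 0) : ∃ k : ℕ, g ^ k • s = 0
  extend (t : Γ(F, V)) : ∃ (k : ℕ) (s : Γ(F, U)), rs h s = rf h g ^ k • t

lemma LocalizesAt.congr {U' V' : X.Opens} {h : V ≤ U} {g : Γ(X, U)} (H : LocalizesAt F h g)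
    (hU : U' = U) (hV : V' = V) (h' : V' ≤ U') : LocalizesAt F h' (rf hU.le g) := by
  subst hU hV
  simpa using H

lemma fromSpec_image_le (hU : IsAffineOpen U) (V : (Spec Γ(X, U)).Opens) :
    hU.fromSpec ''ᵁ V ≤ U := by
  rintro _ ⟨y, -, rfl⟩
  have := hU.range_fromSpec
  exact this.le ⟨y, rfl⟩

lemma fromSpec_image_top (hU : IsAffineOpen U) : hU.fromSpec ''ᵁ ⊤ = U := by
  rw [Scheme.Hom.image_top_eq_opensRange, hU.opensRange_fromSpec]

lemma appIso_inv_fromSpec (hU : IsAffineOpen U) (V : (Spec Γ(X, U)).Opens) (g : Γ(X, U)) :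
    (hU.fromSpec.appIso V).inv
      ((Spec Γ(X, U)).presheaf.map V.leTop.op ((Scheme.ΓSpecIso Γ(X, U)).inv g)) =
    rf (fromSpec_image_le hU V) g := by
  have h1 := hU.fromSpec_app_of_le U le_rfl
  have h2 := Scheme.Hom.appLE_appIso_inv hU.fromSpec (U := U) (V := V)
    (by rw [hU.fromSpec_preimage_self]; exact le_top)
  rw [Scheme.Hom.appLE, h1] at h2
  have h3 := congr($h2 g)
  refine Eq.trans ?_ (h3.trans ?_)
  · simp only [CommRingCat.comp_apply]
    congr 1
    have : X.presheaf.map (homOfLE (le_refl U)).op g = g := rf_self g le_rfl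
    rw [this]
    exact (congr($((Spec Γ(X, U)).presheaf.map_comp (homOfLE le_top).op (homOfLE _).op)
      ((Scheme.ΓSpecIso Γ(X, U)).inv g)))
  · rfl

lemma restrict_fromSpec_smul (hU : IsAffineOpen U) (V : (Spec Γ(X, U)).Opens) (g : Γ(X, U))
    (x : Γ(F.restrict hU.fromSpec, V)) :
    g • x = (rf (fromSpec_image_le hU V) g • (show Γ(F, hU.fromSpec ''ᵁ V) from x) :
      Γ(F, hU.fromSpec ''ᵁ V)) := by
  rw [← appIso_inv_fromSpec]
  rfl

theorem isLocalizing_iff (hU : IsAffineOpen U) :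
    AlgebraicGeometry.IsLocalizing (modulesSpecToSheaf.obj (F.restrict hU.fromSpec)) ↔
      ∀ g : Γ(X, U), LocalizesAt F (X.basicOpen_le g) g := by
  have hle (g : Γ(X, U)) : hU.fromSpec ''ᵁ PrimeSpectrum.basicOpen g ≤ hU.fromSpec ''ᵁ ⊤ :=
    Scheme.Hom.image_mono _ le_top
  have key (g : Γ(X, U)) : LocalizesAt F (X.basicOpen_le g) g ↔
      LocalizesAt F (hle g) (rf (fromSpec_image_le hU ⊤) g) := by
    constructor
    · intro H
      exact H.congr (fromSpec_image_top hU) (hU.fromSpec_image_basicOpen g) _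
    · intro H
      have := H.congr (fromSpec_image_top hU).symm (hU.fromSpec_image_basicOpen g).symm
        (X.basicOpen_le g)
      simpa using this
  simp_rw [key]
  have hpow (g : Γ(X, U)) (k : ℕ) (V : (Spec Γ(X, U)).Opens)
      (x : Γ(F.restrict hU.fromSpec, V)) : g ^ k • x =
      (rf (fromSpec_image_le hU V) g ^ k • (show Γ(F, hU.fromSpec ''ᵁ V) from x) :
      Γ(F, hU.fromSpec ''ᵁ V)) := by
    rw [restrict_fromSpec_smul, map_pow]
  refine forall_congr' fun g => ⟨fun H => ⟨fun s hs => ?_, fun t => ?_⟩, fun H => ?_⟩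
  · obtain ⟨⟨_, k, rfl⟩, hk⟩ := (IsLocalizedModule.eq_zero_iff (.powers g) _).mp
      (show ((modulesSpecToSheaf.obj (F.restrict hU.fromSpec)).obj.map
        (PrimeSpectrum.basicOpen g).leTop.op).hom s = 0 from hs)
    exact ⟨k, (hpow g k ⊤ s).symm.trans hk⟩
  · have hsurj := IsLocalizedModule.surj (.powers g)
      ((modulesSpecToSheaf.obj (F.restrict hU.fromSpec)).obj.map
        (PrimeSpectrum.basicOpen g).leTop.op).hom
    obtain ⟨⟨s, ⟨_, k, rfl⟩⟩, hk⟩ := hsurj t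
    refine ⟨k, s, ?_⟩
    rw [rf_rf]
    exact Eq.trans hk.symm (hpow g k (PrimeSpectrum.basicOpen g) t)
  · refine ⟨?_, ?_, ?_⟩
    · rintro ⟨_, k, rfl⟩
      simp only [map_pow]
      exact (Scheme.Modules.isUnit_algebraMap_end_of_le_basicOpen
        (M := F.restrict hU.fromSpec) g le_rfl).pow k
    · intro t
      obtain ⟨k, s, hs⟩ := H.extend t
      refine ⟨⟨s, ⟨_, k, rfl⟩⟩, ?_⟩
      rw [rf_rf] at hs
      exact (hpow g k (PrimeSpectrum.basicOpen g) t).trans hs.symm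
    · intro s s' hs
      obtain ⟨k, hk⟩ := H.torsion ((show Γ(F, hU.fromSpec ''ᵁ ⊤) from s) -
        (show Γ(F, hU.fromSpec ''ᵁ ⊤) from s')) (by
          rw [map_sub]; exact sub_eq_zero.mpr hs)
      rw [smul_sub, sub_eq_zero] at hk
      exact ⟨⟨_, k, rfl⟩, (hpow g k ⊤ s).trans (hk.trans (hpow g k ⊤ s').symm)⟩

lemma isQuasicoherent_restrict_fromSpec_iff (hU : IsAffineOpen U) :
    (F.restrict hU.fromSpec).IsQuasicoherent ↔
      ∀ g : Γ(X, U), LocalizesAt F (X.basicOpen_le g) g := by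
  rw [isQuasicoherent_iff_isIso_fromTildeΓ, isIso_fromTildeΓ_iff_isLocalizing, isLocalizing_iff]

lemma localizesAt_of_isQuasicoherent (hF : F.IsQuasicoherent) (hU : IsAffineOpen U) (g : Γ(X, U)) :
    LocalizesAt F (X.basicOpen_le g) g :=
  (isQuasicoherent_restrict_fromSpec_iff hU).mp
    (inferInstanceAs ((Scheme.Modules.restrictFunctor hU.fromSpec).obj F).IsQuasicoherent) g

end

section

universe v w

open CategoryTheory.Pretriangulated DerivedCategory

section Products
variable {C : Type u} [Category.{v} C] [Abelian C] [HasProductsOfShape ℕ C]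
  (J : ℕ → CochainComplex C ℤ)

/-- The degreewise product of complexes is the product. -/
def piEvalIsLimit (j : ℤ) : IsLimit
    ((HomologicalComplex.eval C (.up ℤ) j).mapCone (limit.cone (Discrete.functor J))) :=
  isLimitOfPreserves _ (limit.isLimit _)

lemma pi_f_hom_ext {A : C} {j : ℤ} {a b : A ⟶ (∏ᶜ J).X j}
    (h : ∀ m, a ≫ (Pi.π J m).f j = b ≫ (Pi.π J m).f j) : a = b :=
  (piEvalIsLimit J j).hom_ext fun m => h m.as

lemma exists_pi_f_lift {A : C} {j : ℤ} (a : ∀ m, A ⟶ (J m).X j) :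
    ∃ b : A ⟶ (∏ᶜ J).X j, ∀ m, b ≫ (Pi.π J m).f j = a m := by
  let c : Cone (Discrete.functor J ⋙ HomologicalComplex.eval C (.up ℤ) j) :=
    { pt := A
      π := Discrete.natTrans fun m => a m.as }
  exact ⟨(piEvalIsLimit J j).lift c, fun m => (piEvalIsLimit J j).fac c ⟨m⟩⟩

variable {J} in
/-- A map to a product is null homotopic if its components are. -/
def piHomotopy {K : CochainComplex C ℤ} {f : K ⟶ ∏ᶜ J} (h : ∀ m, Homotopy (f ≫ Pi.π J m) 0) :
    Homotopy f 0 where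
  hom i j := (exists_pi_f_lift J fun m => (h m).hom i j).choose
  zero i j hij := pi_f_hom_ext J fun m => by
    rw [(exists_pi_f_lift J fun m => (h m).hom i j).choose_spec, (h m).zero i j hij, zero_comp]
  comm i := pi_f_hom_ext J fun m => by
    have := (h m).comm i
    rw [HomologicalComplex.comp_f] at this
    rw [this, dNext_eq _ (show (ComplexShape.up ℤ).Rel i (i + 1) by simp),
      prevD_eq _ (show (ComplexShape.up ℤ).Rel (i - 1) i by simp),
      dNext_eq _ (show (ComplexShape.up ℤ).Rel i (i + 1) by simp),
      prevD_eq _ (show (ComplexShape.up ℤ).Rel (i - 1) i by simp)]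
    simp only [Preadditive.add_comp, Category.assoc, HomologicalComplex.zero_f, zero_comp]
    rw [(exists_pi_f_lift J fun m => (h m).hom (i + 1) i).choose_spec, ← (Pi.π J m).comm,
      reassoc_of% (exists_pi_f_lift J fun m => (h m).hom i (i - 1)).choose_spec]

instance isKInjective_pi [∀ m, (J m).IsKInjective] : (∏ᶜ J).IsKInjective where
  nonempty_homotopy_zero f hK :=
    ⟨piHomotopy fun m => CochainComplex.IsKInjective.homotopyZero (f ≫ Pi.π J m) hK⟩

variable [HasDerivedCategory.{w} C]

lemma exists_Q_map {K L : CochainComplex C ℤ} [L.IsKInjective] (φ : Q.obj K ⟶ Q.obj L) :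
    ∃ f, φ = Q.map f := by
  obtain ⟨g, hg⟩ := (CochainComplex.IsKInjective.Qh_map_bijective
    ((HomotopyCategory.quotient C (.up ℤ)).obj K) L).surjective
    ((quotientCompQhIso C).hom.app K ≫ φ ≫ (quotientCompQhIso C).inv.app L)
  obtain ⟨f, rfl⟩ := (HomotopyCategory.quotient C (.up ℤ)).map_surjective g
  refine ⟨f, ?_⟩
  have := (quotientCompQhIso C).hom.naturality f
  rw [← cancel_epi ((quotientCompQhIso C).hom.app K), ← this]
  refine Eq.trans ?_ (congrArg (· ≫ (quotientCompQhIso C).hom.app L) hg.symm)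
  simp

lemma homotopy_of_Q_map_eq_zero {K L : CochainComplex C ℤ} [L.IsKInjective] (f : K ⟶ L)
    (h : Q.map f = 0) : Nonempty (Homotopy f 0) := by
  have := (CochainComplex.IsKInjective.Qh_map_bijective
    ((HomotopyCategory.quotient C (.up ℤ)).obj K) L).injective
      (a₁ := (HomotopyCategory.quotient C (.up ℤ)).map f)
      (a₂ := (HomotopyCategory.quotient C (.up ℤ)).map 0) (by
    have hn (g : K ⟶ L) : Qh.map ((HomotopyCategory.quotient C (.up ℤ)).map g) =
        (quotientCompQhIso C).hom.app K ≫ Q.map g ≫ (quotientCompQhIso C).inv.app L := by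
      rw [← Category.assoc, ← (quotientCompQhIso C).hom.naturality g]
      simp
    rw [hn, hn, h, Q.map_zero])
  exact ⟨HomotopyCategory.homotopyOfEq _ _ this⟩

/-- Countable families of bounded below objects have products in the derived category. -/
lemma exists_product [EnoughInjectives C] (E : ℕ → DerivedCategory C) (a : ℕ → ℤ)
    [∀ m, (E m).IsGE (a m)] :
    ∃ (P : DerivedCategory C) (p : ∀ m, P ⟶ E m),
      (∀ (A : DerivedCategory C) (f : ∀ m, A ⟶ E m), ∃ g : A ⟶ P, ∀ m, g ≫ p m = f m) ∧
      ∀ (A : DerivedCategory C) (g : A ⟶ P), (∀ m, g ≫ p m = 0) → g = 0 := by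
  have H (m : ℕ) : ∃ J : CochainComplex C ℤ, J.IsKInjective ∧ Nonempty (Q.obj J ≅ E m) := by
    obtain ⟨K, hK, ⟨e⟩⟩ := exists_iso_Q_obj_of_isGE (E m) (a m)
    obtain ⟨L, i, _, _, _⟩ := CochainComplex.Plus.modelCategoryQuillen.exists_quasiIso_injective K (a m)
    exact ⟨L, CochainComplex.isKInjective_of_injective L (a m),
      ⟨(asIso (Q.map i)).symm ≪≫ e.symm⟩⟩
  choose J hJ e using H
  replace e m := (e m).some
  refine ⟨Q.obj (∏ᶜ J), fun m => Q.map (Pi.π J m) ≫ (e m).hom, fun A f => ?_, fun A g hg => ?_⟩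
  · have hA := Q.objObjPreimageIso A
    have (m : ℕ) := exists_Q_map (hA.hom ≫ f m ≫ (e m).inv)
    choose h hh using this
    refine ⟨hA.inv ≫ Q.map (Pi.lift h), fun m => ?_⟩
    rw [Category.assoc, ← Q.map_comp_assoc, Pi.lift_π, ← hh]
    simp
  · have hA := Q.objObjPreimageIso A
    obtain ⟨f, hf⟩ := exists_Q_map (hA.hom ≫ g)
    have h0 (m : ℕ) : Q.map (f ≫ Pi.π J m) = 0 := by
      rw [Q.map_comp, ← hf, ← cancel_mono (e m).hom, Category.assoc, Category.assoc, hg]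
      simp
    have : Q.map f = 0 := by
      rw [Q_map_eq_of_homotopy _ (piHomotopy fun m =>
        (homotopy_of_Q_map_eq_zero _ (h0 m)).some), Q.map_zero]
    rw [this] at hf
    rw [← cancel_epi hA.hom, hf, comp_zero]

end Products

end

section

open CategoryTheory.Pretriangulated DerivedCategory
open scoped ZeroObject

variable {X : Scheme.{u}} [HasDerivedCategory.{u + 1} X.Modules]
  {A B C E F G : DerivedCategory X.Modules} {V W U : X.Opens}

/-- Shift-adjunction. -/
def tr (k : ℤ) : (A⟦k⟧ ⟶ E) ≃ (A ⟶ E⟦-k⟧) :=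
  (shiftEquiv (DerivedCategory X.Modules) k).toAdjunction.homEquiv A E

lemma tr_comp (k : ℤ) (a : A ⟶ B) (φ : B⟦k⟧ ⟶ E) : tr k (a⟦k⟧' ≫ φ) = a ≫ tr k φ :=
  (shiftEquiv (DerivedCategory X.Modules) k).toAdjunction.homEquiv_naturality_left a φ

lemma tr_comp_right (k : ℤ) (φ : A⟦k⟧ ⟶ E) (f : E ⟶ F) : tr k (φ ≫ f) = tr k φ ≫ f⟦-k⟧' :=
  (shiftEquiv (DerivedCategory X.Modules) k).toAdjunction.homEquiv_naturality_right φ f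

lemma tr_zero (k : ℤ) : tr k (0 : A⟦k⟧ ⟶ E) = 0 := by
  have := tr_comp k (0 : A ⟶ A) (0 : A⟦k⟧ ⟶ E)
  rwa [comp_zero, zero_comp] at this

lemma tr_eq_zero_iff {k : ℤ} {φ : A⟦k⟧ ⟶ E} : tr k φ = 0 ↔ φ = 0 := by
  rw [← tr_zero k, (tr k).injective.eq_iff]

/-- The homology of a shift. -/
def hShift (E : DerivedCategory X.Modules) (n a b : ℤ) (h : n + a = b) :
    (homologyFunctor X.Modules a).obj (E⟦n⟧) ≅ (homologyFunctor X.Modules b).obj E :=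
  ((homologyFunctor X.Modules 0).shiftIso n a b h).app E

lemma hShift_naturality (f : E ⟶ F) (n a b : ℤ) (h : n + a = b) :
    (homologyFunctor X.Modules a).map (f⟦n⟧') ≫ (hShift F n a b h).hom =
      (hShift E n a b h).hom ≫ (homologyFunctor X.Modules b).map f :=
  ((homologyFunctor X.Modules 0).shiftIso n a b h).hom.naturality f

/-- The homology of `E` vanishes in degree `n`. -/
def HZ (n : ℤ) (E : DerivedCategory X.Modules) : Prop :=
  IsZero ((homologyFunctor X.Modules n).obj E)

lemma HZ.shift {b : ℤ} (hE : HZ b E) (n a : ℤ) (h : n + a = b) : HZ a (E⟦n⟧) :=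
  IsZero.of_iso hE (hShift E n a b h)

section
variable {T : Triangle (DerivedCategory X.Modules)}

lemma HZ.obj₁ (hT : T ∈ distTriang _) {n m : ℤ} (hm : m + 1 = n) (h₂ : HZ n T.obj₂) (h₃ : HZ m T.obj₃) : HZ n T.obj₁ :=
  (HomologySequence.exact₁ T hT m n hm).isZero_X₂ (IsZero.eq_of_src h₃ _ _)
    (IsZero.eq_of_tgt h₂ _ _)

lemma HZ.obj₃ (hT : T ∈ distTriang _) {n m : ℤ} (hm : n + 1 = m) (h₂ : HZ n T.obj₂) (h₁ : HZ m T.obj₁) : HZ n T.obj₃ :=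
  (HomologySequence.exact₃ T hT n m hm).isZero_X₂ (IsZero.eq_of_src h₂ _ _)
    (IsZero.eq_of_tgt h₁ _ _)

lemma mono_mor₁ (hT : T ∈ distTriang _) {n m : ℤ} (hm : m + 1 = n) (h₃ : HZ m T.obj₃) :
    Mono ((homologyFunctor X.Modules n).map T.mor₁) :=
  (HomologySequence.mono_homologyMap_mor₁_iff T hT m n hm).mpr (IsZero.eq_of_src h₃ _ _)

lemma epi_mor₁ (hT : T ∈ distTriang _) {n : ℤ} (h₃ : HZ n T.obj₃) :
    Epi ((homologyFunctor X.Modules n).map T.mor₁) :=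
  (HomologySequence.epi_homologyMap_mor₁_iff T hT n).mpr (IsZero.eq_of_tgt h₃ _ _)

lemma mono_mor₂ (hT : T ∈ distTriang _) {n : ℤ} (h₁ : HZ n T.obj₁) :
    Mono ((homologyFunctor X.Modules n).map T.mor₂) :=
  (HomologySequence.mono_homologyMap_mor₂_iff T hT n).mpr (IsZero.eq_of_src h₁ _ _)

lemma epi_mor₂ (hT : T ∈ distTriang _) {n m : ℤ} (hm : n + 1 = m) (h₁ : HZ m T.obj₁) :
    Epi ((homologyFunctor X.Modules n).map T.mor₂) :=
  (HomologySequence.epi_homologyMap_mor₂_iff T hT n m hm).mpr (IsZero.eq_of_tgt h₁ _ _)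

lemma isIso_mor₁ (hT : T ∈ distTriang _) {n m : ℤ} (hm : m + 1 = n) (h : HZ m T.obj₃) (h' : HZ n T.obj₃) :
    IsIso ((homologyFunctor X.Modules n).map T.mor₁) := by
  have := mono_mor₁ hT hm h
  have := epi_mor₁ hT h'
  exact isIso_of_mono_of_epi _

lemma isIso_mor₂ (hT : T ∈ distTriang _) {n m : ℤ} (hm : n + 1 = m) (h : HZ n T.obj₁) (h' : HZ m T.obj₁) :
    IsIso ((homologyFunctor X.Modules n).map T.mor₂) := by
  have := mono_mor₂ hT h
  have := epi_mor₂ hT hm h'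
  exact isIso_of_mono_of_epi _

end

/-- Classes which become zero under a morphism injective on homology are locally zero. -/
lemma locally_zero_of_mono (k : ℤ) (f : E ⟶ F) [Mono ((homologyFunctor X.Modules (-k)).map f)]
    (φ : (OT V)⟦k⟧ ⟶ E) (h : φ ≫ f = 0) {x : X} (hx : x ∈ V) :
    ∃ (V' : X.Opens) (hV : V' ≤ V), x ∈ V' ∧ (res hV)⟦k⟧' ≫ φ = 0 := by
  have hmono : Mono ((homologyFunctor X.Modules 0).map (f⟦-k⟧')) := by
    have := hShift_naturality f (-k) 0 (-k) (by simp)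
    rw [← Iso.eq_comp_inv] at this
    rw [this]
    infer_instance
  have h0 : cl (tr k φ) = 0 := by
    rw [← cancel_mono ((homologyFunctor X.Modules 0).map (f⟦-k⟧')), ← cl_comp, ← tr_comp_right, h,
      tr_zero, cl_zero, zero_comp]
  obtain ⟨V', hV, hx', h'⟩ := locally_zero_of_cl _ h0 hx
  exact ⟨V', hV, hx', by rwa [← tr_eq_zero_iff, tr_comp]⟩

lemma cl_sub (φ ψ : OT V ⟶ E) : cl (φ - ψ) = cl φ - cl ψ := by
  rw [eq_sub_iff_add_eq, ← cl_add, sub_add_cancel]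

/-- Classes lift locally along morphisms surjective on homology. -/
lemma exists_local_factor (k : ℤ) (f : E ⟶ F) [Epi ((homologyFunctor X.Modules (-k)).map f)]
    (ψ : (OT V)⟦k⟧ ⟶ F) {x : X} (hx : x ∈ V) :
    ∃ (V' : X.Opens) (hV : V' ≤ V), x ∈ V' ∧ ∃ φ : (OT V')⟦k⟧ ⟶ E,
      φ ≫ f = (res hV)⟦k⟧' ≫ ψ := by
  have hepi : Epi ((homologyFunctor X.Modules 0).map (f⟦-k⟧')) := by
    have := hShift_naturality f (-k) 0 (-k) (by simp)
    rw [← Iso.eq_comp_inv] at this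
    rw [this]
    infer_instance
  obtain ⟨V₁, h₁, hx₁, t, ht⟩ :=
    exists_local_lift ((homologyFunctor X.Modules 0).map (f⟦-k⟧')) (cl (tr k ψ)) hx
  obtain ⟨V₂, h₂, hx₂, φ, hφ⟩ := exists_cl t hx₁
  have h0 : cl (φ ≫ f⟦-k⟧' - res (h₂.trans h₁) ≫ tr k ψ) = 0 := by
    rw [cl_sub, cl_comp, hφ, cl_OTmap, Category.assoc, ht, ← Category.assoc, OEle_comp, sub_self]
  obtain ⟨V₃, h₃, hx₃, h⟩ := locally_zero_of_cl _ h0 hx₂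
  refine ⟨V₃, h₃.trans (h₂.trans h₁), hx₃, (tr k).symm (res h₃ ≫ φ), (tr k).injective ?_⟩
  rw [tr_comp_right, Equiv.apply_symm_apply, tr_comp, Category.assoc]
  rw [Preadditive.comp_sub, sub_eq_zero, res_res_assoc] at h
  exact h

end

section

open CategoryTheory.Pretriangulated DerivedCategory
open scoped ZeroObject

section Modules
variable {X : Scheme.{u}} {F G : X.Modules} {V W U : X.Opens}

lemma LocalizesAt.of_iso {h : V ≤ U} {g : Γ(X, U)} (H : LocalizesAt F h g) (e : F ≅ G) :
    LocalizesAt G h g where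
  torsion s hs := by
    obtain ⟨k, hk⟩ := H.torsion (e.inv.app U s) (by rw [← app_rs, hs, map_zero])
    refine ⟨k, ?_⟩
    have := congrArg (e.hom.app U) hk
    rw [Scheme.Modules.Hom.app_smul, map_zero, ← app_comp, e.inv_hom_id] at this
    exact this
  extend t := by
    obtain ⟨k, s, hs⟩ := H.extend (e.inv.app V t)
    refine ⟨k, e.hom.app U s, ?_⟩
    rw [← app_rs, hs, Scheme.Modules.Hom.app_smul, ← app_comp, e.inv_hom_id]
    rfl

/-- Sections over affine opens are compatible with localization. -/
def QC (F : X.Modules) : Prop :=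
  ∀ (U : X.Opens), IsAffineOpen U → ∀ (g : Γ(X, U)) (V : X.Opens) (h : V ≤ U),
    V = X.basicOpen g → LocalizesAt F h g

lemma QC.of_iso (h : QC F) (e : F ≅ G) : QC G := fun U hU g V hV hV' =>
  (h U hU g V hV hV').of_iso e

lemma qc_of_isQuasicoherent (hF : F.IsQuasicoherent) : QC F := by
  rintro U hU g _ h rfl
  exact localizesAt_of_isQuasicoherent hF hU g

lemma qc_of_isZero (h : IsZero F) : QC F := fun U hU g V hV _ =>
  have (W : X.Opens) (s : Γ(F, W)) : s = 0 := by
    have h1 : (𝟙 F : F ⟶ F).app W s = (0 : F ⟶ F).app W s := by rw [h.eq_of_src (𝟙 F) 0]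
    exact h1
  { torsion := fun s _ => ⟨0, this _ _⟩
    extend := fun t => ⟨0, 0, by rw [this _ t, map_zero, smul_zero]⟩ }

end Modules

variable {X : Scheme.{u}} [HasDerivedCategory.{u + 1} X.Modules]
  {A B C E F G : DerivedCategory X.Modules} {V W U : X.Opens}

/-- The complex has quasi-coherent homology, in terms of sections over affine opens. -/
def DQ (E : DerivedCategory X.Modules) : Prop :=
  ∀ n : ℤ, QC ((homologyFunctor X.Modules n).obj E)

lemma DQ.shift (h : DQ E) (n : ℤ) : DQ (E⟦n⟧) := fun a =>
  (h (n + a)).of_iso (hShift E n a _ rfl).symm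

lemma isLE_OT (V : X.Opens) : (OT V).IsLE 0 :=
  inferInstanceAs (((singleFunctor X.Modules 0).obj (OE V)).IsLE 0)

lemma OT_hom_eq_zero (h : ∀ i : ℤ, i ≤ 0 → HZ i E) (φ : OT V ⟶ E) : φ = 0 := by
  have := isLE_OT V
  have : E.IsGE 1 := (isGE_iff E 1).2 fun i hi => h i (by omega)
  exact TStructure.t.zero_of_isLE_of_isGE φ 0 1 (by omega) ‹_› ‹_›

lemma OT_shift_hom_eq_zero {k : ℤ} (h : ∀ i : ℤ, i ≤ -k → HZ i E) (φ : (OT V)⟦k⟧ ⟶ E) :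
    φ = 0 := by
  rw [← tr_eq_zero_iff]
  exact OT_hom_eq_zero (fun i hi => (h (-k + i) (by omega)).shift _ _ rfl) _

lemma cl_bijective_of_isZero (hE : ∀ n : ℤ, n ≠ 0 → HZ n E) (V : X.Opens) :
    Function.Bijective (cl : (OT V ⟶ E) → (OE V ⟶ H0 E)) := by
  have : E.IsGE 0 := (isGE_iff E 0).2 fun i hi => hE i (by omega)
  have : E.IsLE 0 := (isLE_iff E 0).2 fun i hi => hE i (by omega)
  obtain ⟨M, ⟨e⟩⟩ := exists_iso_singleFunctor_obj_of_isGE_of_isLE E 0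
  let e' : Q.obj ((HomologicalComplex.single X.Modules (.up ℤ) 0).obj M) ≅ E := e.symm
  let c : M ≅ H0 E := (HomologicalComplex.singleObjHomologySelfIso (.up ℤ) 0 M).symm ≪≫
    hQ _ ≪≫ (DerivedCategory.homologyFunctor X.Modules 0).mapIso e'
  have key (f : OE V ⟶ M) :
      cl (Q.map ((HomologicalComplex.single X.Modules (.up ℤ) 0).map f) ≫ e'.hom) =
      f ≫ c.hom := by
    rw [cl_comp, cl_Q]
    have h1 : clC ((HomologicalComplex.single X.Modules (.up ℤ) 0).map f) =
        f ≫ (HomologicalComplex.singleObjHomologySelfIso (.up ℤ) 0 M).inv := by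
      have := clC_comp (𝟙 (SC V)) ((HomologicalComplex.single X.Modules (.up ℤ) 0).map f)
      rw [Category.id_comp] at this
      rw [this, clC_id]
      exact HomologicalComplex.singleObjHomologySelfIso_inv_naturality (.up ℤ) 0 f
    rw [h1]
    simp only [c, Iso.trans_hom, Iso.symm_hom, Functor.mapIso_hom, Category.assoc]
  have hfac (φ : OT V ⟶ E) : ∃ f : OE V ⟶ M,
      φ = Q.map ((HomologicalComplex.single X.Modules (.up ℤ) 0).map f) ≫ e'.hom := by
    obtain ⟨f, hf⟩ := (singleFunctor X.Modules 0).map_surjective (X := OE V) (Y := M)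
      (φ ≫ e'.inv)
    refine ⟨f, ?_⟩
    rw [← Iso.comp_inv_eq]
    exact hf.symm
  constructor
  · intro φ ψ h
    obtain ⟨f, rfl⟩ := hfac φ
    obtain ⟨g, rfl⟩ := hfac ψ
    rw [key, key, cancel_mono] at h
    rw [h]
  · intro t
    exact ⟨_, (key (t ≫ c.inv)).trans (by simp)⟩

end

section

open CategoryTheory.Pretriangulated DerivedCategory
open scoped ZeroObject

section Modules
variable {X : Scheme.{u}} {F G : X.Modules} {V V₁ V₂ W U : X.Opens}

lemma inf_basicOpen (h : V ≤ U) (g : Γ(X, U)) : X.basicOpen (rf h g) = V ⊓ X.basicOpen g :=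
  X.basicOpen_res g (homOfLE h).op

lemma QC.exists_add (hF : QC F) (hV : IsAffineOpen V) {a b : Γ(X, V)} (hab : IsCoprime a b)
    (h₁ : V₁ = X.basicOpen a) (h₂ : V₂ = X.basicOpen b) (s : Γ(F, V₁ ⊓ V₂)) :
    ∃ (s₁ : Γ(F, V₁)) (s₂ : Γ(F, V₂)), s = rs inf_le_left s₁ + rs inf_le_right s₂ := by
  have hV₁ : V₁ ≤ V := h₁.trans_le (X.basicOpen_le a)
  have hV₂ : V₂ ≤ V := h₂.trans_le (X.basicOpen_le b)
  obtain ⟨k, s₁, hs₁⟩ := (hF V₁ (h₁ ▸ hV.basicOpen a) (rf hV₁ b) (V₁ ⊓ V₂) inf_le_left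
    (by rw [inf_basicOpen, h₂])).extend s
  obtain ⟨l, s₂, hs₂⟩ := (hF V₂ (h₂ ▸ hV.basicOpen b) (rf hV₂ a) (V₁ ⊓ V₂) inf_le_right
    (by rw [inf_basicOpen, h₁, inf_comm])).extend s
  obtain ⟨p, q, hpq⟩ := hab.pow (m := l) (n := k)
  refine ⟨rf hV₁ q • s₁, rf hV₂ p • s₂, ?_⟩
  rw [rs_smul, rs_smul, hs₁, hs₂, rf_rf, rf_rf, rf_rf, rf_rf, ← map_pow, ← map_pow, smul_smul,
    smul_smul, ← map_mul, ← map_mul, ← add_smul, ← map_add, add_comm, hpq, map_one, one_smul]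

lemma sup_basicOpen_eq {a b : Γ(X, V)} (hV : IsAffineOpen V) (hab : IsCoprime a b) :
    X.basicOpen a ⊔ X.basicOpen b = V := by
  have := (hV.iSup_basicOpen_eq_self_iff (s := {a, b})).2 (by
    rw [Ideal.eq_top_iff_one, Ideal.mem_span_pair]
    exact hab)
  rw [iSup_subtype, iSup_insert, iSup_singleton] at this
  exact this

end Modules

variable {X : Scheme.{u}} [HasDerivedCategory.{u + 1} X.Modules]
  {A B C E F G : DerivedCategory X.Modules} {V V₁ V₂ W U : X.Opens}

lemma isZero_OT_bot : IsZero (OT (⊥ : X.Opens)) :=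
  Van.isZero (by simpa using van_OT (⊥ : X.Opens))

lemma res_comp_eq_zero (h : V ≤ W) (hW : W ≤ U) {c : OT U ⟶ E} (hc : res hW ≫ c = 0) :
    res (h.trans hW) ≫ c = 0 := by
  rw [← res_res h hW, Category.assoc, hc, comp_zero]

/-- A locally zero class on an affine open is zero if vanishing can be glued along coverings by
two basic opens. -/
lemma eq_zero_of_locally_zero (hU : IsAffineOpen U) (c : OT U ⟶ E)
    (h : ∀ x ∈ U, ∃ (V : X.Opens) (hV : V ≤ U), x ∈ V ∧ res hV ≫ c = 0)
    (H : ∀ (V : X.Opens) (hV : V ≤ U), IsAffineOpen V → ∀ a b : Γ(X, V), IsCoprime a b →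
      res ((X.basicOpen_le a).trans hV) ≫ c = 0 → res ((X.basicOpen_le b).trans hV) ≫ c = 0 →
      res hV ≫ c = 0) : c = 0 := by
  let I : Ideal Γ(X, U) :=
    { carrier := {g | res (X.basicOpen_le g) ≫ c = 0}
      zero_mem' := by
        have : X.basicOpen (0 : Γ(X, U)) ≤ ⊥ := by simp
        exact res_comp_eq_zero this bot_le (isZero_OT_bot.eq_of_src _ _)
      add_mem' := by
        intro g g' hg hg'
        have hle := X.basicOpen_le (g + g')
        have hu : IsUnit (rf hle (g + g')) := RingedSpace.isUnit_res_basicOpen _ _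
        refine H _ hle (hU.basicOpen _) (rf hle g) (rf hle g') ?_ ?_ ?_
        · obtain ⟨v, hv⟩ := hu.exists_left_inv
          exact ⟨v, v, by rw [← mul_add, ← map_add, hv]⟩
        · exact res_comp_eq_zero ((inf_basicOpen hle g).trans_le inf_le_right) _ hg
        · exact res_comp_eq_zero ((inf_basicOpen hle g').trans_le inf_le_right) _ hg'
      smul_mem' := by
        intro r g hg
        have : X.basicOpen (r • g) ≤ X.basicOpen g := by
          rw [smul_eq_mul, X.basicOpen_mul]; exact inf_le_right
        exact res_comp_eq_zero this _ hg }
  have hI : (1 : Γ(X, U)) ∈ I := by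
    rw [← Ideal.eq_top_iff_one, eq_top_iff,
      ← (hU.self_le_iSup_basicOpen_iff (s := (I : Set Γ(X, U)))).1 ?_, Ideal.span_le]
    intro x hx
    obtain ⟨V, hV, hxV, hc⟩ := h x hx
    obtain ⟨f, hf, hxf⟩ := hU.exists_basicOpen_le ⟨x, hxV⟩ hx
    exact Opens.mem_iSup.2 ⟨⟨f, res_comp_eq_zero hf hV hc⟩, hxf⟩
  have hU1 : U ≤ X.basicOpen (1 : Γ(X, U)) := by simp
  have := res_comp_eq_zero hU1 _ hI
  rwa [res_self, Category.id_comp] at this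

lemma eq_zero_of_sup (hV : V₁ ⊔ V₂ = V) (h₁ : V₁ ≤ V) (h₂ : V₂ ≤ V) (c : OT V ⟶ E)
    (hc₁ : res h₁ ≫ c = 0) (hc₂ : res h₂ ≫ c = 0)
    (H : ∀ b : (OT (V₁ ⊓ V₂))⟦(1 : ℤ)⟧ ⟶ E, ∃ b₁ b₂,
      b = (res inf_le_left)⟦(1 : ℤ)⟧' ≫ b₁ + (res inf_le_right)⟦(1 : ℤ)⟧' ≫ b₂) : c = 0 := by
  subst hV
  exact mayerVietoris_eq_zero c hc₁ hc₂ H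

lemma cl_res (h : V ≤ W) (φ : OT W ⟶ E) :
    secEquiv V (H0 E) (cl (res h ≫ φ)) = rs h (secEquiv W (H0 E) (cl φ)) := by
  rw [cl_OTmap, secEquiv_LE]

lemma exists_add_of_single (hE : ∀ n : ℤ, n ≠ 0 → HZ n E) (hQ : QC (H0 E)) (hV : IsAffineOpen V)
    {a b : Γ(X, V)} (hab : IsCoprime a b)
    (h₁ : V₁ = X.basicOpen a) (h₂ : V₂ = X.basicOpen b) (β : OT (V₁ ⊓ V₂) ⟶ E) :
    ∃ β₁ β₂, β = res inf_le_left ≫ β₁ + res inf_le_right ≫ β₂ := by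
  obtain ⟨s₁, s₂, hs⟩ := hQ.exists_add hV hab h₁ h₂ (secEquiv _ (H0 E) (cl β))
  obtain ⟨β₁, hβ₁⟩ := (cl_bijective_of_isZero hE V₁).2 ((secEquiv _ _).symm s₁)
  obtain ⟨β₂, hβ₂⟩ := (cl_bijective_of_isZero hE V₂).2 ((secEquiv _ _).symm s₂)
  refine ⟨β₁, β₂, (cl_bijective_of_isZero hE _).1 ((secEquiv _ _).injective ?_)⟩
  rw [cl_add, map_add, cl_res, cl_res, hβ₁, hβ₂, AddEquiv.apply_symm_apply,
    AddEquiv.apply_symm_apply, hs]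

lemma eq_zero_of_exists_add (n m : ℤ) (hm : n + 1 = m) (hE : HZ m E)
    (H : ∀ V : X.Opens, IsAffineOpen V → ∀ a b : Γ(X, V), IsCoprime a b →
      ∀ β : OT (X.basicOpen a ⊓ X.basicOpen b) ⟶ E⟦n⟧,
      ∃ (β₁ : OT (X.basicOpen a) ⟶ E⟦n⟧) (β₂ : OT (X.basicOpen b) ⟶ E⟦n⟧), β = res inf_le_left ≫ β₁ + res inf_le_right ≫ β₂)
    (hU : IsAffineOpen U) (φ : OT U ⟶ E⟦m⟧) : φ = 0 := by
  refine eq_zero_of_locally_zero hU φ (fun x hx => ?_) fun V hV hVa a b hab ha hb => ?_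
  · have h0 : cl φ = 0 := IsZero.eq_of_tgt (hE.shift m 0 (add_zero m)) _ _
    exact locally_zero_of_cl φ h0 hx
  · refine eq_zero_of_sup (sup_basicOpen_eq hVa hab) (X.basicOpen_le a) (X.basicOpen_le b) _
      (by rwa [res_res_assoc]) (by rwa [res_res_assoc]) fun b => ?_
    let e : E⟦m⟧ ≅ (E⟦n⟧)⟦(1 : ℤ)⟧ := (shiftFunctorAdd' _ n 1 m hm).app E
    obtain ⟨β, hβ⟩ := (shiftFunctor (DerivedCategory X.Modules) (1 : ℤ)).map_surjective (b ≫ e.hom)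
    obtain ⟨β₁, β₂, rfl⟩ := H V hVa _ _ hab β
    refine ⟨β₁⟦(1 : ℤ)⟧' ≫ e.inv, β₂⟦(1 : ℤ)⟧' ≫ e.inv, ?_⟩
    rw [← cancel_mono e.hom, ← hβ, Functor.map_add, Functor.map_comp, Functor.map_comp,
      Preadditive.add_comp, Category.assoc, Category.assoc, Category.assoc, Category.assoc,
      e.inv_hom_id, Category.comp_id, Category.comp_id]

/-- Vanishing of the cohomology of quasi-coherent modules over affine opens. -/
lemma eq_zero_of_single (hE : ∀ n : ℤ, n ≠ 0 → HZ n E) (hQ : QC (H0 E)) (n : ℕ) :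
    ∀ (U : X.Opens), IsAffineOpen U → ∀ φ : OT U ⟶ E⟦(n + 1 : ℤ)⟧, φ = 0 := by
  induction n with
  | zero =>
    intro U hU φ
    refine eq_zero_of_exists_add 0 _ (by simp) (hE _ (by simp)) (fun V hV a b hab β => ?_) hU φ
    exact exists_add_of_single (fun n hn => (hE n hn).shift 0 n (by simp))
      (hQ.of_iso (hShift E 0 0 0 (by simp)).symm) hV hab rfl rfl β
  | succ n ih =>
    intro U hU φ
    refine eq_zero_of_exists_add (n + 1) _ (by simp) (hE _ (by omega))
      (fun V hV a b hab β => ⟨0, 0, ?_⟩) hU φ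
    rw [comp_zero, comp_zero, add_zero]
    refine ih _ ?_ β
    rw [← inf_basicOpen (X.basicOpen_le a) b]
    exact (hV.basicOpen a).basicOpen _

end

section

open CategoryTheory.Pretriangulated DerivedCategory
open scoped ZeroObject

variable {X : Scheme.{u}} [HasDerivedCategory.{u + 1} X.Modules]
  {A B C E F G : DerivedCategory X.Modules} {V V₁ V₂ W U : X.Opens}

lemma exists_trunc (E : DerivedCategory X.Modules) (a : ℤ) :
    ∃ (K N : DerivedCategory X.Modules) (f : K ⟶ E) (g : E ⟶ N) (h : N ⟶ K⟦(1 : ℤ)⟧),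
      Triangle.mk f g h ∈ distTriang _ ∧ (∀ i, a < i → HZ i K) ∧ (∀ i, i ≤ a → HZ i N) := by
  obtain ⟨K, N, hK, hN, f, g, h, hT⟩ := TStructure.t.exists_triangle E a (a + 1) rfl
  refine ⟨K, N, f, g, h, hT, fun i hi => ?_, fun i hi => ?_⟩
  · exact (isLE_iff K a).1 ⟨hK⟩ i hi
  · exact (isGE_iff N (a + 1)).1 ⟨hN⟩ i (by omega)

section
variable {T : Triangle (DerivedCategory X.Modules)} {a : ℤ}

lemma qc_of_iso_mor₁ {n : ℤ} (h : IsIso ((homologyFunctor X.Modules n).map T.mor₁))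
    (hQ : QC ((homologyFunctor X.Modules n).obj T.obj₂)) :
    QC ((homologyFunctor X.Modules n).obj T.obj₁) :=
  hQ.of_iso (@asIso _ _ _ _ _ h).symm

lemma qc_of_iso_mor₂ {n : ℤ} (h : IsIso ((homologyFunctor X.Modules n).map T.mor₂))
    (hQ : QC ((homologyFunctor X.Modules n).obj T.obj₂)) :
    QC ((homologyFunctor X.Modules n).obj T.obj₃) :=
  hQ.of_iso (@asIso _ _ _ _ _ h)

lemma DQ.trunc₁ (hT : T ∈ distTriang _) (hE : DQ T.obj₂) (h₁ : ∀ i, a < i → HZ i T.obj₁)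
    (h₃ : ∀ i, i ≤ a → HZ i T.obj₃) : DQ T.obj₁ := fun n => by
  rcases lt_or_ge a n with h | h
  · exact qc_of_isZero (h₁ n h)
  · exact qc_of_iso_mor₁ (isIso_mor₁ hT (sub_add_cancel n 1) (h₃ _ (by omega)) (h₃ _ h)) (hE n)

lemma DQ.trunc₃ (hT : T ∈ distTriang _) (hE : DQ T.obj₂) (h₁ : ∀ i, a < i → HZ i T.obj₁)
    (h₃ : ∀ i, i ≤ a → HZ i T.obj₃) : DQ T.obj₃ := fun n => by
  rcases lt_or_ge a n with h | h
  · exact qc_of_iso_mor₂ (isIso_mor₂ hT rfl (h₁ _ h) (h₁ _ (by omega))) (hE n)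
  · exact qc_of_isZero (h₃ n h)

end

lemma shift_hom_eq_zero_of_single {d k : ℤ} (hE : ∀ n : ℤ, n ≠ d → HZ n E) (hQ : DQ E)
    (hd : d < -k) (hV : IsAffineOpen V) (φ : (OT V)⟦k⟧ ⟶ E) : φ = 0 := by
  obtain ⟨n, hn⟩ : ∃ n : ℕ, d + (n + 1 : ℤ) = -k := ⟨(-k - d - 1).toNat, by omega⟩
  let e : E⟦-k⟧ ≅ (E⟦d⟧)⟦(n + 1 : ℤ)⟧ := (shiftFunctorAdd' _ d (n + 1) (-k) hn).app E
  have : tr k φ ≫ e.hom = 0 :=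
    eq_zero_of_single (fun i hi => (hE (d + i) (by omega)).shift _ _ rfl) (hQ.shift d 0) n V hV _
  rw [← tr_eq_zero_iff, ← cancel_mono e.hom, this, zero_comp]

lemma shift_hom_eq_zero_of_bounded {k : ℤ} (d : ℕ) :
    ∀ E : DerivedCategory X.Modules, DQ E → (∀ n : ℤ, -k ≤ n → HZ n E) →
      (∀ n : ℤ, n < -k - d → HZ n E) → ∀ V : X.Opens, IsAffineOpen V →
      ∀ φ : (OT V)⟦k⟧ ⟶ E, φ = 0 := by
  induction d with
  | zero =>
    intro E _ h₁ h₂ V _ φ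
    have : IsZero E := isZero_of_homology fun n => by
      rcases lt_or_ge n (-k) with h | h
      · exact h₂ n (by simpa using h)
      · exact h₁ n h
    exact this.eq_of_tgt _ _
  | succ d ih =>
    intro E hE h₁ h₂ V hV φ
    obtain ⟨K, N, f, g, h, hT, hK, hN⟩ := exists_trunc E (-k - d - 1)
    have hKQ : DQ K := DQ.trunc₁ hT hE hK hN
    have hNQ : DQ N := DQ.trunc₃ hT hE hK hN
    have h0 : φ ≫ g = 0 := ih N hNQ (fun n hn => HZ.obj₃ hT rfl (h₁ n hn) (hK _ (by omega)))
      (fun n hn => hN n (by omega)) V hV _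
    obtain ⟨ψ, hψ⟩ : ∃ ψ : (OT V)⟦k⟧ ⟶ K, φ = ψ ≫ f := Triangle.coyoneda_exact₂ _ hT φ h0
    rw [hψ, shift_hom_eq_zero_of_single (d := -k - d - 1) (fun n hn => ?_) hKQ (by omega) hV ψ,
      zero_comp]
    rcases lt_or_gt_of_ne hn with h | h
    · exact HZ.obj₁ hT (sub_add_cancel n 1) (h₂ n (by push_cast; omega)) (hN _ (by omega))
    · exact hK n h

lemma shift_hom_eq_zero_of_isGE {k a : ℤ} (hE : DQ E) (h₁ : ∀ n : ℤ, -k ≤ n → HZ n E)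
    (h₂ : ∀ n : ℤ, n < a → HZ n E) (hV : IsAffineOpen V) (φ : (OT V)⟦k⟧ ⟶ E) : φ = 0 :=
  shift_hom_eq_zero_of_bounded (-k - a).toNat E hE h₁ (fun n hn => h₂ n (by omega)) V hV φ

end

section

open CategoryTheory.Pretriangulated DerivedCategory
open scoped ZeroObject

variable {X : Scheme.{u}} [HasDerivedCategory.{u + 1} X.Modules]
  {A B C E F G : DerivedCategory X.Modules} {V V₁ V₂ W U : X.Opens}

/-- A Postnikov tower of `G`. -/
structure Tower (G : DerivedCategory X.Modules) where
  obj : ℕ → DerivedCategory X.Modules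
  τ (m : ℕ) : G ⟶ obj m
  q (m : ℕ) : obj (m + 1) ⟶ obj m
  comm (m : ℕ) : τ (m + 1) ≫ q m = τ m
  hz (m : ℕ) (i : ℤ) : i < -m → HZ i (obj m)
  iso (m : ℕ) (i : ℤ) : -m ≤ i → IsIso ((homologyFunctor X.Modules i).map (τ m))

lemma exists_tower (G : DerivedCategory X.Modules) : Nonempty (Tower G) := by
  choose K N f g h hT hK hN using fun m : ℕ => exists_trunc G (-m - 1)
  have hq (m : ℕ) : ∃ q : N (m + 1) ⟶ N m, g m = g (m + 1) ≫ q := by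
    refine Triangle.yoneda_exact₂ _ (hT (m + 1)) (g m) ?_
    refine TStructure.t.zero_of_isLE_of_isGE _ (-(m + 1 : ℕ) - 1) (-m) (by omega) ?_ ?_
    · exact (isLE_iff _ _).2 (hK (m + 1))
    · exact (isGE_iff _ _).2 fun i hi => hN m i (by omega)
  choose q hq using hq
  exact ⟨⟨N, g, q, fun m => (hq m).symm, fun m i hi => hN m i (by omega), fun m i hi =>
    isIso_mor₂ (hT m) rfl (hK m _ (by omega)) (hK m _ (by omega))⟩⟩

lemma hz_obj₁_of_mono_of_epi {T : Triangle (DerivedCategory X.Modules)} (hT : T ∈ distTriang _)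
    {n m : ℤ} (hm : m + 1 = n) (h : Mono ((homologyFunctor X.Modules n).map T.mor₂))
    (h' : Epi ((homologyFunctor X.Modules m).map T.mor₂)) : HZ n T.obj₁ :=
  (HomologySequence.exact₁ T hT m n hm).isZero_X₂
    ((HomologySequence.epi_homologyMap_mor₂_iff T hT m n hm).1 h')
    ((HomologySequence.mono_homologyMap_mor₂_iff T hT n).1 h)

namespace Tower

variable (P : Tower G)

lemma isIso_q (m : ℕ) (i : ℤ) (hi : -m ≤ i) :
    IsIso ((homologyFunctor X.Modules i).map (P.q m)) := by
  have h₁ := P.iso m i hi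
  have h₂ := P.iso (m + 1) i (by push_cast; omega)
  rw [← P.comm m, Functor.map_comp] at h₁
  exact IsIso.of_isIso_comp_left ((homologyFunctor X.Modules i).map (P.τ (m + 1))) _

lemma exists_fiber (hG : DQ G) (m : ℕ) : ∃ (N : DerivedCategory X.Modules)
    (f : N ⟶ P.obj (m + 1)) (δ : P.obj m ⟶ N⟦(1 : ℤ)⟧),
    Triangle.mk f (P.q m) δ ∈ distTriang _ ∧ DQ N ∧ ∀ i : ℤ, i ≠ -m - 1 → HZ i N := by
  obtain ⟨N, f, δ, hT⟩ := distinguished_cocone_triangle₁ (P.q m)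
  have hz (i : ℤ) (hi : i ≠ -m - 1) : HZ i N := by
    rcases lt_or_gt_of_ne hi with hi | hi
    · exact HZ.obj₁ hT (sub_add_cancel i 1) (P.hz (m + 1) i (by push_cast; omega))
        (P.hz m _ (by omega))
    · have h₁ := P.isIso_q m i (by omega)
      refine hz_obj₁_of_mono_of_epi hT (sub_add_cancel i 1) (@IsIso.mono_of_iso _ _ _ _ _ h₁) ?_
      rcases eq_or_ne i (-m) with rfl | hi'
      · have : HZ (-m - 1 : ℤ) (P.obj m) := P.hz m _ (by omega)
        exact ⟨fun _ _ _ => IsZero.eq_of_src this _ _⟩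
      · exact @IsIso.epi_of_iso _ _ _ _ _ (P.isIso_q m (i - 1) (by omega))
  refine ⟨N, f, δ, hT, fun i => ?_, hz⟩
  rcases eq_or_ne i (-m - 1) with rfl | hi
  · refine qc_of_iso_mor₁ (isIso_mor₁ hT (sub_add_cancel _ 1) (P.hz m _ (by omega))
      (P.hz m _ (by omega))) ?_
    have := P.iso (m + 1) (-m - 1) (by push_cast; omega)
    exact (hG _).of_iso (@asIso _ _ _ _ _ this)
  · exact qc_of_isZero (hz i hi)

lemma q_surjective (hG : DQ G) (hV : IsAffineOpen V) (k : ℤ) (m : ℕ)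
    (f : (OT V)⟦k⟧ ⟶ P.obj m) : ∃ f' : (OT V)⟦k⟧ ⟶ P.obj (m + 1), f' ≫ P.q m = f := by
  obtain ⟨N, i, δ, hT, hN, hz⟩ := P.exists_fiber hG m
  rcases lt_or_ge (m : ℤ) k with h | h
  · exact ⟨0, by rw [zero_comp, OT_shift_hom_eq_zero (fun i hi => P.hz m i (by omega)) f]⟩
  · have h0 : f ≫ δ = 0 := shift_hom_eq_zero_of_single (d := -m - 2)
      (fun n hn => (hz (1 + n) (by omega)).shift _ _ rfl) (hN.shift 1) (by omega) hV _
    obtain ⟨f', hf'⟩ := Triangle.coyoneda_exact₃ _ hT f h0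
    exact ⟨f', hf'.symm⟩

lemma q_injective (hG : DQ G) (hV : IsAffineOpen V) {k : ℤ} {m : ℕ} (hk : k ≤ m)
    (f : (OT V)⟦k⟧ ⟶ P.obj (m + 1)) (hf : f ≫ P.q m = 0) : f = 0 := by
  obtain ⟨N, i, δ, hT, hN, hz⟩ := P.exists_fiber hG m
  obtain ⟨f', rfl⟩ : ∃ f' : (OT V)⟦k⟧ ⟶ N, f = f' ≫ i := Triangle.coyoneda_exact₂ _ hT f hf
  rw [shift_hom_eq_zero_of_single (d := -m - 1) hz hN (by omega) hV f', zero_comp]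

end Tower

/-- Quasi-coherent complexes are homotopy limits of their Postnikov towers. -/
lemma exists_holim (P : Tower G) (hG : DQ G) : ∃ (H : DerivedCategory X.Modules)
    (p : ∀ m, H ⟶ P.obj m) (γ : G ⟶ H), (∀ m, p (m + 1) ≫ P.q m = p m) ∧
      (∀ m, γ ≫ p m = P.τ m) ∧
      ∀ V : X.Opens, IsAffineOpen V → ∀ (k : ℤ) (h : (OT V)⟦k⟧ ⟶ H), (∀ m, h ≫ p m = 0) →
        h = 0 := by
  have (m : ℕ) : (P.obj m).IsGE (-m) := (isGE_iff _ _).2 (P.hz m)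
  obtain ⟨Pr, p, hp, hp'⟩ := exists_product P.obj (fun m => -m)
  obtain ⟨σ, hσ⟩ := hp Pr fun m => p m - p (m + 1) ≫ P.q m
  obtain ⟨H, ι, δ, hT⟩ := distinguished_cocone_triangle₁ σ
  have hισ : ι ≫ σ = 0 := comp_distTriang_mor_zero₁₂ _ hT
  have hσδ : σ ≫ δ = 0 := comp_distTriang_mor_zero₂₃ _ hT
  obtain ⟨γ₀, hγ₀⟩ := hp G P.τ
  have h0 : γ₀ ≫ σ = 0 := hp' _ _ fun m => by
    rw [Category.assoc, hσ, Preadditive.comp_sub, ← Category.assoc, hγ₀, hγ₀, P.comm, sub_self]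
  obtain ⟨γ, hγ⟩ : ∃ γ : G ⟶ H, γ₀ = γ ≫ ι := Triangle.coyoneda_exact₂ _ hT γ₀ h0
  refine ⟨H, fun m => ι ≫ p m, γ, fun m => ?_, fun m => ?_, fun V hV k h hh => ?_⟩
  · have := hισ =≫ p m
    rw [zero_comp, Category.assoc, hσ, Preadditive.comp_sub, sub_eq_zero] at this
    exact (Category.assoc _ _ _).trans this.symm
  · rw [← Category.assoc, ← hγ, hγ₀]
  · have hι : h ≫ ι = 0 := hp' _ _ fun m => by rw [Category.assoc, hh]
    have hι' : h⟦(1 : ℤ)⟧' ≫ ι⟦(1 : ℤ)⟧' = 0 := by rw [← Functor.map_comp, hι, Functor.map_zero]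
    obtain ⟨e, he⟩ : ∃ e : ((OT V)⟦k⟧)⟦(1 : ℤ)⟧ ⟶ Pr, h⟦(1 : ℤ)⟧' = e ≫ δ :=
      Triangle.coyoneda_exact₁ _ hT _ hι'
    let c : (OT V)⟦k + 1⟧ ≅ ((OT V)⟦k⟧)⟦(1 : ℤ)⟧ := (shiftFunctorAdd _ k 1).app (OT V)
    choose s hs using fun m => P.q_surjective hG hV (k + 1) m
    let x (m : ℕ) : (OT V)⟦k + 1⟧ ⟶ P.obj m :=
      Nat.rec 0 (fun m y => s m (y - c.hom ≫ e ≫ p m)) m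
    have hx (m : ℕ) : x (m + 1) ≫ P.q m = x m - c.hom ≫ e ≫ p m := hs m _
    obtain ⟨y, hy⟩ := hp _ x
    have hyσ : y ≫ σ = c.hom ≫ e := sub_eq_zero.1 <| hp' _ _ fun m => by
      rw [Preadditive.sub_comp, Category.assoc, hσ, Preadditive.comp_sub, ← Category.assoc y, hy, hy,
        hx, sub_sub_cancel, Category.assoc, sub_self]
    apply (shiftFunctor (DerivedCategory X.Modules) (1 : ℤ)).map_injective
    rw [he, Functor.map_zero, ← cancel_epi c.hom, ← Category.assoc, ← hyσ, Category.assoc, hσδ,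
      comp_zero, comp_zero]

end

section

open CategoryTheory.Pretriangulated DerivedCategory
open scoped ZeroObject

variable {X : Scheme.{u}} [HasDerivedCategory.{u + 1} X.Modules]
  {A B C E F G : DerivedCategory X.Modules} {V V₁ V₂ W U : X.Opens}

lemma exists_affine_le {x : X} (hx : x ∈ V) : ∃ V' ≤ V, x ∈ V' ∧ IsAffineOpen V' := by
  obtain ⟨_, ⟨V', h, rfl⟩, hx', hV⟩ := X.isBasis_affineOpens.exists_subset_of_mem_open hx V.2
  exact ⟨V', hV, hx', h⟩

lemma van_of_affine_locally_zero (h : ∀ V ≤ U, IsAffineOpen V → ∀ (k : ℤ) (c : (OT V)⟦k⟧ ⟶ E),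
    ∀ x ∈ V, ∃ (V' : X.Opens) (hV : V' ≤ V), x ∈ V' ∧ (res hV)⟦k⟧' ≫ c = 0) :
    Van (U : Set X) E := by
  refine van_of_locally_zero IsAffineOpen (fun V _ x hx => exists_affine_le hx)
    fun V hVU hV n φ x hx => ?_
  obtain ⟨k, rfl⟩ : ∃ k, n = -k := ⟨-n, (neg_neg n).symm⟩
  obtain ⟨c, rfl⟩ := (tr k).surjective φ
  obtain ⟨V', h', hx', hc⟩ := h V hVU hV k c x hx
  exact ⟨V', h', hx', by rw [← tr_comp, hc, tr_zero]⟩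

lemma res_shift_comp (h : V ≤ V₁) (h' : V₁ ≤ W) (k : ℤ) (c : (OT W)⟦k⟧ ⟶ E) :
    (res h)⟦k⟧' ≫ (res h')⟦k⟧' ≫ c = (res (h.trans h'))⟦k⟧' ≫ c := by
  rw [← Category.assoc, ← Functor.map_comp, res_res]

lemma isIso_of_holim {H : DerivedCategory X.Modules} (P : Tower G) (hG : DQ G)
    (p : ∀ m, H ⟶ P.obj m) (γ : G ⟶ H) (hp : ∀ m, p (m + 1) ≫ P.q m = p m)
    (hγ : ∀ m, γ ≫ p m = P.τ m)
    (h0 : ∀ V : X.Opens, IsAffineOpen V → ∀ (k : ℤ) (h : (OT V)⟦k⟧ ⟶ H), (∀ m, h ≫ p m = 0) →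
        h = 0) : IsIso γ := by
  obtain ⟨C, c, δ, hT⟩ := distinguished_cocone_triangle γ
  have hCz : Van ((⊤ : X.Opens) : Set X) C := by
    refine van_of_affine_locally_zero fun V _ hV k f x hx => ?_
    let m : ℕ := (k + 1).toNat
    have hδγ : δ ≫ γ⟦(1 : ℤ)⟧' = 0 := comp_distTriang_mor_zero₃₁ _ hT
    have hδτ : (f ≫ δ) ≫ (P.τ m)⟦(1 : ℤ)⟧' = 0 := by
      rw [← hγ m, Functor.map_comp, Category.assoc, ← Category.assoc δ, hδγ, zero_comp, comp_zero]
    have hmono : Mono ((homologyFunctor X.Modules (-k)).map ((P.τ m)⟦(1 : ℤ)⟧')) := by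
      have i := P.iso m (1 + -k) (by omega)
      have := hShift_naturality (P.τ m) 1 (-k) _ rfl
      rw [← Iso.eq_comp_inv] at this
      rw [this]
      infer_instance
    obtain ⟨V₁, hV₁, hx₁, hf₁⟩ := locally_zero_of_mono k _ (f ≫ δ) hδτ hx
    rw [← Category.assoc] at hf₁
    obtain ⟨h, hh⟩ : ∃ h : (OT V₁)⟦k⟧ ⟶ H, (res hV₁)⟦k⟧' ≫ f = h ≫ c :=
      Triangle.coyoneda_exact₃ _ hT _ hf₁
    have := P.iso m (-k) (by omega)
    obtain ⟨V₂, hV₂, hx₂, φ, hφ⟩ := exists_local_factor k (P.τ m) (h ≫ p m) hx₁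
    obtain ⟨V₃, hV₃, hx₃, hV₃'⟩ := exists_affine_le hx₂
    let h' : (OT V₃)⟦k⟧ ⟶ H := (res hV₃)⟦k⟧' ≫ ((res hV₂)⟦k⟧' ≫ h - φ ≫ γ)
    have hm : h' ≫ p m = 0 := by
      rw [Category.assoc, Preadditive.sub_comp, Category.assoc, Category.assoc, hγ, hφ, sub_self,
        comp_zero]
    have hle (j : ℕ) : ∀ l ≤ j, h' ≫ p j = 0 → h' ≫ p l = 0 := by
      induction j with
      | zero => intro l hl h; rwa [Nat.le_zero.1 hl]
      | succ j ih =>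
        intro l hl h
        rcases Nat.le_succ_iff.1 hl with hl | rfl
        · exact ih l hl (by rw [← hp j, ← Category.assoc, h, zero_comp])
        · exact h
    have hge (j : ℕ) (hj : m ≤ j) : h' ≫ p j = 0 := by
      induction j, hj using Nat.le_induction with
      | base => exact hm
      | succ j hj ih =>
        exact P.q_injective hG hV₃' (by omega) _ (by rw [Category.assoc, hp, ih])
    have hz : h' = 0 := h0 V₃ hV₃' k h' fun l => hle (max l m) l (le_max_left _ _)
      (hge _ (le_max_right _ _))
    refine ⟨V₃, hV₃.trans (hV₂.trans hV₁), hx₃, ?_⟩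
    have hγc : γ ≫ c = 0 := comp_distTriang_mor_zero₁₂ _ hT
    have := hz =≫ c
    rw [zero_comp, Category.assoc, Preadditive.sub_comp, Category.assoc, Category.assoc, hγc,
      comp_zero, sub_zero, ← hh, res_shift_comp, res_shift_comp] at this
    exact this
  rw [Opens.coe_top] at hCz
  exact (Triangle.isZero₃_iff_isIso₁ _ hT).1 hCz.isZero

/-- Affine sections of a quasi-coherent complex in negative degrees vanish. -/
theorem shift_hom_eq_zero_of_neg {k : ℤ} (hG : DQ G) (h : ∀ i, -k ≤ i → HZ i G)
    (hV : IsAffineOpen V) (φ : (OT V)⟦k⟧ ⟶ G) : φ = 0 := by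
  obtain ⟨P⟩ := exists_tower G
  obtain ⟨H, p, γ, hp, hγ, h0⟩ := exists_holim P hG
  have := isIso_of_holim P hG p γ hp hγ h0
  have hobj (m : ℕ) : DQ (P.obj m) := fun i => by
    rcases lt_or_ge i (-m) with hi | hi
    · exact qc_of_isZero (P.hz m i hi)
    · exact (hG i).of_iso (@asIso _ _ _ _ _ (P.iso m i hi))
  have hobj' (m : ℕ) (i : ℤ) (hi : -k ≤ i) : HZ i (P.obj m) := by
    rcases lt_or_ge i (-m) with hi' | hi'
    · exact P.hz m i hi'
    · exact IsZero.of_iso (h i hi) (@asIso _ _ _ _ _ (P.iso m i hi')).symm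
  rw [← cancel_mono γ, zero_comp]
  exact h0 V hV k _ fun m =>
    shift_hom_eq_zero_of_isGE (hobj m) (hobj' m) (P.hz m) hV _

lemma OT_hom_eq_zero_of_neg (hG : DQ G) (h : ∀ i, 0 ≤ i → HZ i G)
    (hV : IsAffineOpen V) (φ : OT V ⟶ G) : φ = 0 := by
  let e : (OT V)⟦(0 : ℤ)⟧ ≅ OT V := (shiftFunctorZero _ ℤ).app (OT V)
  rw [← cancel_epi e.hom, comp_zero]
  exact shift_hom_eq_zero_of_neg hG (by simpa using h) hV _

/-- Affine sections of a quasi-coherent complex are the sections of its homology sheaf. -/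
theorem cl_bijective (hE : DQ E) (hV : IsAffineOpen V) :
    Function.Bijective (cl : (OT V ⟶ E) → (OE V ⟶ H0 E)) := by
  obtain ⟨K, N, f, g, h, hT, hK, hN⟩ := exists_trunc E (-1)
  have hK' : DQ K := hE.trunc₁ hT hK hN
  have hN' : DQ N := hE.trunc₃ hT hK hN
  obtain ⟨K₀, N₀, f₀, g₀, h₀, hT₀, hK₀, hN₀⟩ := exists_trunc N 0
  have i₀ : IsIso ((homologyFunctor X.Modules 0).map f₀) :=
    isIso_mor₁ hT₀ (sub_add_cancel 0 1) (hN₀ _ (by omega)) (hN₀ _ le_rfl)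
  have i₁ : IsIso ((homologyFunctor X.Modules 0).map g) :=
    isIso_mor₂ hT rfl (hK _ (by omega)) (hK _ (by omega))
  have hz (n : ℤ) (hn : n ≠ 0) : HZ n K₀ := by
    rcases lt_or_gt_of_ne hn with hn | hn
    · exact HZ.obj₁ hT₀ (sub_add_cancel n 1) (hN n (by omega)) (hN₀ _ (by omega))
    · exact hK₀ n hn
  have b₀ := cl_bijective_of_isZero hz V
  have hfac (φ : OT V ⟶ N) : ∃ φ' : OT V ⟶ K₀, φ = φ' ≫ f₀ :=
    Triangle.coyoneda_exact₂ _ hT₀ φ (OT_hom_eq_zero (fun i hi => hN₀ i hi) (φ ≫ g₀))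
  have hlift (φ : OT V ⟶ N) : ∃ φ' : OT V ⟶ E, φ = φ' ≫ g :=
    Triangle.coyoneda_exact₃ _ hT φ (OT_hom_eq_zero_of_neg (hK'.shift 1)
      (fun i hi => (hK (1 + i) (by omega)).shift _ _ rfl) hV _)
  constructor
  · intro φ ψ hφψ
    have hcl : cl (φ - ψ) = 0 := by rw [cl_sub, hφψ, sub_self]
    obtain ⟨χ, hχ⟩ := hfac ((φ - ψ) ≫ g)
    have hχ0 : χ = 0 := by
      apply b₀.1
      have := cl_comp χ f₀
      rw [← hχ, cl_comp, hcl, zero_comp] at this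
      rw [cl_zero]
      exact (cancel_mono ((homologyFunctor X.Modules 0).map f₀)).1 (this.symm.trans zero_comp.symm)
    rw [hχ0, zero_comp] at hχ
    obtain ⟨χ', hχ'⟩ : ∃ χ' : OT V ⟶ K, φ - ψ = χ' ≫ f := Triangle.coyoneda_exact₂ _ hT _ hχ
    rw [OT_hom_eq_zero_of_neg hK' (fun i hi => hK i (by omega)) hV χ', zero_comp] at hχ'
    exact sub_eq_zero.1 hχ'
  · intro t
    obtain ⟨χ, hχ⟩ := b₀.2 (t ≫ (homologyFunctor X.Modules 0).map g ≫
      inv ((homologyFunctor X.Modules 0).map f₀))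
    obtain ⟨φ, hφ⟩ := hlift (χ ≫ f₀)
    refine ⟨φ, (cancel_mono ((homologyFunctor X.Modules 0).map g)).1 ?_⟩
    refine (cl_comp φ g).symm.trans ?_
    rw [← hφ, cl_comp, hχ]
    exact (Category.assoc _ _ _).trans (congrArg (t ≫ ·)
      ((Category.assoc _ _ _).trans (by rw [IsIso.inv_hom_id]; exact Category.comp_id _)))

end

section

open CategoryTheory.Pretriangulated DerivedCategory
open scoped ZeroObject

variable {X : Scheme.{u}} [HasDerivedCategory.{u + 1} X.Modules]
  {A B C E F G : DerivedCategory X.Modules} {V V₁ V₂ W U : X.Opens}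

lemma OTmap_actObj (g : Γ(X, V)) : OTmap (actObj g (OX X)) = ga g (van_OT V) := by
  apply Q_map_eq_ga
  intro i
  by_cases hi : i = 0
  · subst hi
    let e : (SC V).X 0 ≅ OE V := HomologicalComplex.singleObjXSelf (.up ℤ) 0 (OE V)
    have h₁ : (SCmap (actObj g (OX X))).f 0 = e.hom ≫ actObj g (OX X) ≫ e.inv :=
      HomologicalComplex.single_map_f_self _ _ _
    have h₂ : extMap V e.hom ≫ extObjι V (OE V) = extObjι V ((SC V).X 0) ≫ e.hom := extMap_ι _
    have h₃ : extMap V e.hom ≫ actObj g (OE V) = actObj g ((SC V).X 0) ≫ extMap V e.hom :=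
      (act g).naturality e.hom
    rw [h₁, ← Category.assoc, ← h₂, Category.assoc, ← Category.assoc (extObjι V (OE V)),
      ← cancel_mono e.hom]
    have h₄ : extObjι V (OE V) ≫ actObj g (OX X) = actObj g (OE V) ≫ extObjι V (OE V) :=
      extObjι_actObj g (OX X)
    rw [h₄, Category.assoc, Category.assoc, Category.assoc, Iso.inv_hom_id, Category.comp_id,
      ← Category.assoc, h₃, Category.assoc, Category.assoc, h₂]
  · exact (HomologicalComplex.isZero_single_obj_X (.up ℤ) 0 (OE V) i hi).eq_of_tgt _ _

lemma cl_ga (h : V ≤ U) (g : Γ(X, U)) (hV : Van (U : Set X)ᶜ (OT V)) (φ : OT V ⟶ E) :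
    secEquiv V (H0 E) (cl (ga g hV ≫ φ)) = rf h g • secEquiv V (H0 E) (cl φ) := by
  have : ga g hV = OTmap (actObj (rf h g) (OX X)) := by rw [OTmap_actObj, ga_rf]
  rw [this, cl_OTmap, secEquiv_act]

/-- Morphisms out of the part of `OT V` away from a basic open set are torsion. -/
theorem tors_ZT_OT (hE : DQ E) (g : Γ(X, U)) (hVU : V ≤ U) (hV : IsAffineOpen V) :
    Tors g ((ZT (X.basicOpen g)).obj (OT V)) E := by
  let D := X.basicOpen g
  have hVan : Van (U : Set X)ᶜ (OT V) := (van_OT V).mono (compl_le hVU)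
  have hD : V ⊓ D = X.basicOpen (rf hVU g) := (inf_basicOpen hVU g).symm
  have hDa : IsAffineOpen (V ⊓ D) := hD ▸ hV.basicOpen (rf hVU g)
  have hv : VIso D (res (inf_le_left : V ⊓ D ≤ V)) := vIso_res_of_inf_le _ (by rw [inf_comm])
  have torsion (E : DerivedCategory X.Modules) (hE : DQ E) (φ : OT V ⟶ E)
      (h0 : res (inf_le_left : V ⊓ D ≤ V) ≫ φ = 0) : ∃ k : ℕ, ga (g ^ k) hVan ≫ φ = 0 := by
    obtain ⟨k, hk⟩ := (hE 0 V hV (rf hVU g) (V ⊓ D) inf_le_left hD).torsion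
      (secEquiv V (H0 E) (cl φ)) (by rw [← cl_res, h0, cl_zero, map_zero])
    refine ⟨k, (cl_bijective hE hV).1 ((secEquiv V (H0 E)).injective ?_)⟩
    rw [cl_ga hVU, map_pow, hk, cl_zero, map_zero]
  have extend (E : DerivedCategory X.Modules) (hE : DQ E) (χ : OT (V ⊓ D) ⟶ E) :
      ∃ (k : ℕ) (ψ : OT V ⟶ E), res inf_le_left ≫ ψ =
        ga (g ^ k) ((van_OT _).mono (compl_le (inf_le_left.trans hVU))) ≫ χ := by
    obtain ⟨k, s, hs⟩ := (hE 0 V hV (rf hVU g) (V ⊓ D) inf_le_left hD).extend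
      (secEquiv _ (H0 E) (cl χ))
    obtain ⟨ψ, hψ⟩ := (cl_bijective hE hV).2 ((secEquiv V (H0 E)).symm s)
    refine ⟨k, ψ, (cl_bijective hE hDa).1 ((secEquiv _ (H0 E)).injective ?_)⟩
    rw [cl_res, hψ, AddEquiv.apply_symm_apply, hs, cl_ga (inf_le_left.trans hVU), map_pow, rf_rf]
  obtain ⟨C, π, δ, hT⟩ := distinguished_cocone_triangle (res (inf_le_left : V ⊓ D ≤ V))
  have hC : Van (U : Set X)ᶜ C := Van.obj₃ hT ((van_OT _).mono (compl_le (inf_le_left.trans hVU))) hVan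
  have key : Tors g C E := by
    refine ⟨hC, fun n φ => ?_⟩
    obtain ⟨k, hk⟩ := torsion _ (hE.shift n) (π ≫ φ) (by
      have : res (inf_le_left : V ⊓ D ≤ V) ≫ π = 0 := comp_distTriang_mor_zero₁₂ _ hT
      rw [← Category.assoc, this, zero_comp])
    rw [← Category.assoc, ga_nat _ hVan hC, Category.assoc] at hk
    obtain ⟨χ, hχ⟩ : ∃ χ : (OT (V ⊓ D))⟦(1 : ℤ)⟧ ⟶ E⟦n⟧, ga (g ^ k) hC ≫ φ = δ ≫ χ :=
      Triangle.yoneda_exact₃ _ hT _ hk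
    obtain ⟨l, ψ, hψ⟩ := extend _ ((hE.shift n).shift (-1)) (tr 1 χ)
    obtain ⟨ψ', rfl⟩ := (tr 1).surjective ψ
    rw [← tr_comp, ← tr_comp, (tr 1).injective.eq_iff, shift_ga] at hψ
    refine ⟨l + k, ?_⟩
    have hz : δ ≫ (res (inf_le_left : V ⊓ D ≤ V))⟦(1 : ℤ)⟧' = 0 := comp_distTriang_mor_zero₃₁ _ hT
    rw [ga_pow_add, Category.assoc, hχ, ← Category.assoc,
      ga_nat _ hC (((van_OT _).mono (compl_le (inf_le_left.trans hVU))).shift 1), Category.assoc,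
      ← hψ, ← Category.assoc, hz, zero_comp]
  obtain ⟨e⟩ : Nonempty (C ≅ (ZT D).obj (OT V)) := by
    have hCv : Van (D : Set X) C := (vIso_iff hT).1 hv
    have i := isIso_π hCv
    have j : IsIso ((ZT D).map π) := isIso_ZT_map₂ hT ((van_OT _).mono (compl_le inf_le_right))
    exact ⟨asIso ((πT D).app C) ≪≫ (@asIso _ _ _ _ _ j).symm⟩
  exact (triClosed_tors g E).iso e key

/-- A quasi-coherent complex without affine sections vanishes. -/
theorem van_of_perp (hE : DQ E) (hU : IsAffineOpen U) (h : Perp (OT U) E) : Van (U : Set X) E := by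
  refine van_of_affine_locally_zero fun V hV hVa k c x hx => ?_
  obtain ⟨f, hf, hxf⟩ := hU.exists_basicOpen_le ⟨x, hx⟩ (hV hx)
  refine ⟨X.basicOpen f, hf, hxf, tr_eq_zero_iff.1 ?_⟩
  rw [tr_comp]
  obtain ⟨n, s, hs⟩ := (hE.shift (-k) 0 U hU f _ (X.basicOpen_le f) rfl).extend
    (secEquiv _ (H0 _) (cl (res hf ≫ tr k c)))
  obtain ⟨ψ, hψ⟩ := (cl_bijective (hE.shift (-k)) hU).2 ((secEquiv U (H0 _)).symm s)
  have hs0 : s = 0 := by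
    rw [← (secEquiv U (H0 _)).apply_symm_apply s, ← hψ, h _ ψ, cl_zero, map_zero]
  have hu : IsUnit (rf (X.basicOpen_le f) f ^ n) :=
    IsUnit.pow n (RingedSpace.isUnit_res_basicOpen _ _)
  rw [hs0, map_zero, eq_comm, hu.smul_eq_zero] at hs
  refine (cl_bijective (hE.shift (-k)) (hU.basicOpen f)).1 ((secEquiv _ (H0 _)).injective ?_)
  rw [hs, cl_zero, map_zero]

end

section

open CategoryTheory.Pretriangulated DerivedCategory
open scoped ZeroObject

variable {X : Scheme.{u}} [HasDerivedCategory.{u + 1} X.Modules]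
  {A B C E F G : DerivedCategory X.Modules} {V W U : X.Opens} {l : List Γ(X, U)}

/-- The union of the basic open sets of a list of functions. -/
def DL : List Γ(X, U) → X.Opens
  | [] => ⊥
  | g :: l => X.basicOpen g ⊔ DL l

lemma basicOpen_le_DL {g : Γ(X, U)} (hg : g ∈ l) : X.basicOpen g ≤ DL l := by
  induction l with
  | nil => simp at hg
  | cons a l ih =>
    obtain rfl | hg := List.mem_cons.1 hg
    · exact le_sup_left
    · exact (ih hg).trans le_sup_right

lemma DL_le_iff : DL l ≤ V ↔ ∀ g ∈ l, X.basicOpen g ≤ V := by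
  refine ⟨fun h g hg => (basicOpen_le_DL hg).trans h, fun h => ?_⟩
  induction l with
  | nil => exact bot_le
  | cons a l ih =>
    exact sup_le (h a List.mem_cons_self) (ih fun g hg => h g (List.mem_cons_of_mem _ hg))

/-- The basic open sets of `U`. -/
def Bas (U V : X.Opens) : Prop := ∃ h : Γ(X, U), V = X.basicOpen h

lemma basicOpen_le_pow (g : Γ(X, U)) (k : ℕ) : (X.basicOpen g : Set X) ⊆ X.basicOpen (g ^ k) := by
  change X.basicOpen g ≤ X.basicOpen (g ^ k)
  induction k with
  | zero =>
    rw [pow_zero, X.basicOpen_of_isUnit isUnit_one]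
    exact X.basicOpen_le g
  | succ k ih =>
    rw [pow_succ, X.basicOpen_mul]
    exact le_inf ih le_rfl

lemma Bas.le (h : Bas U V) : V ≤ U := by
  obtain ⟨f, rfl⟩ := h
  exact X.basicOpen_le f

lemma Bas.inf (h : Bas U V) (g : Γ(X, U)) : Bas U (X.basicOpen g ⊓ V) := by
  obtain ⟨f, rfl⟩ := h
  exact ⟨g * f, (X.basicOpen_mul g f).symm⟩

lemma Bas.isAffineOpen (h : Bas U V) (hU : IsAffineOpen U) : IsAffineOpen V := by
  obtain ⟨f, rfl⟩ := h
  exact hU.basicOpen f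

lemma bas_self (U : X.Opens) : Bas U U :=
  ⟨1, (X.basicOpen_of_isUnit isUnit_one).symm⟩

/-- The basic open sets of `U` contained in a member of the cover given by `l`. -/
def BasIn (l : List Γ(X, U)) (V : X.Opens) : Prop :=
  Bas U V ∧ ∃ g ∈ l, V ≤ X.basicOpen g

lemma BasIn.inf (h : BasIn l V) (g : Γ(X, U)) : BasIn l (X.basicOpen g ⊓ V) := by
  obtain ⟨h, f, hf, hV⟩ := h
  exact ⟨h.inf g, f, hf, inf_le_right.trans hV⟩

lemma BasIn.le_DL (h : BasIn l V) : V ≤ DL l := by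
  obtain ⟨_, f, hf, hV⟩ := h
  exact hV.trans (basicOpen_le_DL hf)

/-- The objects generated by the structure sheaf of `U`. -/
abbrev GenU (U : X.Opens) (A : DerivedCategory X.Modules) : Prop := Gen (fun V => V = U) A

lemma GenU.van (hA : GenU U A) : Van (U : Set X)ᶜ A := Gen.van hA fun _ h => h.le

lemma GenU.bas (hA : GenU U A) : Gen (Bas U) A :=
  Gen.mono (fun V (h : V = U) => h ▸ bas_self U) hA

lemma GenU.LT_basicOpen (hA : GenU U A) (g : Γ(X, U)) :
    GenU (X.basicOpen g) ((LT (X.basicOpen g)).obj A) :=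
  Gen.LT (fun W hW => by rw [hW]; exact inf_eq_left.2 (X.basicOpen_le g)) hA

lemma gen_LT_DL {P : X.Opens → Prop} (hP : ∀ V, P V → ∀ g : Γ(X, U), P (X.basicOpen g ⊓ V))
    (h : ∀ g ∈ l, Gen P ((LT (X.basicOpen g)).obj A)) : Gen P ((LT (DL l)).obj A) := by
  induction l with
  | nil =>
    refine (triClosed_gen P).zero (Van.isZero ((van_LT_compl _ A).mono fun _ _ h => h))
  | cons g l ih =>
    have ih := ih fun f hf => h f (List.mem_cons_of_mem _ hf)
    exact (triClosed_gen P).LT_sup (h g List.mem_cons_self) ih (ih.LT fun V hV => hP V hV g)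

lemma GenU.gen_LT_DL (hA : GenU U A) (l : List Γ(X, U)) : Gen (BasIn l) ((LT (DL l)).obj A) :=
  LN.gen_LT_DL (fun _ h g => h.inf g) fun g hg =>
    Gen.mono (fun V (hV : V = _) => ⟨⟨g, hV⟩, g, hg, hV.le⟩) (hA.LT_basicOpen g)

lemma gen_ZT_DL (hA : Gen (Bas U) A) (l : List Γ(X, U)) : Gen (Bas U) ((ZT (DL l)).obj A) :=
  (triClosed_gen _).cone (triangle_ZT _ A)
    (LN.gen_LT_DL (fun _ h g => h.inf g) fun g _ => hA.LT fun _ hW => hW.inf g) hA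

lemma dq_OT_top : DQ (OT (⊤ : X.Opens)) := by
  intro n
  have e : (homologyFunctor X.Modules n).obj (OT (⊤ : X.Opens)) ≅ (SC (⊤ : X.Opens)).homology n :=
    (homologyFunctorFactors X.Modules n).app _
  by_cases hn : n = 0
  · subst hn
    have : IsIso (extObjι (⊤ : X.Opens) (OX X)) := by
      apply isIso_extι_of_vanishes
      intro U s x _ hx
      exact absurd trivial hx
    have h : QC (OX X) :=
      qc_of_isQuasicoherent ((SheafOfModules.isQuasicoherent X.ringCatSheaf).prop_of_iso
        (coproductUniqueIso fun _ : PUnit.{u + 1} => SheafOfModules.unit X.ringCatSheaf)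
        (inferInstanceAs (SheafOfModules.free PUnit.{u + 1}).IsQuasicoherent))
    exact h.of_iso ((asIso (extObjι (⊤ : X.Opens) (OX X))).symm ≪≫
      (HomologicalComplex.homologyFunctorSingleIso X.Modules (.up ℤ) 0).symm.app _ ≪≫ e.symm)
  · refine qc_of_isZero (IsZero.of_iso ?_ e)
    exact (HomologicalComplex.exactAt_single_obj (.up ℤ) 0 _ n hn).isZero_homology

lemma tors_ZT_OT_OT (hU : IsAffineOpen U) (hV : Bas U V) (hVW : V ≤ W) (g : Γ(X, U)) :
    Tors g ((ZT (X.basicOpen g)).obj (OT V)) (OT W) := by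
  have h := tors_ZT_OT (dq_OT_top (X := X)) g hV.le (hV.isAffineOpen hU)
  exact h.of_vIso' ((vIso_res (le_top : W ≤ ⊤)).mono hVW)
    (((van_OT V)).ZT _)

lemma Gen.tors_ZT {P : X.Opens → Prop} (hA : Gen P A) {g : Γ(X, U)}
    (h : ∀ V, P V → Tors g ((LN.ZT (X.basicOpen g)).obj (OT V)) E) :
    Tors g ((LN.ZT (X.basicOpen g)).obj A) E :=
  hA _ ((triClosed_tors g E).comap (LN.ZT (X.basicOpen g))) h

lemma tors_ZT_genU (hU : IsAffineOpen U) (hA : Gen (Bas U) A) (hB : GenU U B) (g : Γ(X, U)) :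
    Tors g ((ZT (X.basicOpen g)).obj A) B :=
  hA.tors_ZT fun V hV => hB _ (triClosed_tors' g (((van_OT V).mono (compl_le hV.le)).ZT _))
    fun W hW => hW ▸ tors_ZT_OT_OT hU hV hV.le g

lemma exists_cone_ga (hA : GenU U A) (g : Γ(X, U)) : ∃ (C : DerivedCategory X.Modules)
    (p : A ⟶ C) (δ : C ⟶ A⟦(1 : ℤ)⟧), Triangle.mk (ga g hA.van) p δ ∈ distTriang _ ∧ GenU U C ∧
      Van (X.basicOpen g : Set X) C ∧ ∀ S : Set X, Van S A → Van S C := by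
  obtain ⟨C, p, δ, hT⟩ := distinguished_cocone_triangle (ga g hA.van)
  refine ⟨C, p, δ, hT, (triClosed_gen _).cone hT hA hA, ?_, fun S hS => Van.obj₃ hT hS hS⟩
  refine (vIso_iff hT).1 (VIso.of_comp_left (vIso_ε _ A) ?_)
  change VIso _ ((εT (X.basicOpen g)).app A ≫ ga g hA.van)
  rw [← ga_nat g ((van_LT_compl _ A).mono (compl_le (X.basicOpen_le g))) hA.van]
  have := isIso_ga_of_le (X.basicOpen_le g) (RingedSpace.isUnit_res_basicOpen _ _)
    (van_LT_compl (X.basicOpen g) A)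
  exact (vIso_of_isIso _).comp (vIso_ε _ A)

lemma Tors.exists_pow {g : Γ(X, U)} (h : Tors g A B) (hA : Van (U : Set X)ᶜ A) (θ : A ⟶ B) :
    ∃ k : ℕ, ga (g ^ k) hA ≫ θ = 0 := by
  obtain ⟨k, hk⟩ := h.2 0 (θ ≫ (shiftFunctorZero _ ℤ).inv.app B)
  refine ⟨k, ?_⟩
  rw [← Category.assoc] at hk
  exact (cancel_mono ((shiftFunctorZero _ ℤ).inv.app B)).1 (hk.trans zero_comp.symm)

lemma nonempty_ZT_sup (h : Van (V : Set X) C) :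
    Nonempty ((ZT (V ⊔ W)).obj C ≅ (ZT W).obj C) := by
  have := isIso_π (h.ZT W)
  exact ⟨(nonempty_ZT_ZT V W C).some.symm ≪≫ (asIso ((πT V).app ((ZT W).obj C))).symm⟩

/-- Morphisms from the part of `A` away from `DL l` factor through generated objects. -/
theorem factor_ZT (hU : IsAffineOpen U) (l : List Γ(X, U)) (hA : GenU U A) (hB : GenU U B)
    (θ : (ZT (DL l)).obj A ⟶ B) : ∃ (K : DerivedCategory X.Modules), GenU U K ∧
      Van (DL l : Set X) K ∧ (∀ S : Set X, Van S A → Van S K) ∧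
      ∃ (κ : (ZT (DL l)).obj A ⟶ K) (θ' : K ⟶ B), θ = κ ≫ θ' := by
  induction l generalizing A with
  | nil =>
    have h : Van ((DL ([] : List Γ(X, U)) : X.Opens) : Set X) A := by
      intro n V s x _ hx
      exact absurd hx (by simp [DL])
    have := isIso_π h
    exact ⟨A, hA, h, fun _ h => h, inv ((πT _).app A), (πT _).app A ≫ θ, by simp⟩
  | cons g l ih =>
    have hZ : Van (U : Set X)ᶜ ((ZT (DL (g :: l))).obj A) := hA.van.ZT _
    have ht : Tors g ((ZT (DL (g :: l))).obj A) B :=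
      (triClosed_tors g B).iso (nonempty_ZT_ZT _ _ A).some
        (tors_ZT_genU hU (gen_ZT_DL hA.bas l) hB g)
    obtain ⟨k, hk⟩ := ht.exists_pow hZ θ
    obtain ⟨C, p, δ, hT, hC, hgC, hS⟩ := exists_cone_ga hA (g ^ k)
    rw [← ZT_ga (g ^ k) hA.van] at hk
    obtain ⟨θ₁, hθ⟩ : ∃ θ₁ : (ZT (DL (g :: l))).obj C ⟶ B, θ = (ZT (DL (g :: l))).map p ≫ θ₁ :=
      Triangle.yoneda_exact₂ _ ((ZT (DL (g :: l))).map_distinguished _ hT) θ hk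
    have hgC' : Van (X.basicOpen g : Set X) C := hgC.mono (basicOpen_le_pow g k)
    obtain ⟨e⟩ : Nonempty ((ZT (DL (g :: l))).obj C ≅ (ZT (DL l)).obj C) := nonempty_ZT_sup hgC'
    obtain ⟨K, hK, hKl, hKS, κ, θ', h⟩ := ih hC (e.inv ≫ θ₁)
    refine ⟨K, hK, ?_, fun S h => hKS S (hS S h), (ZT (DL (g :: l))).map p ≫ e.hom ≫ κ, θ', ?_⟩
    · rw [DL, Opens.coe_sup]
      exact (hKS _ hgC').union hKl
    · rw [hθ, Category.assoc, Category.assoc, ← h, e.hom_inv_id_assoc]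

end

section

open CategoryTheory.Pretriangulated DerivedCategory
open scoped ZeroObject

variable {X : Scheme.{u}} [HasDerivedCategory.{u + 1} X.Modules]
  {A B C E F G : DerivedCategory X.Modules} {V W U : X.Opens} {l : List Γ(X, U)}

lemma exists_extension_of_mor₃ {f : A ⟶ B} {g : B ⟶ C} {δ : C ⟶ A⟦(1 : ℤ)⟧}
    (hT : Triangle.mk f g δ ∈ distTriang _) (φ : A ⟶ E) (h : δ ≫ φ⟦(1 : ℤ)⟧' = 0) :
    ∃ ψ : B ⟶ E, f ≫ ψ = φ := by
  obtain ⟨ψ, hψ⟩ : ∃ ψ : B⟦(1 : ℤ)⟧ ⟶ E⟦(1 : ℤ)⟧, φ⟦(1 : ℤ)⟧' = (-f⟦(1 : ℤ)⟧') ≫ ψ :=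
    Triangle.yoneda_exact₂ _ (rot_of_distTriang _ (rot_of_distTriang _ hT)) _ h
  obtain ⟨χ, rfl⟩ := (shiftFunctor (DerivedCategory X.Modules) (1 : ℤ)).map_surjective ψ
  refine ⟨-χ, (shiftFunctor (DerivedCategory X.Modules) (1 : ℤ)).map_injective ?_⟩
  rw [hψ, Preadditive.comp_neg, Functor.map_neg, Functor.map_comp, Preadditive.neg_comp]

lemma GenU.shift (h : GenU U A) (n : ℤ) : GenU U (A⟦n⟧) := (triClosed_gen _).shift h n

/-- Morphisms from `LT (DL l) A` extend after replacing `A`. -/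
lemma exists_extension_genU (hU : IsAffineOpen U) (l : List Γ(X, U)) (hA : GenU U A)
    (hB : GenU U B) (φ : (LT (DL l)).obj A ⟶ B) :
    ∃ (A' : DerivedCategory X.Modules) (a : A' ⟶ A) (ψ : A' ⟶ B), GenU U A' ∧ VIso (DL l) a ∧
      (εT (DL l)).app A' ≫ ψ = (LT (DL l)).map a ≫ φ := by
  obtain ⟨K, hK, hKl, -, κ, θ', h⟩ := factor_ZT hU l hA (hB.shift 1)
    (δT (DL l) A ≫ φ⟦(1 : ℤ)⟧')
  let m : A ⟶ K := (πT (DL l)).app A ≫ κ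
  obtain ⟨A', a, δ, hT⟩ := distinguished_cocone_triangle₁ m
  have ha : a ≫ (πT (DL l)).app A ≫ κ = 0 := comp_distTriang_mor_zero₁₂ _ hT
  have hz : (ZT (DL l)).map a ≫ κ = 0 := by
    refine π_hom_ext hKl ?_
    rw [← Category.assoc, π_nat, Category.assoc, ha, comp_zero]
  obtain ⟨ψ, hψ⟩ := exists_extension_of_mor₃ (triangle_ZT (DL l) A') ((LT (DL l)).map a ≫ φ) (by
    rw [Functor.map_comp, ← Category.assoc, δ_nat, Category.assoc, h, ← Category.assoc, hz,
      zero_comp])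
  exact ⟨A', a, ψ, (triClosed_gen _).fiber hT hA hK, (vIso_iff hT).2 hKl, hψ⟩

/-- The objects of the form `LT (DL l) B` with `B` generated by the structure sheaf of `U`. -/
def Ext (l : List Γ(X, U)) (F : DerivedCategory X.Modules) : Prop :=
  ∃ B, GenU U B ∧ Nonempty (F ≅ (LT (DL l)).obj B)

lemma Ext.shift (h : Ext l F) (n : ℤ) : Ext l (F⟦n⟧) := by
  obtain ⟨B, hB, ⟨e⟩⟩ := h
  exact ⟨B⟦n⟧, hB.shift n, ⟨(shiftFunctor _ n).mapIso e ≪≫ (((LT (DL l)).commShiftIso n).app B).symm⟩⟩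

lemma nonempty_iso_of_arrow_iso {T T' : Triangle (DerivedCategory X.Modules)}
    (hT : T ∈ distTriang _) (hT' : T' ∈ distTriang _) (a : T.obj₁ ≅ T'.obj₁)
    (b : T.obj₂ ≅ T'.obj₂) (h : T.mor₁ ≫ b.hom = a.hom ≫ T'.mor₁) :
    Nonempty (T.obj₃ ≅ T'.obj₃) :=
  ⟨Triangle.π₃.mapIso (isoTriangleOfIso₁₂ T T' hT hT' a b h)⟩

lemma Ext.cone (hU : IsAffineOpen U) {T : Triangle (DerivedCategory X.Modules)}
    (hT : T ∈ distTriang _) (h₁ : Ext l T.obj₁) (h₂ : Ext l T.obj₂) : Ext l T.obj₃ := by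
  obtain ⟨A, hA, ⟨e₁⟩⟩ := h₁
  obtain ⟨B, hB, ⟨e₂⟩⟩ := h₂
  obtain ⟨f, h⟩ : ∃ f : (LT (DL l)).obj A ⟶ (LT (DL l)).obj B, f ≫ e₂.inv = e₁.inv ≫ T.mor₁ :=
    ⟨e₁.inv ≫ T.mor₁ ≫ e₂.hom, by simp⟩
  obtain ⟨A', a, ψ, hA', ha, hψ⟩ := exists_extension_genU hU l hA hB (f ≫ (εT (DL l)).app B)
  have i : IsIso ((LT (DL l)).map a) := ha
  have hf : (LT (DL l)).map ψ = (LT (DL l)).map a ≫ f :=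
    (vIso_ε _ B).hom_ext (van_LT_compl _ A') ((ε_nat _ ψ).trans (hψ.trans (Category.assoc _ _ _).symm))
  obtain ⟨C, p, δ, hT'⟩ := distinguished_cocone_triangle ψ
  obtain ⟨e⟩ := nonempty_iso_of_arrow_iso ((LT (DL l)).map_distinguished _ hT') hT
    ((@asIso _ _ _ _ _ i) ≪≫ e₁.symm) e₂.symm (by
      change (LT (DL l)).map ψ ≫ e₂.inv = ((LT (DL l)).map a ≫ e₁.inv) ≫ T.mor₁
      rw [hf, Category.assoc, Category.assoc, h])
  exact ⟨C, (triClosed_gen _).cone hT' hA' hB, ⟨e.symm⟩⟩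

lemma triClosed_ext (hU : IsAffineOpen U) (l : List Γ(X, U)) : TriClosed (Ext (X := X) l) where
  zero hA := ⟨0, (triClosed_gen _).zero (isZero_zero _),
    ⟨hA.iso (Functor.map_isZero (LT (DL l)) (isZero_zero _))⟩⟩
  shift h n := h.shift n
  ext hT h₁ h₃ := Ext.cone hU (inv_rot_of_distTriang _ hT) (h₃.shift (-1)) h₁

end

section

open CategoryTheory.Pretriangulated DerivedCategory
open scoped ZeroObject

variable {X : Scheme.{u}} [HasDerivedCategory.{u + 1} X.Modules]
  {A B C E F G : DerivedCategory X.Modules} {V W U : X.Opens} {l : List Γ(X, U)}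

/-- The complexes which look quasi-coherent when tested on the basic open sets in `BasIn l`. -/
def Cond (l : List Γ(X, U)) (E : DerivedCategory X.Modules) : Prop :=
  ∀ (h : Γ(X, U)) (V : X.Opens), BasIn l V → Tors h ((ZT (X.basicOpen h)).obj (OT V)) E

lemma triClosed_cond (l : List Γ(X, U)) : TriClosed (Cond (X := X) l) :=
  .forall fun h => .forall fun V => .forall fun hV =>
    triClosed_tors' h (((van_OT V).mono (compl_le hV.1.le)).ZT _)

lemma Cond.of_vIso' (h : Cond l F) {f : E ⟶ F} (hf : VIso (DL l) f) : Cond l E :=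
  fun g V hV => (h g V hV).of_vIso' hf (((van_OT V).mono (compl_le hV.le_DL)).ZT _)

lemma GenU.cond (hU : IsAffineOpen U) (hA : GenU U A) (l : List Γ(X, U)) : Cond l A :=
  hA _ (triClosed_cond l) fun _ hW g _ hV => hW ▸ tors_ZT_OT_OT hU hV.1 hV.1.le g

lemma Ext.cond (hU : IsAffineOpen U) (h : Ext l F) : Cond l F := by
  obtain ⟨B, hB, ⟨e⟩⟩ := h
  exact (triClosed_cond l).iso e.symm ((hB.cond hU l).of_vIso' (vIso_ε _ B))

lemma cond_of_local (hU : IsAffineOpen U)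
    (h : ∀ g ∈ l, GenU (X.basicOpen g) ((LT (X.basicOpen g)).obj A)) : Cond l A := by
  intro f V hV
  obtain ⟨g, hg, hVg⟩ := hV.2
  have hC : Van ((X.basicOpen g : X.Opens) : Set X)ᶜ ((ZT (X.basicOpen f)).obj (OT V)) :=
    ((van_OT V).mono (compl_le hVg)).ZT _
  have key : Tors f ((ZT (X.basicOpen f)).obj (OT V)) ((LT (X.basicOpen g)).obj A) :=
    h g hg _ (triClosed_tors' f (((van_OT V).mono (compl_le hV.1.le)).ZT _))
      fun W hW => hW ▸ tors_ZT_OT_OT hU hV.1 hVg f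
  exact key.of_vIso (vIso_ε _ A) hC

/-- Morphisms from `F` to suitable objects factor through extensions of generated objects. -/
def Fac (l : List Γ(X, U)) (F : DerivedCategory X.Modules) : Prop :=
  ∀ E, Cond l E → ∀ f : F ⟶ E, ∃ B, Ext l B ∧ ∃ (x : F ⟶ B) (y : B ⟶ E), f = x ≫ y

lemma fac_ext (hU : IsAffineOpen U) {T : Triangle (DerivedCategory X.Modules)}
    (hT : T ∈ distTriang _) (h₁ : Fac l T.obj₁) (h₃ : Fac l T.obj₃) : Fac l T.obj₂ := by
  intro E hE f
  obtain ⟨B', hB', x', y', h'⟩ := h₁ E hE (T.mor₁ ≫ f)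
  obtain ⟨C, c, d, hC⟩ := distinguished_cocone_triangle y'
  have hyc : y' ≫ c = 0 := comp_distTriang_mor_zero₁₂ _ hC
  have hcd : c ≫ d = 0 := comp_distTriang_mor_zero₂₃ _ hC
  obtain ⟨q, hq⟩ : ∃ q : T.obj₃ ⟶ C, f ≫ c = T.mor₂ ≫ q :=
    Triangle.yoneda_exact₂ T hT _ (by rw [← Category.assoc, h', Category.assoc, hyc, comp_zero])
  obtain ⟨B'', hB'', x'', y'', h''⟩ := h₃ C ((triClosed_cond l).cone hC (hB'.cond hU) hE) q
  obtain ⟨D, j, p, hD⟩ := distinguished_cocone_triangle₂ (y'' ≫ d)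
  obtain ⟨e, he, he'⟩ : ∃ e : D ⟶ E, j ≫ e = 𝟙 B' ≫ y' ∧ p ≫ y'' = e ≫ c :=
    complete_distinguished_triangle_morphism₂ _ _ hD hC (𝟙 B') y'' (by
      change (y'' ≫ d) ≫ (𝟙 B')⟦(1 : ℤ)⟧' = y'' ≫ d
      rw [CategoryTheory.Functor.map_id, Category.comp_id])
  obtain ⟨s, hs⟩ : ∃ s : T.obj₂ ⟶ D, T.mor₂ ≫ x'' = s ≫ p :=
    Triangle.coyoneda_exact₃ _ hD _ (by
      change (T.mor₂ ≫ x'') ≫ y'' ≫ d = 0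
      rw [Category.assoc, ← Category.assoc x'', ← h'', ← Category.assoc, ← hq, Category.assoc, hcd,
        comp_zero])
  obtain ⟨z, hz⟩ : ∃ z : T.obj₂ ⟶ B', f - s ≫ e = z ≫ y' :=
    Triangle.coyoneda_exact₂ _ hC _ (by
      change (f - s ≫ e) ≫ c = 0
      rw [Preadditive.sub_comp, Category.assoc, ← he', ← Category.assoc s, ← hs, hq, h'',
        Category.assoc, sub_self])
  refine ⟨D, (triClosed_ext hU l).ext hD hB' hB'', s + z ≫ j, e, ?_⟩
  rw [Preadditive.add_comp, Category.assoc, he, Category.id_comp, ← hz, add_sub_cancel]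

lemma triClosed_fac (hU : IsAffineOpen U) (l : List Γ(X, U)) : TriClosed (Fac (X := X) l) where
  zero hA E _ f := ⟨0, (triClosed_ext hU l).zero (isZero_zero _), 0, 0, hA.eq_of_src _ _⟩
  shift {A} hA n E hE f := by
    obtain ⟨B, hB, x, y, h⟩ := hA _ ((triClosed_cond l).shift hE (-n)) (tr n f)
    obtain ⟨y, rfl⟩ := (tr n).surjective y
    exact ⟨B⟦n⟧, hB.shift n, x⟦n⟧', y, (tr n).injective (by rw [tr_comp, h])⟩
  ext hT h₁ h₃ := fac_ext hU hT h₁ h₃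

lemma fac_OT (hU : IsAffineOpen U) (hV : BasIn l V) : Fac l (OT V) := by
  intro E hE f
  obtain ⟨h, rfl⟩ := hV.1
  have hO : GenU U (OT U) := gen_OT rfl
  let A := (LT (DL l)).obj (OT U)
  have hA : Gen (BasIn l) A := hO.gen_LT_DL l
  have hAv : Van (U : Set X)ᶜ A := hO.van.LT _
  have i : IsIso ((LT (X.basicOpen h)).map ((εT (DL l)).app (OT U))) := isIso_LT_ε hV.le_DL _
  obtain ⟨e⟩ : Nonempty ((LT (X.basicOpen h)).obj (OT U) ≅ OT (X.basicOpen h)) :=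
    VIso.isoLT (vIso_res (X.basicOpen_le h)) (van_OT _)
  let e' : (LT (X.basicOpen h)).obj A ≅ OT (X.basicOpen h) := @asIso _ _ _ _ _ i ≪≫ e
  obtain ⟨k, ψ, hψ⟩ : ∃ (k : ℕ) (ψ : A ⟶ E), (εT (X.basicOpen h)).app A ≫ ψ =
      ga (h ^ k) (hAv.LT _) ≫ e'.hom ≫ f := by
    obtain ⟨k, ψ, hψ⟩ := (hA.tors_ZT (hE h)).exists_extension hAv 0
      (e'.hom ≫ f ≫ (shiftFunctorZero _ ℤ).inv.app E)
    refine ⟨k, ψ ≫ (shiftFunctorZero _ ℤ).hom.app E, ?_⟩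
    rw [← Category.assoc, hψ]
    simp only [Category.assoc]
    rw [Iso.inv_hom_id_app]
    exact congrArg (fun z => _ ≫ _ ≫ z) (Category.comp_id f)
  have hu : IsUnit (rf (X.basicOpen_le h) (h ^ k)) := by
    rw [map_pow]
    exact (RingedSpace.isUnit_res_basicOpen _ _).pow k
  have i' := isIso_ga_of_le (X.basicOpen_le h) hu (van_LT_compl (X.basicOpen h) A)
  obtain ⟨w, hw⟩ := i'.out
  refine ⟨A, ⟨_, hO, ⟨Iso.refl _⟩⟩, e'.inv ≫ w ≫ (εT _).app A, ψ, ?_⟩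
  rw [Category.assoc, Category.assoc]
  refine Eq.symm ((congrArg (fun z => e'.inv ≫ w ≫ z) hψ).trans ?_)
  rw [← Category.assoc w, hw.2, Category.id_comp, e'.inv_hom_id_assoc]

/-- Locally generated objects are direct summands of restrictions of generated objects. -/
theorem exists_retract (hU : IsAffineOpen U)
    (h : ∀ g ∈ l, GenU (X.basicOpen g) ((LT (X.basicOpen g)).obj A)) :
    ∃ I, Ext l I ∧ ∃ (i : (LT (DL l)).obj A ⟶ I) (r : I ⟶ (LT (DL l)).obj A), i ≫ r = 𝟙 _ := by
  have hF : Gen (BasIn l) ((LT (DL l)).obj A) := gen_LT_DL (fun _ h g => h.inf g) fun g hg =>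
    Gen.mono (fun V (hV : V = _) => ⟨⟨g, hV⟩, g, hg, hV.le⟩) (h g hg)
  have hc : Cond l ((LT (DL l)).obj A) := (cond_of_local hU h).of_vIso' (vIso_ε _ A)
  obtain ⟨B, hB, i, r, hir⟩ := hF _ (triClosed_fac hU l) (fun V hV => fac_OT hU hV) _ hc (𝟙 _)
  exact ⟨B, hB, i, r, hir.symm⟩

end

section

open CategoryTheory.Pretriangulated DerivedCategory
open scoped ZeroObject

variable {X : Scheme.{u}} [HasDerivedCategory.{u + 1} X.Modules]
  {A B C E F G : DerivedCategory X.Modules} {V W U : X.Opens} {l : List Γ(X, U)}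

/-- A retract becomes a cone after adding its shift. -/
lemma nonempty_biprod_iso_cone {I M : DerivedCategory X.Modules} {i : F ⟶ I} {r : I ⟶ F}
    (hir : i ≫ r = 𝟙 F) {p : I ⟶ M} {d : M ⟶ I⟦(1 : ℤ)⟧}
    (hT : Triangle.mk (𝟙 I - r ≫ i) p d ∈ distTriang _) :
    Nonempty (F ⊞ F⟦(1 : ℤ)⟧ ≅ M) := by
  have hi : i ≫ (𝟙 I - r ≫ i) = 0 := by simp [reassoc_of% hir]
  have hr : (𝟙 I - r ≫ i) ≫ r = 0 := by simp [hir]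
  have hp : (𝟙 I - r ≫ i) ≫ p = 0 := comp_distTriang_mor_zero₁₂ _ hT
  have hpd : p ≫ d = 0 := comp_distTriang_mor_zero₂₃ _ hT
  have hd : d ≫ (𝟙 I - r ≫ i)⟦(1 : ℤ)⟧' = 0 := comp_distTriang_mor_zero₃₁ _ hT
  have hp' : p = r ≫ i ≫ p := by
    rwa [Preadditive.sub_comp, Category.id_comp, Category.assoc, sub_eq_zero] at hp
  have hd' : d = d ≫ r⟦(1 : ℤ)⟧' ≫ i⟦(1 : ℤ)⟧' := by
    rwa [Functor.map_sub, CategoryTheory.Functor.map_id, Functor.map_comp, Preadditive.comp_sub,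
      Category.comp_id, sub_eq_zero] at hd
  have hir' : i⟦(1 : ℤ)⟧' ≫ r⟦(1 : ℤ)⟧' = 𝟙 _ := by
    rw [← Functor.map_comp, hir, CategoryTheory.Functor.map_id]
  obtain ⟨s, hs⟩ : ∃ s : F⟦(1 : ℤ)⟧ ⟶ M, i⟦(1 : ℤ)⟧' = s ≫ d :=
    Triangle.coyoneda_exact₁ _ hT (i⟦(1 : ℤ)⟧') (by
      change i⟦(1 : ℤ)⟧' ≫ (𝟙 I - r ≫ i)⟦(1 : ℤ)⟧' = 0
      rw [← Functor.map_comp, hi, Functor.map_zero])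
  have := isIso_of_yoneda_map_bijective (biprod.desc (i ≫ p) s) (by
    refine fun T => ⟨fun x y hxy => ?_, fun m => ?_⟩
    · rw [← sub_eq_zero] at hxy ⊢
      dsimp only at hxy
      rw [← Preadditive.sub_comp] at hxy
      generalize x - y = z at hxy ⊢
      rw [biprod.desc_eq, Preadditive.comp_add] at hxy
      have h2 : z ≫ biprod.snd = 0 := by
        have := congrArg (· ≫ d ≫ r⟦(1 : ℤ)⟧') hxy
        simpa [Preadditive.add_comp, reassoc_of% hpd, reassoc_of% hs.symm, hir'] using this
      rw [reassoc_of% h2, zero_comp, add_zero] at hxy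
      obtain ⟨w, hw⟩ : ∃ w : T ⟶ I, (z ≫ biprod.fst) ≫ i = w ≫ (𝟙 I - r ≫ i) :=
        Triangle.coyoneda_exact₂ _ hT _ ((Category.assoc _ _ _).trans ((Category.assoc _ _ _).trans hxy))
      refine biprod.hom_ext _ _ ?_ (by rw [h2, zero_comp])
      have : ((z ≫ biprod.fst) ≫ i) ≫ r = (w ≫ (𝟙 I - r ≫ i)) ≫ r := by rw [hw]
      rw [Category.assoc, hir, Category.comp_id, Category.assoc, hr, comp_zero] at this
      rw [this, zero_comp]
    · obtain ⟨w, hw⟩ : ∃ w : T ⟶ I, m - (m ≫ d ≫ r⟦(1 : ℤ)⟧') ≫ s = w ≫ p :=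
        Triangle.coyoneda_exact₃ _ hT _ (by
          change (m - (m ≫ d ≫ r⟦(1 : ℤ)⟧') ≫ s) ≫ d = 0
          rw [Preadditive.sub_comp, Category.assoc, ← hs, Category.assoc, Category.assoc, ← hd',
            sub_self])
      refine ⟨biprod.lift (w ≫ r) (m ≫ d ≫ r⟦(1 : ℤ)⟧'), ?_⟩
      dsimp only
      rw [biprod.lift_desc, Category.assoc, ← hp', ← hw, sub_add_cancel])
  exact ⟨asIso (biprod.desc (i ≫ p) s)⟩

/-- Locally generated objects extend to generated objects after adding their shift. -/
theorem exists_genU_extension (hU : IsAffineOpen U)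
    (h : ∀ g ∈ l, GenU (X.basicOpen g) ((LT (X.basicOpen g)).obj A)) :
    ∃ P, GenU U P ∧ Nonempty ((LT (DL l)).obj (A ⊞ A⟦(1 : ℤ)⟧) ≅ (LT (DL l)).obj P) := by
  obtain ⟨I, hI, i, r, hir⟩ := exists_retract hU h
  obtain ⟨M, p, d, hT⟩ := distinguished_cocone_triangle (𝟙 I - r ≫ i)
  obtain ⟨P, hP, ⟨e⟩⟩ := Ext.cone hU hT hI hI
  obtain ⟨e'⟩ := nonempty_biprod_iso_cone hir hT
  have := preservesBinaryBiproducts_of_preservesBiproducts (LT (X := X) (DL l))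
  exact ⟨P, hP, ⟨(LT (DL l)).mapBiprod A (A⟦(1 : ℤ)⟧) ≪≫
    biprod.mapIso (Iso.refl _) (((LT (DL l)).commShiftIso (1 : ℤ)).app A) ≪≫ e' ≪≫ e⟩⟩

/-- Gluing of complexes which agree on the intersection. -/
theorem exists_glue {Y : X.Opens} {S P : DerivedCategory X.Modules} (hS : Van (Y : Set X)ᶜ S)
    (hP : Van (U : Set X)ᶜ P) (e : (LT (Y ⊓ U)).obj S ≅ (LT (Y ⊓ U)).obj P) :
    ∃ (R : DerivedCategory X.Modules) (s : S ⟶ R) (p : P ⟶ R), Van ((Y ⊔ U : X.Opens) : Set X)ᶜ R ∧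
      VIso Y s ∧ VIso U p := by
  let a : (LT (Y ⊓ U)).obj S ⟶ S := (εT (Y ⊓ U)).app S
  let b : (LT (Y ⊓ U)).obj S ⟶ P := e.hom ≫ (εT (Y ⊓ U)).app P
  have hF := van_LT_compl (Y ⊓ U) S
  have ha : VIso U a := (vIso_ε (Y ⊓ U) S).of_inf_le (W := Y) (hF.mono (compl_le inf_le_left)) hS
    (by rw [inf_comm])
  have hb : VIso Y b := ((vIso_of_isIso e.hom).comp (vIso_ε (Y ⊓ U) P)).of_inf_le (W := U)
    (hF.mono (compl_le inf_le_right)) hP le_rfl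
  obtain ⟨C, c, δ, hT⟩ := distinguished_cocone_triangle a
  obtain ⟨R, p, q, hR⟩ := distinguished_cocone_triangle₂ (δ ≫ b⟦(1 : ℤ)⟧')
  obtain ⟨s, hs, hs'⟩ : ∃ s : S ⟶ R, a ≫ s = b ≫ p ∧ c ≫ 𝟙 C = s ≫ q :=
    complete_distinguished_triangle_morphism₂ _ _ hT hR b (𝟙 C) (Category.id_comp _).symm
  have hC : Van (U : Set X) C := (vIso_iff hT).1 ha
  have hp : VIso U p := (vIso_iff hR).2 hC
  refine ⟨R, s, p, ?_, ?_, hp⟩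
  · have h₁ : ((Y ⊔ U : X.Opens) : Set X)ᶜ ⊆ (Y : Set X)ᶜ := compl_le le_sup_left
    have h₂ : Van ((Y ⊔ U : X.Opens) : Set X)ᶜ C :=
      Van.obj₃ hT ((hF.mono (compl_le inf_le_left)).mono h₁) (hS.mono h₁)
    exact Van.obj₂ hR (hP.mono (compl_le le_sup_right)) h₂
  · let φ : Triangle.mk a c δ ⟶ Triangle.mk p q (δ ≫ b⟦(1 : ℤ)⟧') :=
      { hom₁ := b
        hom₂ := s
        hom₃ := 𝟙 C
        comm₁ := hs
        comm₂ := hs'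
        comm₃ := (Category.id_comp _).symm }
    exact isIso₂_of_isIso₁₃ ((LT Y).mapTriangle.map φ) ((LT Y).map_distinguished _ hT)
      ((LT Y).map_distinguished _ hR) hb (inferInstanceAs (IsIso ((LT Y).map (𝟙 C))))

end

section

open CategoryTheory.Pretriangulated DerivedCategory
open scoped ZeroObject

variable {X : Scheme.{u}} [HasDerivedCategory.{u + 1} X.Modules]
  {A B C E F G : DerivedCategory X.Modules} {V W U : X.Opens} {l : List Γ(X, U)}

/-- Koszul objects detect complexes supported away from `DL l`. -/
theorem exists_koszul (hU : IsAffineOpen U) (l : List Γ(X, U)) (hB : GenU U B) :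
    ∃ K, GenU U K ∧ Van (DL l : Set X) K ∧ (∀ S : Set X, Van S B → Van S K) ∧
      ∀ E : DerivedCategory X.Modules, DQ E → Perp K E → Perp ((ZT (DL l)).obj B) E := by
  induction l generalizing B with
  | nil =>
    have h : Van ((DL ([] : List Γ(X, U)) : X.Opens) : Set X) B := by
      intro n V s x _ hx
      exact absurd hx (by simp [DL])
    have := isIso_π h
    exact ⟨B, hB, h, fun _ h => h, fun E _ hE =>
      (triClosed_perp E).iso (asIso ((πT (DL ([] : List Γ(X, U)))).app B)) hE⟩
  | cons g l ih =>
    obtain ⟨C, p, δ, hT, hC, hgC, hS⟩ := exists_cone_ga hB g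
    obtain ⟨K, hK, hKl, hKS, h⟩ := ih hC
    refine ⟨K, hK, ?_, fun S h => hKS S (hS S h), fun E hE hKE => ?_⟩
    · rw [DL, Opens.coe_sup]
      exact (hKS _ hgC).union hKl
    · have ht : Tors g ((ZT (DL (g :: l))).obj B) E :=
        (triClosed_tors g E).iso (nonempty_ZT_ZT _ _ B).some
          ((gen_ZT_DL hB.bas l).tors_ZT fun V hV =>
            tors_ZT_OT hE g hV.le (hV.isAffineOpen hU))
      have hF : Perp ((ZT (DL (g :: l))).obj C) E :=
        (triClosed_perp E).iso (nonempty_ZT_sup hgC).some.symm (h E hE hKE)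
      have hT' := (ZT (DL (g :: l))).map_distinguished _ hT
      have hT'' : Triangle.mk (ga g (hB.van.ZT (DL (g :: l)))) ((ZT (DL (g :: l))).map p)
          ((ZT (DL (g :: l))).map δ ≫ ((ZT (DL (g :: l))).commShiftIso (1 : ℤ)).hom.app B) ∈
            distTriang _ := by
        rw [← ZT_ga g hB.van]
        exact hT'
      exact ht.perp _ hT'' hF

lemma GenU.restrict (hA : GenU V ((LT V).obj A)) (hW : W ≤ V) : GenU W ((LT W).obj A) := by
  have := isIso_LT_ε hW A
  exact (triClosed_gen _).iso (asIso ((LT W).map ((εT V).app A)))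
    (Gen.LT (fun V' hV' => by rw [hV']; exact inf_eq_left.2 hW) hA)

/-- A locally perfect complex which generates the quasi-coherent complexes on `Y`. -/
structure GeneratesOn (Y : X.Opens) (S : DerivedCategory X.Modules) : Prop where
  van : Van (Y : Set X)ᶜ S
  gen : ∀ E, DQ E → Perp S E → Van (Y : Set X) E
  perfect : ∀ x ∈ Y, ∃ V ≤ Y, x ∈ V ∧ GenU V ((LT V).obj S)

lemma generatesOn_bot : GeneratesOn (⊥ : X.Opens) (0 : DerivedCategory X.Modules) where
  van := van_of_isZero _ (isZero_zero _)
  gen E _ _ n V s x _ hx := absurd hx (by simp)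
  perfect x hx := absurd hx (by simp)

lemma exists_list_DL (hU : IsAffineOpen U) {Y : X.Opens} (hc : IsCompact ((Y ⊓ U : X.Opens) : Set X))
    {P : X.Opens → Prop} (hP : ∀ V W, W ≤ V → P V → P W)
    (h : ∀ x ∈ Y, ∃ V ≤ Y, x ∈ V ∧ P V) :
    ∃ l : List Γ(X, U), DL l = Y ⊓ U ∧ ∀ g ∈ l, P (X.basicOpen g) := by
  have key : ∀ x : ((Y ⊓ U : X.Opens) : Set X), ∃ g : Γ(X, U), X.basicOpen g ≤ Y ⊓ U ∧
      (x : X) ∈ X.basicOpen g ∧ P (X.basicOpen g) := by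
    rintro ⟨x, hxY, hxU⟩
    obtain ⟨V, hV, hxV, hPV⟩ := h x hxY
    obtain ⟨g, hg, hxg⟩ := hU.exists_basicOpen_le ⟨x, hxV⟩ hxU
    exact ⟨g, le_inf (hg.trans hV) (X.basicOpen_le g), hxg, hP _ _ hg hPV⟩
  choose g hg hxg hPg using key
  obtain ⟨t, ht⟩ := hc.elim_finite_subcover (fun x => (X.basicOpen (g x) : Set X))
    (fun x => (X.basicOpen (g x)).2) fun x hx => Set.mem_iUnion.2 ⟨⟨x, hx⟩, hxg ⟨x, hx⟩⟩
  refine ⟨t.toList.map g, le_antisymm ?_ ?_, ?_⟩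
  · refine DL_le_iff.2 fun f hf => ?_
    obtain ⟨x, _, rfl⟩ := List.mem_map.1 hf
    exact hg x
  · intro x hx
    obtain ⟨y, hy, hxy⟩ := Set.mem_iUnion₂.1 (ht hx)
    exact basicOpen_le_DL (List.mem_map.2 ⟨y, Finset.mem_toList.2 hy, rfl⟩) hxy
  · intro f hf
    obtain ⟨x, _, rfl⟩ := List.mem_map.1 hf
    exact hPg x

lemma Perp.biprod_left (h : Perp (A ⊞ B) E) : Perp A E := fun n f => by
  rw [← biprod.inl_desc f (0 : B ⟶ E⟦n⟧), h n (biprod.desc f 0), comp_zero]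

lemma Perp.biprod_right (h : Perp (A ⊞ B) E) : Perp B E := fun n f => by
  rw [← biprod.inr_desc (0 : A ⟶ E⟦n⟧) f, h n (biprod.desc 0 f), comp_zero]

lemma TriClosed.biprod {S : DerivedCategory X.Modules → Prop} (hS : TriClosed S) (hA : S A)
    (hB : S B) : S (A ⊞ B) :=
  hS.ext (binaryBiproductTriangle_distinguished A B) hA hB

lemma TriClosed.map_biprod {S : DerivedCategory X.Modules → Prop} (hS : TriClosed S)
    (hA : S ((LT V).obj A)) (hB : S ((LT V).obj B)) : S ((LT V).obj (A ⊞ B)) :=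
  (hS.comap (LT V)).biprod hA hB

lemma GeneratesOn.sup [QuasiSeparatedSpace X] {Y : X.Opens} {S : DerivedCategory X.Modules}
    (hS : GeneratesOn Y S) (hY : IsCompact (Y : Set X)) (hU : IsAffineOpen U) :
    ∃ S', GeneratesOn (Y ⊔ U) S' := by
  obtain ⟨l, hl, hlS⟩ := exists_list_DL hU
    (QuasiSeparatedSpace.inter_isCompact (Y : Set X) U Y.2 hY U.2 hU.isCompact)
    (P := fun V => GenU V ((LT V).obj S)) (fun V W hW h => h.restrict hW) hS.perfect
  obtain ⟨P, hP, ⟨e⟩⟩ := exists_genU_extension hU hlS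
  rw [hl] at e
  have hSd : Van (Y : Set X)ᶜ (S ⊞ S⟦(1 : ℤ)⟧) :=
    (triClosed_van _).biprod hS.van (hS.van.shift 1)
  obtain ⟨R, s, p, hR, hs, hp⟩ := exists_glue hSd hP.van e
  obtain ⟨K, hK, hKl, hKv, hKE⟩ := exists_koszul hU l (gen_OT (P := fun V => V = U) rfl)
  have hKU : Van (U : Set X)ᶜ K := hKv _ (van_OT U)
  have hKY : Van (Y : Set X) K := (hKl.union hKU).mono fun x hx => by
    rw [hl]
    by_cases hxU : x ∈ U
    · exact Or.inl ⟨hx, hxU⟩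
    · exact Or.inr hxU
  refine ⟨R ⊞ K, ?_, ?_, ?_⟩
  · exact (triClosed_van _).biprod hR (hKU.mono (compl_le le_sup_right))
  · intro E hE h
    have hRE := h.biprod_left
    have hZ : Perp ((ZT (Y ⊓ U)).obj (OT U)) E := by
      rw [← hl]
      exact hKE E hE h.biprod_right
    have hZP : Perp ((ZT (Y ⊓ U)).obj P) E :=
      hP _ ((triClosed_perp E).comap (ZT (Y ⊓ U))) fun V hV => hV ▸ hZ
    have hYP : Van (Y : Set X) ((ZT (Y ⊓ U)).obj P) :=
      ((van_ZT (Y ⊓ U) P).union (hP.van.ZT _)).mono fun x hx => by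
        by_cases hxU : x ∈ U
        · exact Or.inl ⟨hx, hxU⟩
        · exact Or.inr hxU
    have i₁ := isIso_π hYP
    have i₂ : IsIso ((ZT Y).map ((πT (Y ⊓ U)).app P)) :=
      isIso_ZT_map₂ (triangle_ZT (Y ⊓ U) P) ((van_LT_compl _ P).mono (compl_le inf_le_left))
    obtain ⟨C, c, δ, hT⟩ := distinguished_cocone_triangle p
    have hC : Van (Y : Set X)ᶜ C :=
      (((vIso_iff hT).1 hp).union (Van.obj₃ hT (hP.van.mono (compl_le le_sup_right)) hR)).mono
        fun x hx => by
          by_cases hxU : x ∈ U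
          · exact Or.inl hxU
          · exact Or.inr fun h => h.elim hx hxU
    have i₃ : IsIso ((ZT Y).map p) := isIso_ZT_map hT hC
    have hZR : Perp ((ZT Y).obj R) E := (triClosed_perp E).iso
      (@asIso _ _ _ _ _ i₁ ≪≫ (@asIso _ _ _ _ _ i₂).symm ≪≫ @asIso _ _ _ _ _ i₃) hZP
    have hLR : Perp ((LT Y).obj R) E := (triClosed_perp E).fiber (triangle_ZT Y R) hRE hZR
    have hSE : Perp (S ⊞ S⟦(1 : ℤ)⟧) E := (triClosed_perp E).iso (hs.isoLT hSd).some hLR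
    have hYE := hS.gen E hE hSE.biprod_left
    have hUE : Van (U : Set X) E := van_of_perp hE hU
      ((triClosed_perp E).ext (triangle_ZT (Y ⊓ U) (OT U))
        (Perp.of_van (van_LT_compl _ _) (hYE.mono fun x hx => hx.1)) hZ)
    rw [Opens.coe_sup]
    exact hYE.union hUE
  · intro x hx
    rcases hx with hx | hx
    · obtain ⟨V, hV, hxV, hVS⟩ := hS.perfect x hx
      refine ⟨V, hV.trans le_sup_left, hxV, (triClosed_gen _).map_biprod ?_ ?_⟩
      · have i : IsIso ((LT V).map s) := hs.mono hV
        exact (triClosed_gen _).iso (@asIso _ _ _ _ _ i)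
          ((triClosed_gen _).map_biprod hVS
            (((triClosed_gen _).comap (LT V)).shift hVS 1))
      · exact (triClosed_gen _).zero (isZero_LT (hKY.mono hV))
    · refine ⟨U, le_sup_right, hx, (triClosed_gen _).map_biprod ?_ ?_⟩
      · exact (triClosed_gen _).iso (hp.isoLT hP.van).some.symm hP
      · have := isIso_ε hKU
        exact (triClosed_gen _).iso (asIso ((εT U).app K)).symm hK

theorem exists_generatesOn_top [CompactSpace X] [QuasiSeparatedSpace X] :
    ∃ S : DerivedCategory X.Modules, GeneratesOn (⊤ : X.Opens) S := by
  have : ∀ Y : X.Opens, IsCompact (Y : Set X) →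
      IsCompact (Y : Set X) ∧ ∃ S : DerivedCategory X.Modules, GeneratesOn Y S := by
    intro Y hY
    refine compact_open_induction_on (P := fun Y : X.Opens => IsCompact (Y : Set X) ∧
      ∃ S : DerivedCategory X.Modules, GeneratesOn Y S) Y hY ⟨by simp, 0, generatesOn_bot⟩ ?_
    rintro Y hY U ⟨_, S, hS⟩
    refine ⟨?_, hS.sup hY U.2⟩
    rw [Opens.coe_sup]
    exact hY.union U.2.isCompact
  exact (this ⊤ isCompact_univ).2

end

section

open CategoryTheory.Pretriangulated DerivedCategory
open scoped ZeroObject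

variable {X : Scheme.{u}} {F G : X.Modules} {U V W : X.Opens}

lemma mono_restrict (U : X.Opens) (φ : F ⟶ G) [Mono φ] :
    Mono ((Scheme.Modules.restrictFunctor U.ι).map φ) :=
  mono_of_injective _ fun W s hs => injective_of_mono φ (U := U.ι ''ᵁ W) s hs

instance (U : X.Opens) : PreservesColimitsOfSize.{u, u} (Scheme.Modules.restrictFunctor U.ι) :=
  (Scheme.Modules.restrictAdjunction U.ι).leftAdjoint_preservesColimits

lemma preservesFiniteLimits_of_mono {C D : Type*} [Category C] [Category D] [Abelian C] [Abelian D]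
    (F : C ⥤ D) [F.Additive] [PreservesFiniteColimits F]
    (h : ∀ ⦃A B : C⦄ (f : A ⟶ B) [Mono f], Mono (F.map f)) : PreservesFiniteLimits F := by
  refine ((F.exact_tfae.out 0 3 rfl rfl).1 fun S hS => ?_).1
  obtain ⟨h₁, h₂⟩ := ((F.preservesFiniteColimits_tfae.out 0 3 rfl rfl).2 inferInstance) S hS
  have := hS.mono_f
  have := h S.f
  exact { exact := h₁, mono_f := this, epi_g := h₂ }

/-- Restriction to `U`, through the category of modules over the scheme `U`. -/
def restrictionIso (U : X.Opens) : restrictionFunctor X U ≅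
    Scheme.Modules.restrictFunctor U.ι ⋙ (Scheme.Modules.overEquiv U).inverse :=
  (Functor.rightUnitor (restrictionFunctor X U)).symm ≪≫
    Functor.isoWhiskerLeft (restrictionFunctor X U) (Scheme.Modules.overEquiv U).unitIso ≪≫
    (Functor.associator _ _ _).symm ≪≫
    Functor.isoWhiskerRight (Scheme.Modules.overFunctorEquiv U) _

instance (U : X.Opens) : PreservesFiniteColimits (restrictionFunctor X U) :=
  ⟨fun _ _ _ => by
    have := preservesColimits_of_natIso (restrictionIso U).symm
    infer_instance⟩

instance (U : X.Opens) : PreservesFiniteLimits (restrictionFunctor X U) := by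
  apply preservesFiniteLimits_of_mono
  intro A B f _
  have := mono_restrict U f
  have : Mono ((Scheme.Modules.overEquiv U).inverse.map
    ((Scheme.Modules.restrictFunctor U.ι).map f)) := inferInstance
  exact ((MorphismProperty.monomorphisms _).arrow_mk_iso_iff
    (Arrow.isoOfNatIso (restrictionIso U) (Arrow.mk f))).2 this

lemma isIso_restrict_extι (U : X.Opens) (F : X.Modules) :
    IsIso ((restrictionFunctor X U).map (extObjι U F)) := by
  have : IsIso ((Scheme.Modules.restrictFunctor U.ι).map (extObjι U F)) := by
    refine isIso_of_locally _ (fun W s hs => injective_of_mono (extObjι U F) (U := U.ι ''ᵁ W) s hs)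
      fun W s x hx => ?_
    have hW : U.ι ''ᵁ W ≤ U := U.ι_image_le W
    obtain ⟨t, ht⟩ := exists_extι (V := U) (F := F) (U := U.ι ''ᵁ W) (s := s)
      (mem_extSub_of_le hW)
    refine ⟨W, le_rfl, hx, t, ?_⟩
    rw [rs_self]
    exact ht
  have : IsIso ((Scheme.Modules.overEquiv U).inverse.map
    ((Scheme.Modules.restrictFunctor U.ι).map (extObjι U F))) := inferInstance
  exact (NatIso.isIso_map_iff (restrictionIso U) _).2 this

def restrictionUnit (U : X.Opens) :
    (restrictionFunctor X U).obj (OX X) ≅ SheafOfModules.unit (X.ringCatSheaf.over U) :=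
  Iso.refl _

lemma nonempty_free_zero {C : Type*} [Category C] [Abelian C] [HasCoproducts.{u} C] {M N : C}
    (hN : IsZero N) : Nonempty (N ≅ ∐ fun _ : ULift.{u} (Fin 0) => M) := by
  refine ⟨hN.iso ((IsZero.iff_id_eq_zero _).2 ?_)⟩
  exact Sigma.hom_ext _ _ fun i => i.down.elim0

lemma nonempty_free_succ {C : Type*} [Category C] [Abelian C] [HasCoproducts.{u} C] {M N L : C}
    {k : ℕ} (e : N ≅ ∐ fun _ : ULift.{u} (Fin k) => M) (e' : L ≅ M ⊞ N) :
    Nonempty (L ≅ ∐ fun _ : ULift.{u} (Fin (k + 1)) => M) := by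
  let e₁ : N ≅ ∐ fun _ : Fin k => M := e ≪≫ Sigma.whiskerEquiv (f := fun _ : ULift.{u} (Fin k) => M)
    (g := fun _ : Fin k => M) Equiv.ulift fun _ => Iso.refl M
  have h := extendCofanIsColimit (fun _ : Fin (k + 1) => M)
    (coproductIsCoproduct fun _ : Fin k => M) (BinaryBiproduct.isColimit M (∐ fun _ : Fin k => M))
  exact ⟨e' ≪≫ biprod.mapIso (Iso.refl _) e₁ ≪≫
    h.coconePointUniqueUpToIso (coproductIsCoproduct fun _ : Fin (k + 1) => M) ≪≫
    Sigma.whiskerEquiv (f := fun _ : Fin (k + 1) => M) (g := fun _ : ULift.{u} (Fin (k + 1)) => M)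
      Equiv.ulift.symm fun _ => Iso.refl M⟩

/-- The finite direct sums of copies of `OE V`. -/
inductive FinFree (V : X.Opens) : X.Modules → Prop
  | zero {M : X.Modules} : IsZero M → FinFree V M
  | succ {M N : X.Modules} : FinFree V M → Nonempty (N ≅ OE V ⊞ M) → FinFree V N

lemma FinFree.of_iso {M N : X.Modules} (h : FinFree V M) (e : N ≅ M) : FinFree V N := by
  cases h with
  | zero h => exact .zero (h.of_iso e)
  | succ h e' => exact .succ h ⟨e ≪≫ e'.some⟩

lemma FinFree.ext {M : X.Modules} (h : FinFree W M) (hV : V ≤ W) :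
    FinFree V ((extF V).obj M) := by
  induction h with
  | zero h => exact .zero ((extF V).map_isZero h)
  | @succ M N _ e ih =>
    have := isIso_extF_map_extObjLE hV (OX X)
    have i : IsIso (extObjι V (extObj V (OX X))) :=
      isIso_extι_of_vanishes (extF_vanishes V (OX X))
    have := preservesBinaryBiproducts_of_preservesBiproducts (extF (X := X) V)
    exact .succ ih ⟨(extF V).mapIso e.some ≪≫ (extF V).mapBiprod _ _ ≪≫
      biprod.mapIso ((asIso ((extF V).map (extObjLE hV (OX X)))).symm ≪≫
        @asIso _ _ _ _ _ i) (Iso.refl _)⟩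

lemma FinFree.exists_free {M : X.Modules} (h : FinFree V M) :
    ∃ k : ℕ, Nonempty ((restrictionFunctor X V).obj M ≅
      SheafOfModules.free (ULift.{u} (Fin k))) := by
  induction h with
  | zero h => exact ⟨0, nonempty_free_zero ((restrictionFunctor X V).map_isZero h)⟩
  | @succ M N _ e ih =>
    obtain ⟨k, ⟨e'⟩⟩ := ih
    have := isIso_restrict_extι V (OX X)
    have := preservesBinaryBiproducts_of_preservesBiproducts (restrictionFunctor X V)
    exact ⟨k + 1, nonempty_free_succ e' ((restrictionFunctor X V).mapIso e.some ≪≫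
      (restrictionFunctor X V).mapBiprod _ _ ≪≫
      biprod.mapIso (asIso ((restrictionFunctor X V).map (extObjι V (OX X))) ≪≫
        restrictionUnit V) (Iso.refl _))⟩

end

section

open CategoryTheory.Pretriangulated DerivedCategory
open scoped ZeroObject

section

variable {X : Scheme.{u}} {V W : X.Opens} {K L : CochainComplex X.Modules ℤ}

/-- The bounded complexes whose terms become finite direct sums of `OE V` after restriction
to `V`. -/
def StrictOn (V : X.Opens) (K : CochainComplex X.Modules ℤ) : Prop :=
  (∃ a b : ℤ, ∀ i : ℤ, (i < a ∨ b < i) → IsZero (K.X i)) ∧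
    ∀ i : ℤ, FinFree V ((extF V).obj (K.X i))

lemma strictOn_zero (V : X.Opens) : StrictOn V (0 : CochainComplex X.Modules ℤ) := by
  have h : ∀ i, IsZero ((0 : CochainComplex X.Modules ℤ).X i) := fun i =>
    (HomologicalComplex.eval _ _ i).map_isZero (isZero_zero _)
  exact ⟨⟨0, 0, fun i _ => h i⟩, fun i => .zero ((extF V).map_isZero (h i))⟩

lemma StrictOn.mono (h : StrictOn W K) (hV : V ≤ W) : StrictOn V K :=
  ⟨h.1, fun i => ((h.2 i).ext hV).of_iso
    ((@asIso _ _ _ _ _ (isIso_extF_map_extObjι V (K.X i))).symm ≪≫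
      @asIso _ _ _ _ _ (isIso_extF_map_extObjLE hV (K.X i)))⟩

lemma StrictOn.shift (h : StrictOn V K) (n : ℤ) : StrictOn V (K⟦n⟧) := by
  obtain ⟨⟨a, b, h₁⟩, h₂⟩ := h
  exact ⟨⟨a - n, b - n, fun i hi => h₁ (i + n) (by omega)⟩, fun i => h₂ (i + n)⟩

lemma StrictOn.mappingCone (h : StrictOn V K) (f : SC V ⟶ K) :
    StrictOn V (CochainComplex.mappingCone f) := by
  obtain ⟨⟨a, b, h₁⟩, h₂⟩ := h
  have e : ∀ i : ℤ, (CochainComplex.mappingCone f).X i ≅ (SC V).X (i + 1) ⊞ K.X i := fun i =>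
    HomologicalComplex.homotopyCofiber.XIsoBiprod f i (i + 1) rfl
  have h0 : ∀ i : ℤ, i ≠ 0 → IsZero ((SC V).X i) := fun i hi =>
    HomologicalComplex.isZero_single_obj_X _ _ _ _ hi
  refine ⟨⟨min a (-1), max b (-1), fun i hi => ?_⟩, fun i => ?_⟩
  · refine IsZero.of_iso ?_ (e i)
    exact (biprod_isZero_iff _ _).2 ⟨h0 _ (by omega), h₁ _ (by omega)⟩
  · have := preservesBinaryBiproducts_of_preservesBiproducts (extF (X := X) V)
    refine FinFree.of_iso ?_ ((extF V).mapIso (e i) ≪≫ (extF V).mapBiprod _ _)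
    by_cases hi : i + 1 = 0
    · have j : IsIso (extObjι V (extObj V (OX X))) :=
        isIso_extι_of_vanishes (extF_vanishes V (OX X))
      rw [hi]
      exact .succ (h₂ i) ⟨biprod.mapIso ((extF V).mapIso
        (HomologicalComplex.singleObjXSelf (.up ℤ) 0 (OE V)) ≪≫ @asIso _ _ _ _ _ j)
          (Iso.refl _)⟩
    · exact (h₂ i).of_iso (isoZeroBiprod ((extF V).map_isZero (h0 _ hi))).symm

end

section

variable {X : Scheme.{u}} [HasDerivedCategory.{u + 1} X.Modules]
  {A B C : DerivedCategory X.Modules} {V W : X.Opens} {x : X}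

/-- Over `V`, the object `A` is represented by a complex which is strict on `V`. -/
def HasStrict (V : X.Opens) (A : DerivedCategory X.Modules) : Prop :=
  ∃ K : CochainComplex X.Modules ℤ, StrictOn V K ∧ Nonempty ((LT V).obj A ≅ (LT V).obj (Q.obj K))

lemma HasStrict.mono (h : HasStrict W A) (hV : V ≤ W) : HasStrict V A := by
  obtain ⟨K, hK, ⟨e⟩⟩ := h
  exact ⟨K, hK.mono hV, ⟨(@asIso _ _ _ _ _ (isIso_LT_ε hV A)).symm ≪≫ (LT V).mapIso e ≪≫
    @asIso _ _ _ _ _ (isIso_LT_ε hV (Q.obj K))⟩⟩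

lemma HasStrict.of_iso (h : HasStrict V A) (e : (LT V).obj B ≅ (LT V).obj A) :
    HasStrict V B := by
  obtain ⟨K, hK, ⟨e'⟩⟩ := h
  exact ⟨K, hK, ⟨e ≪≫ e'⟩⟩

lemma HasStrict.shift (h : HasStrict V A) (n : ℤ) : HasStrict V (A⟦n⟧) := by
  obtain ⟨K, hK, ⟨e⟩⟩ := h
  exact ⟨K⟦n⟧, hK.shift n, ⟨((LT V).commShiftIso n).app A ≪≫ (shiftFunctor _ n).mapIso e ≪≫
    (((LT V).commShiftIso n).app (Q.obj K)).symm ≪≫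
    (LT V).mapIso ((Q.commShiftIso n).app K).symm⟩⟩

lemma hasStrict_of_isZero (V : X.Opens) (h : IsZero A) : HasStrict V A :=
  ⟨0, strictOn_zero V, ⟨((LT V).map_isZero h).iso
    ((LT V).map_isZero (Q.map_isZero (isZero_zero _)))⟩⟩

/-- `HasStrict` on a neighbourhood of `x`. -/
def LocStrict (x : X) (A : DerivedCategory X.Modules) : Prop :=
  ∃ V : X.Opens, x ∈ V ∧ HasStrict V A

lemma LocStrict.of_iso (h : LocStrict x A) (e : B ≅ A) : LocStrict x B := by
  obtain ⟨V, hx, h⟩ := h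
  exact ⟨V, hx, h.of_iso ((LT V).mapIso e)⟩

lemma LocStrict.shift (h : LocStrict x A) (n : ℤ) : LocStrict x (A⟦n⟧) := by
  obtain ⟨V, hx, h⟩ := h
  exact ⟨V, hx, h.shift n⟩

lemma LocStrict.of_shift (n : ℤ) (h : LocStrict x (A⟦n⟧)) : LocStrict x A :=
  (h.shift (-n)).of_iso ((shiftFunctorCompIsoId _ n (-n) (by simp)).app A).symm

lemma exists_vIso₃ {A' B' C' : DerivedCategory X.Modules} {f : A ⟶ B} {g : B ⟶ C}
    {h : C ⟶ A⟦(1 : ℤ)⟧} {f' : A' ⟶ B'} {g' : B' ⟶ C'} {h' : C' ⟶ A'⟦(1 : ℤ)⟧}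
    (hT : Triangle.mk f g h ∈ distTriang _) (hT' : Triangle.mk f' g' h' ∈ distTriang _)
    {a : A ⟶ A'} {b : B ⟶ B'} (comm : f ≫ b = a ≫ f') (ha : VIso V a) (hb : VIso V b) :
    ∃ c : C ⟶ C', VIso V c := by
  obtain ⟨c, hc₁, hc₂⟩ := complete_distinguished_triangle_morphism _ _ hT hT' a b comm
  exact ⟨c, VIso.hom₃ hT hT' (Triangle.homMk _ _ a b c comm hc₁ hc₂) ha hb⟩

lemma replace_obj₁ {A' : DerivedCategory X.Modules} {f : A ⟶ B} {g : B ⟶ C}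
    {h : C ⟶ A⟦(1 : ℤ)⟧} (hT : Triangle.mk f g h ∈ distTriang _) (e : A' ≅ A) :
    Triangle.mk (e.hom ≫ f) g (h ≫ e.inv⟦1⟧') ∈ distTriang _ := by
  refine isomorphic_distinguished _ hT _
    (Triangle.isoMk _ _ e (Iso.refl _) (Iso.refl _) ?_ ?_ ?_)
  · exact Category.comp_id _
  · exact (Category.comp_id _).trans (Category.id_comp _).symm
  · change (h ≫ e.inv⟦1⟧') ≫ e.hom⟦1⟧' = 𝟙 _ ≫ h
    rw [Category.assoc, ← Functor.map_comp, Iso.inv_hom_id]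
    simp

lemma LocStrict.attach (hA : LocStrict x A) (hx : x ∈ V) {c : OT V ⟶ A} {p : A ⟶ B}
    {δ : B ⟶ (OT V)⟦(1 : ℤ)⟧} (hT : Triangle.mk c p δ ∈ distTriang _) : LocStrict x B := by
  obtain ⟨V', hx', hA⟩ := hA
  obtain ⟨K, hK, ⟨e⟩⟩ := hA.mono (inf_le_right : V ⊓ V' ≤ V')
  obtain ⟨c', hc'⟩ := (vIso_ε (V ⊓ V') A).exists_lift (van_OT _)
    (res (inf_le_left : V ⊓ V' ≤ V) ≫ c)
  obtain ⟨V₂, h, hx₂, z, hz⟩ := exists_rep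
    (c' ≫ e.hom ≫ (εT (V ⊓ V')).app (Q.obj K)) (⟨hx, hx'⟩ : x ∈ V ⊓ V')
  obtain ⟨D, q, γ, hD⟩ := distinguished_cocone_triangle (res h ≫ c')
  have h₁ : (res h ≫ c') ≫ (εT (V ⊓ V')).app A = res (h.trans inf_le_left) ≫ c := by
    rw [← res_res h inf_le_left, Category.assoc, Category.assoc, ← hc']
  have h₂ : (res h ≫ c') ≫ e.hom ≫ (εT (V ⊓ V')).app (Q.obj K) = 𝟙 _ ≫ Q.map (mkC z) := by
    rw [Category.id_comp, ← hz, Category.assoc]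
  obtain ⟨a, ha⟩ := exists_vIso₃ hD hT h₁ (vIso_res _) ((vIso_ε _ A).mono h)
  obtain ⟨b, hb⟩ := exists_vIso₃ hD (mappingCone_triangle_distinguished (mkC z)) h₂
    (vIso_of_isIso (𝟙 _)) ((vIso_of_isIso e.hom).comp ((vIso_ε _ _).mono h))
  exact ⟨V₂, hx₂, _, (hK.mono h).mappingCone _,
    ⟨(@asIso _ _ _ _ _ ha).symm ≪≫ @asIso _ _ _ _ _ hb⟩⟩

/-- The objects whose cones preserve `LocStrict`. -/
lemma triClosed_attach (x : X) : TriClosed fun C : DerivedCategory X.Modules =>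
    ∀ ⦃A B : DerivedCategory X.Modules⦄ (c : C ⟶ A) (p : A ⟶ B) (δ : B ⟶ C⟦(1 : ℤ)⟧),
      Triangle.mk c p δ ∈ distTriang _ → LocStrict x A → LocStrict x B where
  zero {C} hC A B c p δ hT hA := by
    have : IsIso p := (Triangle.isZero₁_iff_isIso₂ _ hT).1 hC
    exact hA.of_iso (asIso p).symm
  shift {C} hC n A B c p δ hT hA := by
    have h := Triangle.shift_distinguished _ hT (-n)
    exact .of_shift (-n) (hC _ _ _ (replace_obj₁ h
      ((shiftFunctorCompIsoId (DerivedCategory X.Modules) n (-n) (by simp)).app C).symm)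
      (hA.shift (-n)))
  ext {T} hT h₁ h₃ A B c p δ hT' hA := by
    obtain ⟨A', q, γ, hq⟩ := distinguished_cocone_triangle (T.mor₁ ≫ c)
    have o := Triangulated.someOctahedron rfl hT hT' hq
    exact h₃ _ _ _ o.mem (h₁ _ _ _ hq hA)

lemma GenU.locStrict (hA : GenU V A) (hx : x ∈ V) : LocStrict x A := by
  obtain ⟨B, p, δ, hT⟩ := distinguished_cocone_triangle (0 : A ⟶ 0)
  have h : LocStrict x B := hA _ (triClosed_attach x)
    (fun W hW A B c p δ hT hA => hA.attach (hW ▸ hx) hT) _ _ _ hT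
      ⟨V, hx, hasStrict_of_isZero V (isZero_zero _)⟩
  have : IsIso δ := (Triangle.isZero₂_iff_isIso₃ _ hT).1 (isZero_zero _)
  exact .of_shift 1 (h.of_iso (asIso δ).symm)

end

end

section

open CategoryTheory.Pretriangulated DerivedCategory
open scoped ZeroObject

variable {X : Scheme.{u}} [HasDerivedCategory.{u + 1} X.Modules]
  [∀ U : X.Opens, HasDerivedCategory.{u + 1} (ModOver X U)]

lemma isIso_restrictComplex_ε (V : X.Opens) (K : CochainComplex X.Modules ℤ) :
    IsIso ((restrictComplex X V).map ((εC V).app K)) := by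
  have (i : ℤ) : IsIso (((restrictComplex X V).map ((εC V).app K)).f i) :=
    isIso_restrict_extι V (K.X i)
  exact HomologicalComplex.Hom.isIso_of_components _

lemma nonempty_restrict_LT (V : X.Opens) (K : CochainComplex X.Modules ℤ) :
    Nonempty ((restrictionFunctor X V).mapDerivedCategory.obj ((LT V).obj (Q.obj K)) ≅
      Q.obj ((restrictComplex X V).obj K)) := by
  have := isIso_restrictComplex_ε V K
  exact ⟨(restrictionFunctor X V).mapDerivedCategory.mapIso ((LTQ V).app K) ≪≫
    (restrictionFunctor X V).mapDerivedCategoryFactors.app ((LC V).obj K) ≪≫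
    Q.mapIso (asIso ((restrictComplex X V).map ((εC V).app K)))⟩

lemma StrictOn.strictlyPerfect {V : X.Opens} {K : CochainComplex X.Modules ℤ}
    (h : StrictOn V K) : StrictlyPerfect X V ((restrictComplex X V).obj K) := by
  obtain ⟨⟨a, b, h₁⟩, h₂⟩ := h
  refine ⟨⟨a, b, fun i hi => (restrictionFunctor X V).map_isZero (h₁ i hi)⟩, fun i => ?_⟩
  obtain ⟨k, ⟨e⟩⟩ := (h₂ i).exists_free
  have := isIso_restrict_extι V (K.X i)
  exact ⟨k, ⟨(asIso ((restrictionFunctor X V).map (extObjι V (K.X i)))).symm ≪≫ e⟩⟩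

lemma isPerfect_of_locStrict {S : CochainComplex X.Modules ℤ}
    (h : ∀ x, LocStrict x (Q.obj S)) : IsPerfect X S := by
  choose V hV K hK e using h
  refine ⟨X, V, eq_top_iff.2 fun x _ => Opens.mem_iSup.2 ⟨x, hV x⟩, fun x =>
    ⟨_, (hK x).strictlyPerfect, ⟨?_⟩⟩⟩
  exact (nonempty_restrict_LT (V x) S).some.symm ≪≫
    (restrictionFunctor X (V x)).mapDerivedCategory.mapIso (e x).some ≪≫
    (nonempty_restrict_LT (V x) (K x)).some

end

section

open CategoryTheory.Pretriangulated DerivedCategory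
open scoped ZeroObject

variable {X : Scheme.{u}} [HasDerivedCategory.{u + 1} X.Modules]
  {A E F : DerivedCategory X.Modules} {V W U D : X.Opens}

lemma ga_add_OT (a b : Γ(X, V)) :
    ga (a + b) (van_OT V) = ga a (van_OT V) + ga b (van_OT V) := by
  have h : actObj (a + b) (OX X) = actObj a (OX X) + actObj b (OX X) := by
    apply (secEquiv V (OE V)).injective
    rw [map_add, ← Category.comp_id (actObj (a + b) (OX X)), ← Category.comp_id (actObj a (OX X)),
      ← Category.comp_id (actObj b (OX X)), secEquiv_act, secEquiv_act, secEquiv_act, add_smul]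
  rw [← OTmap_actObj, ← OTmap_actObj, ← OTmap_actObj, h]
  exact (((HomologicalComplex.single X.Modules (.up ℤ) 0) ⋙ Q).map_add)

lemma res_eq_of_vIso (hD : D ≤ V) : ∃ (r : OT D ⟶ (LT D).obj (OT V))
    (s : (LT D).obj (OT V) ⟶ OT D), r ≫ (εT D).app (OT V) = res hD ∧
      s ≫ res hD = (εT D).app (OT V) ∧ r ≫ s = 𝟙 _ := by
  obtain ⟨r, hr⟩ := (vIso_ε D (OT V)).exists_lift (van_OT D) (res hD)
  obtain ⟨s, hs⟩ := (vIso_res hD).exists_lift (van_LT_compl D (OT V)) ((εT D).app (OT V))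
  exact ⟨r, s, hr, hs, (vIso_res hD).hom_ext (van_OT D) (by
    rw [Category.assoc, hs, Category.id_comp]; exact hr)⟩

lemma Tors.exists_ga_comp_eq_zero {g : Γ(X, V)} (h : Tors g ((ZT D).obj (OT V)) E)
    (hD : D ≤ V) (φ : OT V ⟶ E) (h0 : res hD ≫ φ = 0) :
    ∃ k : ℕ, ga (g ^ k) (van_OT V) ≫ φ = 0 := by
  obtain ⟨r, s, hr, hs, hrs⟩ := res_eq_of_vIso hD
  let e := (shiftFunctorZero (DerivedCategory X.Modules) ℤ).app E
  obtain ⟨k, hk⟩ := h.eq_zero_of_LT (van_OT V) 0 (φ ≫ e.inv) (by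
    rw [← hs, Category.assoc, ← Category.assoc (res hD), h0, zero_comp, comp_zero])
  refine ⟨k, ?_⟩
  rwa [← cancel_mono e.inv, zero_comp, Category.assoc]

lemma Tors.exists_res_comp_eq {g : Γ(X, V)} (h : Tors g ((ZT D).obj (OT V)) E)
    (hD : D ≤ V) (χ : OT D ⟶ E) :
    ∃ (k : ℕ) (ψ : OT V ⟶ E), res hD ≫ ψ =
      ga (g ^ k) ((van_OT D).mono (compl_le hD)) ≫ χ := by
  obtain ⟨r, s, hr, hs, hrs⟩ := res_eq_of_vIso hD
  let e := (shiftFunctorZero (DerivedCategory X.Modules) ℤ).app E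
  obtain ⟨k, ψ, hψ⟩ := h.exists_extension (van_OT V) 0 (s ≫ χ ≫ e.inv)
  refine ⟨k, ψ ≫ e.hom, ?_⟩
  rw [← hr, Category.assoc, ← Category.assoc ((εT D).app (OT V))]
  erw [hψ]
  rw [Category.assoc, Category.assoc, Category.assoc, Iso.inv_hom_id, Category.comp_id,
    ← Category.assoc, ← ga_nat _ ((van_OT D).mono (compl_le hD)), Category.assoc,
    ← Category.assoc r, hrs, Category.id_comp]

/-- Over affine open subsets of `U`, morphisms to `E` satisfy the torsion condition. -/
def TorsOn (U : X.Opens) (E : DerivedCategory X.Modules) : Prop :=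
  ∀ V ≤ U, IsAffineOpen V → ∀ g : Γ(X, V), Tors g ((ZT (X.basicOpen g)).obj (OT V)) E

lemma TorsOn.shift (h : TorsOn U E) (n : ℤ) : TorsOn U (E⟦n⟧) := fun V hV hVa g =>
  (triClosed_tors' g (h V hV hVa g).1).shift (h V hV hVa g) n

lemma GenU.torsOn (hA : GenU U ((LT U).obj A)) : TorsOn U A := by
  intro V hV hVa g
  have hC : Van (V : Set X)ᶜ ((ZT (X.basicOpen g)).obj (OT V)) := (van_OT V).ZT _
  have h : Tors g ((ZT (X.basicOpen g)).obj (OT V)) (OT U) :=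
    (tors_ZT_OT (dq_OT_top (X := X)) g le_rfl hVa).of_vIso'
      ((vIso_res (le_top : U ≤ ⊤)).mono hV) hC
  have h' : Tors g ((ZT (X.basicOpen g)).obj (OT V)) ((LT U).obj A) :=
    hA _ (triClosed_tors' g hC) (by rintro _ rfl; exact h)
  exact h'.of_vIso ((vIso_ε U A).mono hV) hC

namespace TorsOn

lemma cl_injective (h : TorsOn U E) (hV : V ≤ U) (hVa : IsAffineOpen V) (φ : OT V ⟶ E) (h0 : cl φ = 0) :
    φ = 0 := by
  refine eq_zero_of_locally_zero hVa φ (fun x hx => locally_zero_of_cl φ h0 hx) ?_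
  intro W hW hWa a b hab ha hb
  obtain ⟨k, hk⟩ := (h W (hW.trans hV) hWa a).exists_ga_comp_eq_zero (X.basicOpen_le a)
    (res hW ≫ φ) (by rwa [← Category.assoc, res_res])
  obtain ⟨l, hl⟩ := (h W (hW.trans hV) hWa b).exists_ga_comp_eq_zero (X.basicOpen_le b)
    (res hW ≫ φ) (by rwa [← Category.assoc, res_res])
  obtain ⟨c, d, hcd⟩ := hab.pow (m := k) (n := l)
  rw [← Category.id_comp (res hW ≫ φ), ← ga_one (van_OT W), ← hcd, ga_add_OT, ga_mul, ga_mul,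
    Preadditive.add_comp, Category.assoc, hk, Category.assoc, hl, comp_zero, comp_zero, add_zero]

lemma exists_local_cl (hV : IsAffineOpen V) (t : Γ(H0 E, V)) {x : X} (hx : x ∈ V) :
    ∃ (f : Γ(X, V)), x ∈ X.basicOpen f ∧ ∃ φ : OT (X.basicOpen f) ⟶ E,
      secEquiv _ (H0 E) (cl φ) = rs (X.basicOpen_le f) t := by
  obtain ⟨V', h', hx', φ, hφ⟩ := exists_cl ((secEquiv V (H0 E)).symm t) hx
  obtain ⟨f, hf, hxf⟩ := hV.exists_basicOpen_le ⟨x, hx'⟩ hx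
  refine ⟨f, hxf, res hf ≫ φ, ?_⟩
  rw [cl_res, hφ]
  erw [secEquiv_LE]
  rw [AddEquiv.apply_symm_apply, rs_rs]

lemma exists_smul_eq_zero (h : TorsOn U E) (hV : V ≤ U) (hVa : IsAffineOpen V) (g : Γ(X, V)) (t : Γ(H0 E, V))
    (ht : rs (X.basicOpen_le g) t = 0) : ∃ m : ℕ, g ^ m • t = 0 := by
  suffices H : ∃ m : ℕ, ∀ x ∈ (V : Set X), ∃ (W : X.Opens) (hW : W ≤ V), x ∈ W ∧
      rs hW (g ^ m • t) = 0 by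
    obtain ⟨m, hm⟩ := H
    exact ⟨m, eq_zero_of_locally _ hm⟩
  refine hVa.isCompact.induction_on (p := fun s => ∃ m : ℕ, ∀ x ∈ s, ∃ (W : X.Opens) (hW : W ≤ V),
    x ∈ W ∧ rs hW (g ^ m • t) = 0) ⟨0, by simp⟩ ?_ ?_ ?_
  · rintro s s' hs ⟨m, hm⟩
    exact ⟨m, fun x hx => hm x (hs hx)⟩
  · have key (m l : ℕ) (x : X) : (∃ (W : X.Opens) (hW : W ≤ V), x ∈ W ∧ rs hW (g ^ m • t) = 0) →
        ∃ (W : X.Opens) (hW : W ≤ V), x ∈ W ∧ rs hW (g ^ (l + m) • t) = 0 := by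
      rintro ⟨W, hW, hx, h0⟩
      exact ⟨W, hW, hx, by rw [pow_add, mul_smul, rs_smul, h0, smul_zero]⟩
    rintro s s' ⟨m, hm⟩ ⟨l, hl⟩
    refine ⟨l + m, ?_⟩
    rintro x (hx | hx)
    · exact key m l x (hm x hx)
    · rw [add_comm]
      exact key l m x (hl x hx)
  · intro x hx
    obtain ⟨f, hxf, φ, hφ⟩ := exists_local_cl hVa t hx
    have hf := X.basicOpen_le f
    have hle : X.basicOpen (rf hf g) ≤ X.basicOpen g := (inf_basicOpen hf g).trans_le inf_le_right
    obtain ⟨k, hk⟩ := (h _ (hf.trans hV) (hVa.basicOpen f) (rf hf g)).exists_ga_comp_eq_zero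
      (X.basicOpen_le (rf hf g)) φ (by
        refine h.cl_injective ((X.basicOpen_le (rf hf g)).trans (hf.trans hV))
          ((hVa.basicOpen f).basicOpen _) _ ((secEquiv _ (H0 E)).injective ?_)
        have h0 : rs hle (rs (X.basicOpen_le g) t) = 0 := by rw [ht, map_zero]
        rw [cl_res, hφ, map_zero, rs_rs, ← h0, rs_rs])
    refine ⟨X.basicOpen f, mem_nhdsWithin_of_mem_nhds ((X.basicOpen f).isOpen.mem_nhds hxf), k,
      fun y hy => ⟨_, hf, hy, ?_⟩⟩
    have h1 := cl_ga le_rfl (rf hf g ^ k) (van_OT _) φ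
    rw [hk, cl_zero, map_zero, rf_self] at h1
    rw [rs_smul, ← hφ, map_pow, ← h1]

lemma cl_surjective (h : TorsOn U E) (hV : V ≤ U) (hVa : IsAffineOpen V) (t : Γ(H0 E, V)) :
    ∃ φ : OT V ⟶ E, secEquiv V (H0 E) (cl φ) = t := by
  let I : Ideal Γ(X, V) :=
    { carrier := {a | ∃ φ : OT V ⟶ E, secEquiv V (H0 E) (cl φ) = a • t}
      zero_mem' := ⟨0, by rw [cl_zero, map_zero, zero_smul]⟩
      add_mem' := by
        rintro a b ⟨φ, hφ⟩ ⟨ψ, hψ⟩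
        exact ⟨φ + ψ, by rw [cl_add, map_add, hφ, hψ, add_smul]⟩
      smul_mem' := by
        rintro r a ⟨φ, hφ⟩
        exact ⟨ga r (van_OT V) ≫ φ, by rw [cl_ga le_rfl, hφ, rf_self, smul_smul]; rfl⟩ }
  suffices hI : (1 : Γ(X, V)) ∈ I by
    obtain ⟨φ, hφ⟩ := hI
    exact ⟨φ, by rw [hφ, one_smul]⟩
  rw [← Ideal.eq_top_iff_one, eq_top_iff,
    ← (hVa.self_le_iSup_basicOpen_iff (s := (I : Set Γ(X, V)))).1 ?_, Ideal.span_le]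
  intro x hx
  obtain ⟨f, hxf, χ, hχ⟩ := exists_local_cl hVa t hx
  obtain ⟨k, ψ, hψ⟩ := (h V hV hVa f).exists_res_comp_eq (X.basicOpen_le f) χ
  obtain ⟨m, hm⟩ := h.exists_smul_eq_zero hV hVa f (secEquiv V (H0 E) (cl ψ) - f ^ k • t) (by
    rw [map_sub, ← cl_res, hψ, cl_ga (X.basicOpen_le f), hχ, rs_smul, sub_self])
  have hmem : f ^ (m + k) ∈ I := ⟨ga (f ^ m) (van_OT V) ≫ ψ, by
    rw [smul_sub, sub_eq_zero] at hm
    rw [cl_ga le_rfl, rf_self, hm, pow_add, mul_smul]⟩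
  refine Opens.mem_iSup.2 ⟨⟨f ^ (m + k + 1), pow_succ' f (m + k) ▸ I.mul_mem_left _ hmem⟩, ?_⟩
  rwa [X.basicOpen_pow _ (Nat.succ_pos _)]

lemma localizesAt (h : TorsOn U E) (hV : V ≤ U) (hVa : IsAffineOpen V) (g : Γ(X, V)) :
    LocalizesAt (H0 E) (X.basicOpen_le g) g where
  torsion t ht := h.exists_smul_eq_zero hV hVa g t ht
  extend t := by
    obtain ⟨χ, rfl⟩ := h.cl_surjective ((X.basicOpen_le g).trans hV) (hVa.basicOpen g) t
    obtain ⟨k, ψ, hψ⟩ := (h V hV hVa g).exists_res_comp_eq (X.basicOpen_le g) χ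
    exact ⟨k, secEquiv V (H0 E) (cl ψ), by rw [← cl_res, hψ, cl_ga (X.basicOpen_le g), map_pow]⟩

end TorsOn

end

section

open CategoryTheory.Pretriangulated DerivedCategory
open scoped ZeroObject

section Modules

variable {X : Scheme.{u}} {F : X.Modules} {U : X.Opens}

/-- Transport of a presentation along an isomorphism. -/
def presentationOfIso {M N : X.Modules} (e : M ≅ N) (P : M.Presentation) : N.Presentation :=
  @SheafOfModules.Presentation.ofIsIso.{u, u, u} _ _ _ _ _ _ _ _ e.hom (e.isIso_hom) P

lemma nonempty_presentation_of_isQuasicoherent {R : CommRingCat.{u}} (M : (Spec R).Modules)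
    [M.IsQuasicoherent] : Nonempty M.Presentation :=
  have := (isQuasicoherent_iff_isIso_fromTildeΓ M).1 inferInstance
  ⟨presentationOfIso (asIso M.fromTildeΓ)
    (presentationTilde.{u} _ .univ (by simp) _ (Submodule.span_eq _))⟩

lemma isQuasicoherent_of_iso {F G : X.Modules} (e : F ≅ G) (hF : F.IsQuasicoherent) :
    G.IsQuasicoherent :=
  ObjectProperty.prop_of_iso (SheafOfModules.isQuasicoherent.{u} X.ringCatSheaf) (X := F) (Y := G)
    e hF

/-- `fromSpec` becomes the inclusion of `U` after composing with `U ≅ Spec Γ(X, U)`. -/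
def restrictFromSpecIso (hU : IsAffineOpen U) :
    (F.restrict hU.fromSpec).restrict hU.isoSpec.hom ≅ F.restrict U.ι :=
  ((Scheme.Modules.restrictFunctorComp hU.isoSpec.hom hU.fromSpec).symm ≪≫
    Scheme.Modules.restrictFunctorCongr (by simp)).app F

instance instPreservesColimitsOverEquivInverse (U : X.Opens) : PreservesColimitsOfSize.{u, u} (Scheme.Modules.overEquiv U).inverse :=
  inferInstance

/-- The inverse of `overEquiv` sends the structure sheaf to the structure sheaf. -/
def overEquivInverseUnit (U : X.Opens) :
    (Scheme.Modules.overEquiv U).inverse.obj (SheafOfModules.unit (U : Scheme).ringCatSheaf) ≅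
      SheafOfModules.unit (X.ringCatSheaf.over U) :=
  (Scheme.Modules.overEquiv U).inverse.mapIso (Scheme.Modules.restrictUnitIso U.ι).symm ≪≫
    ((restrictionIso U).app (OX X)).symm ≪≫ restrictionUnit U

lemma isQuasicoherent_over_of_localizesAt (hU : IsAffineOpen U)
    (h : ∀ g : Γ(X, U), LocalizesAt F (X.basicOpen_le g) g) :
    ((restrictionFunctor X U).obj F).IsQuasicoherent := by
  have := (isQuasicoherent_restrict_fromSpec_iff hU).2 h
  obtain ⟨P⟩ := nonempty_presentation_of_isQuasicoherent (F.restrict hU.fromSpec)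
  let P₁ : (F.restrict U.ι).Presentation :=
    presentationOfIso (restrictFromSpecIso hU) (Scheme.Modules.presentationRestrict hU.isoSpec.hom P)
  let P₂ := @SheafOfModules.Presentation.map.{u} _ _ _ _ _ _ _ _ _ _ _ _ _ P₁
    (Scheme.Modules.overEquiv U).inverse
    (by exact instPreservesColimitsOverEquivInverse U) (overEquivInverseUnit U).symm
  exact (SheafOfModules.Presentation.ofIsIso.{u, u, u} ((restrictionIso U).app F).inv
    P₂).isQuasicoherent

lemma isQuasicoherent_of_localizesAt (h : ∀ x : X, ∃ U : X.Opens, x ∈ U ∧ IsAffineOpen U ∧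
    ∀ g : Γ(X, U), LocalizesAt F (X.basicOpen_le g) g) : F.IsQuasicoherent := by
  choose U hx hU h using h
  have (x : X) : (SheafOfModules.over F (U x)).IsQuasicoherent :=
    isQuasicoherent_over_of_localizesAt (hU x) (h x)
  refine SheafOfModules.IsQuasicoherent.of_coversTop F U ((Opens.coversTop_iff _ _).2 ?_)
  exact TopologicalSpace.IsOpenCover.mk (eq_top_iff.2 fun x _ => Opens.mem_iSup.2 ⟨x, hx x⟩)

end Modules

end

section

open CategoryTheory.Pretriangulated DerivedCategory
open scoped ZeroObject

variable {X : Scheme.{u}} [HasDerivedCategory.{u + 1} X.Modules]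
  {S E : DerivedCategory X.Modules} {V W : X.Opens}

lemma LocStrict.of_LT {x : X} (h : LocStrict x ((LT V).obj S)) (hx : x ∈ V) : LocStrict x S := by
  obtain ⟨W, hxW, hW⟩ := h
  have := isIso_LT_ε (inf_le_right : W ⊓ V ≤ V) S
  exact ⟨W ⊓ V, ⟨hxW, hx⟩, (hW.mono inf_le_left).of_iso
    (@asIso _ _ _ _ _ (isIso_LT_ε (inf_le_right : W ⊓ V ≤ V) S)).symm⟩

lemma GeneratesOn.locStrict (hS : GeneratesOn (⊤ : X.Opens) S) (x : X) : LocStrict x S := by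
  obtain ⟨V, -, hx, hV⟩ := hS.perfect x trivial
  exact (hV.locStrict hx).of_LT hx

lemma GeneratesOn.isQuasicoherent_homology (hS : GeneratesOn (⊤ : X.Opens) S) (n : ℤ) :
    ((homologyFunctor X.Modules n).obj S).IsQuasicoherent := by
  refine isQuasicoherent_of_localizesAt fun x => ?_
  obtain ⟨V, -, hx, hV⟩ := hS.perfect x trivial
  obtain ⟨U, hUV, hxU, hU⟩ := exists_affine_le hx
  exact ⟨U, hxU, hU, fun g => ((hV.torsOn.shift n).localizesAt hUV hU g).of_iso
    (hShift S n 0 n (add_zero n))⟩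

lemma GeneratesOn.exists_ne_zero (hS : GeneratesOn (⊤ : X.Opens) S) (hE : DQ E)
    (hE₀ : ¬ IsZero E) : ∃ (n : ℤ) (f : S⟦n⟧ ⟶ E), f ≠ 0 := by
  by_contra! h
  refine hE₀ (Van.isZero (hS.gen E hE fun n f => ?_))
  obtain ⟨n, rfl⟩ := neg_surjective n
  rw [← (tr n).apply_symm_apply f, tr_eq_zero_iff]
  exact h n _

end

end LN

open LN DerivedCategory in
/-- **Theorem 4.2 (first part) of Lipman–Neeman** (after Bondal–van den Bergh).  For any
quasi-compact quasi-separated scheme `X`, the category `D_qc(X)` has a perfect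
generator: there is a perfect complex `S` of `O_X`-modules such that for every nonzero
`E` in `D_qc(X)` there are an `n ∈ ℤ` and a nonzero morphism `S[n] ⟶ E`. -/
theorem statement_1 (X : Scheme.{u}) [CompactSpace X] [QuasiSeparatedSpace X]
    [HasDerivedCategory.{u + 1} X.Modules]
    [∀ U : X.Opens, HasDerivedCategory.{u + 1} (ModOver X U)] :
    ∃ S : CochainComplex X.Modules ℤ, MemDqc X S ∧ IsPerfect X S ∧
      ∀ E : DerivedCategory X.Modules,
        (∀ n : ℤ, ((homologyFunctor X.Modules n).obj E).IsQuasicoherent) →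
        ¬ IsZero E →
        ∃ (n : ℤ) (f : (Q.obj S)⟦n⟧ ⟶ E), f ≠ 0 := by
  obtain ⟨S, hS⟩ := exists_generatesOn_top (X := X)
  let e : Q.obj (Q.objPreimage S) ≅ S := Q.objObjPreimageIso S
  refine ⟨Q.objPreimage S, fun n => ?_, isPerfect_of_locStrict fun x => (hS.locStrict x).of_iso e,
    fun E hE hE₀ => ?_⟩
  · exact isQuasicoherent_of_iso
      (((homologyFunctor X.Modules n).mapIso e).symm ≪≫
        (homologyFunctorFactors X.Modules n).app (Q.objPreimage S))
      (hS.isQuasicoherent_homology n)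
  · obtain ⟨n, f, hf⟩ := hS.exists_ne_zero (fun n => qc_of_isQuasicoherent (hE n)) hE₀
    exact ⟨n, e.hom⟦n⟧' ≫ f, fun h => hf ((cancel_epi (e.hom⟦n⟧')).1 (h.trans comp_zero.symm))⟩
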